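/- arXiv:1902.05903 — 2 statements merged into one kernel-verified Lean document; each statement's English description precedes it below -/
import Mathlib

section
/- Let s ≥ 1 and r ≥ 3 be fixed integers, and let (v_i, e_i) for 1 ≤ i ≤ s be fixed integers satisfying v_i ≥ r+1 and e_i ≥ 2 for all i, with e₁ ≥ 3, gcd(e₁-1, e₁r-v₁) = 1, and (e₁r-v₁)/(e₁-1) < (e_i r - v_i)/(e_i - 1) for all 2 ≤ i ≤ s. Then there exist a constant c > 0 and an integer N such that for every n ≥ N there exists an r-graph on vertex set [n] with at least c · n^{(e₁r-v₁)/(e₁-1)} · (log n)^{1/(e₁-1)} edges which is 𝒢_r(v_i, e_i)-free for every 1 ≤ i ≤ s. -/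
/-- Expectation of `f` over a random subset of `Ω` with density `θ`. -/
noncomputable def bexp {β : Type*} [DecidableEq β] (Ω : Finset β) (θ : ℝ)
    (f : Finset β → ℝ) : ℝ :=
  ∑ C ∈ Ω.powerset, (θ ^ C.card * (1 - θ) ^ (Ω \ C).card) * f C

section bexpSection
variable {β : Type*} [DecidableEq β]

lemma bexp_add (Ω : Finset β) (θ : ℝ) (f g : Finset β → ℝ) :
    bexp Ω θ (fun C => f C + g C) = bexp Ω θ f + bexp Ω θ g := by
  simp only [bexp, mul_add, Finset.sum_add_distrib]

lemma bexp_sub (Ω : Finset β) (θ : ℝ) (f g : Finset β → ℝ) :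
    bexp Ω θ (fun C => f C - g C) = bexp Ω θ f - bexp Ω θ g := by
  simp only [bexp, mul_sub, Finset.sum_sub_distrib]

lemma bexp_const_mul (Ω : Finset β) (θ : ℝ) (c : ℝ) (f : Finset β → ℝ) :
    bexp Ω θ (fun C => c * f C) = c * bexp Ω θ f := by
  simp only [bexp, Finset.mul_sum]
  exact Finset.sum_congr rfl fun _ _ => by ring

lemma bexp_sum {γ : Type*} (Ω : Finset β) (θ : ℝ) (s : Finset γ) (f : γ → Finset β → ℝ) :
    bexp Ω θ (fun C => ∑ i ∈ s, f i C) = ∑ i ∈ s, bexp Ω θ (f i) := by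
  simp only [bexp, Finset.mul_sum]
  exact Finset.sum_comm

lemma bexp_mono (Ω : Finset β) {θ : ℝ} (h0 : 0 ≤ θ) (h1 : θ ≤ 1) {f g : Finset β → ℝ}
    (h : ∀ C ⊆ Ω, f C ≤ g C) : bexp Ω θ f ≤ bexp Ω θ g := by
  refine Finset.sum_le_sum fun C hC => ?_
  have : 0 ≤ 1 - θ := by linarith
  exact mul_le_mul_of_nonneg_left (h C (Finset.mem_powerset.1 hC)) (by positivity)

lemma bexp_ind (Ω : Finset β) (θ : ℝ) (A B : Finset β) (hA : A ⊆ Ω) (hB : B ⊆ Ω)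
    (hAB : Disjoint A B) :
    bexp Ω θ (fun C => if A ⊆ C ∧ Disjoint B C then 1 else 0)
      = θ ^ A.card * (1 - θ) ^ B.card := by
  have key := Finset.prod_add (fun i => if i ∈ B then 0 else θ)
    (fun i => if i ∈ A then 0 else 1 - θ) Ω
  have lhs : ∏ i ∈ Ω, ((if i ∈ B then 0 else θ) + (if i ∈ A then 0 else 1 - θ))
      = θ ^ A.card * (1 - θ) ^ B.card := by
    have h1 : ∀ i ∈ Ω, ((if i ∈ B then 0 else θ) + (if i ∈ A then 0 else 1 - θ))
        = (if i ∈ A then θ else 1) * (if i ∈ B then 1 - θ else 1) := by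
      intro i _
      by_cases ha : i ∈ A
      · have hb : i ∉ B := Finset.disjoint_left.1 hAB ha
        simp [ha, hb]
      · by_cases hb : i ∈ B <;> simp [ha, hb]
    rw [Finset.prod_congr rfl h1, Finset.prod_mul_distrib, Finset.prod_ite_mem,
      Finset.prod_ite_mem, Finset.inter_eq_right.2 hA, Finset.inter_eq_right.2 hB]
    simp
  rw [← lhs, key, bexp]
  refine Finset.sum_congr rfl fun C hC => ?_
  split_ifs with h
  · have e1 : ∏ i ∈ C, (if i ∈ B then 0 else θ) = θ ^ C.card := by
      rw [Finset.prod_congr rfl (g := fun _ => θ)]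
      · simp
      · intro i hi
        simp [Finset.disjoint_right.1 h.2 hi]
    have e2 : ∏ i ∈ Ω \ C, (if i ∈ A then 0 else 1 - θ) = (1 - θ) ^ (Ω \ C).card := by
      rw [Finset.prod_congr rfl (g := fun _ => 1 - θ)]
      · simp
      · intro i hi
        have : i ∉ A := fun hh => (Finset.mem_sdiff.1 hi).2 (h.1 hh)
        simp [this]
    rw [e1, e2, mul_one]
  · rw [mul_zero]
    symm
    rw [not_and_or] at h
    rcases h with h | h
    · obtain ⟨x, hx, hxC⟩ := Finset.not_subset.1 h
      exact mul_eq_zero_of_right _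
        (Finset.prod_eq_zero (Finset.mem_sdiff.2 ⟨hA hx, hxC⟩) (by simp [hx]))
    · obtain ⟨x, hx, hxC⟩ := Finset.not_disjoint_iff.1 h
      exact mul_eq_zero_of_left (Finset.prod_eq_zero hxC (by simp [hx])) _

lemma bexp_one (Ω : Finset β) (θ : ℝ) : bexp Ω θ (fun _ => 1) = 1 := by
  have := bexp_ind Ω θ ∅ ∅ (by simp) (by simp) (by simp)
  simpa using this

lemma bexp_exists (Ω : Finset β) {θ : ℝ} (h0 : 0 ≤ θ) (h1 : θ ≤ 1) (f : Finset β → ℝ) :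
    ∃ C ⊆ Ω, bexp Ω θ f ≤ f C := by
  obtain ⟨C, hC, hmax⟩ := Finset.exists_max_image Ω.powerset f ⟨∅, by simp⟩
  refine ⟨C, Finset.mem_powerset.1 hC, ?_⟩
  calc bexp Ω θ f ≤ bexp Ω θ (fun _ => f C * 1) :=
        bexp_mono Ω h0 h1 fun D hD => by
          rw [mul_one]; exact hmax D (Finset.mem_powerset.2 hD)
    _ = f C := by rw [bexp_const_mul, bexp_one, mul_one]

end bexpSection

/-- A linear, triangle-free hypergraph with edges of size at least two. -/
def GoodHG {ι : Type*} [DecidableEq ι] (U : Finset ι) (E : Finset (Finset ι)) : Prop :=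
  (∀ e ∈ E, e ⊆ U ∧ 2 ≤ e.card) ∧
  (∀ e ∈ E, ∀ f ∈ E, ∀ x y, x ∈ e → x ∈ f → y ∈ e → y ∈ f → x ≠ y → e = f) ∧
  (∀ e ∈ E, ∀ f ∈ E, ∀ g ∈ E, ∀ x y z, x ∈ e → x ∈ f → y ∈ f → y ∈ g → z ∈ g → z ∈ e →
    x ≠ y → y ≠ z → z ≠ x → e = f ∨ f = g ∨ g = e)

/-- Cost of an edge of which `j` vertices remain. -/
noncomputable def ecost (a : ℝ) (b : ℕ → ℝ) (j : ℕ) : ℝ :=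
  if j = 0 then 1 else if j = 1 then a else b j

lemma ecost_nonneg {a : ℝ} {b : ℕ → ℝ} (ha : 0 ≤ a) (hb : ∀ j, 0 ≤ b j) (j : ℕ) :
    0 ≤ ecost a b j := by
  unfold ecost
  split_ifs
  · norm_num
  · exact ha
  · exact hb j

section stepSection
variable {ι : Type*} [DecidableEq ι]

lemma detStep (U : Finset ι) (E : Finset (Finset ι)) (hG : GoodHG U E)
    (C Sv : Finset ι) (hC : C ⊆ U) (hSv : Sv ⊆ U) (hd : Disjoint C Sv)
    (a : ℝ) (b : ℕ → ℝ) (ha : 0 ≤ a) (hb : ∀ j, 0 ≤ b j)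
    (IH : ∀ (U' : Finset ι) (E' : Finset (Finset ι)), GoodHG U' E' →
      ∃ I ⊆ U', (∀ e ∈ E', ¬ e ⊆ I) ∧ a * U'.card - ∑ e ∈ E', b e.card ≤ (I.card : ℝ)) :
    ∃ I ⊆ U, (∀ e ∈ E, ¬ e ⊆ I) ∧
      (C.card : ℝ) + a * Sv.card
        - ∑ e ∈ E, (if e \ C ⊆ Sv then ecost a b (e \ C).card else 0) ≤ (I.card : ℝ) := by
  obtain ⟨hE, hlin, htri⟩ := hG
  have hpick : ∀ e : Finset ι, ∃ x : Option ι, e ∈ E → ∃ y ∈ e, x = some y := by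
    intro e
    by_cases he : e ∈ E
    · have : e.Nonempty := Finset.card_pos.1 (by have := (hE e he).2; omega)
      obtain ⟨y, hy⟩ := this
      exact ⟨some y, fun _ => ⟨y, hy, rfl⟩⟩
    · exact ⟨none, fun h => absurd h he⟩
  choose pk hpk using hpick
  set E0 := E.filter (fun e => e \ C ⊆ Sv ∧ (e \ C).card = 0) with hE0
  set E1 := E.filter (fun e => e \ C ⊆ Sv ∧ (e \ C).card = 1) with hE1
  set E2 := E.filter (fun e => e \ C ⊆ Sv ∧ 2 ≤ (e \ C).card) with hE2
  set R : Finset ι := E0.biUnion (fun e => (pk e).toFinset) with hR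
  set V' := Sv \ E1.biUnion (fun e => e \ C) with hV'
  set E' := (E2.filter (fun e => e \ C ⊆ V')).image (fun e => e \ C) with hE'
  have hgood : GoodHG V' E' := by
    refine ⟨?_, ?_, ?_⟩
    · intro e' he'
      obtain ⟨e, he, rfl⟩ := Finset.mem_image.1 he'
      have h1 := Finset.mem_filter.1 he
      exact ⟨h1.2, (Finset.mem_filter.1 h1.1).2.2⟩
    · intro e' he' f' hf' x y h1 h2 h3 h4 hxy
      obtain ⟨e, he, rfl⟩ := Finset.mem_image.1 he'
      obtain ⟨f, hf, rfl⟩ := Finset.mem_image.1 hf'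
      have he := (Finset.mem_filter.1 (Finset.mem_filter.1 he).1).1
      have hf := (Finset.mem_filter.1 (Finset.mem_filter.1 hf).1).1
      rw [hlin e he f hf x y (Finset.mem_sdiff.1 h1).1 (Finset.mem_sdiff.1 h2).1
        (Finset.mem_sdiff.1 h3).1 (Finset.mem_sdiff.1 h4).1 hxy]
    · intro e' he' f' hf' g' hg' x y z h1 h2 h3 h4 h5 h6 hxy hyz hzx
      obtain ⟨e, he, rfl⟩ := Finset.mem_image.1 he'
      obtain ⟨f, hf, rfl⟩ := Finset.mem_image.1 hf'
      obtain ⟨g, hg, rfl⟩ := Finset.mem_image.1 hg'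
      have he := (Finset.mem_filter.1 (Finset.mem_filter.1 he).1).1
      have hf := (Finset.mem_filter.1 (Finset.mem_filter.1 hf).1).1
      have hg := (Finset.mem_filter.1 (Finset.mem_filter.1 hg).1).1
      rcases htri e he f hf g hg x y z (Finset.mem_sdiff.1 h1).1 (Finset.mem_sdiff.1 h2).1
        (Finset.mem_sdiff.1 h3).1 (Finset.mem_sdiff.1 h4).1 (Finset.mem_sdiff.1 h5).1
        (Finset.mem_sdiff.1 h6).1 hxy hyz hzx with h | h | h
      · exact Or.inl (by rw [h])
      · exact Or.inr (Or.inl (by rw [h]))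
      · exact Or.inr (Or.inr (by rw [h]))
  obtain ⟨I', hI'V, hI'E, hI'c⟩ := IH V' E' hgood
  have hV'Sv : V' ⊆ Sv := Finset.sdiff_subset
  have hI'Sv : I' ⊆ Sv := hI'V.trans hV'Sv
  refine ⟨(C \ R) ∪ I', ?_, ?_, ?_⟩
  · exact Finset.union_subset (Finset.sdiff_subset.trans hC) (hI'Sv.trans hSv)
  · intro e he hsub
    have hsub2 : e \ C ⊆ I' := by
      intro x hx
      have hx' := Finset.mem_sdiff.1 hx
      rcases Finset.mem_union.1 (hsub hx'.1) with h | h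
      · exact absurd (Finset.mem_sdiff.1 h).1 hx'.2
      · exact h
    have hsS : e \ C ⊆ Sv := hsub2.trans hI'Sv
    rcases Nat.lt_or_ge (e \ C).card 2 with hlt | hge
    · have hcases : (e \ C).card = 0 ∨ (e \ C).card = 1 := by omega
      rcases hcases with h0 | h1
      · obtain ⟨y, hy, hpe⟩ := hpk e he
        have hyR : y ∈ R := by
          rw [hR, Finset.mem_biUnion]
          exact ⟨e, Finset.mem_filter.2 ⟨he, hsS, h0⟩, by simp [hpe]⟩
        have hyC : y ∈ C := by
          have : e ⊆ C := Finset.sdiff_eq_empty_iff_subset.1 (Finset.card_eq_zero.1 h0)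
          exact this hy
        rcases Finset.mem_union.1 (hsub hy) with h | h
        · exact (Finset.mem_sdiff.1 h).2 hyR
        · exact Finset.disjoint_left.1 hd hyC (hI'Sv h)
      · obtain ⟨x, hx⟩ := Finset.card_eq_one.1 h1
        have hxm : x ∈ e \ C := by rw [hx]; simp
        have hxV := hI'V (hsub2 hxm)
        exact (Finset.mem_sdiff.1 hxV).2
          (Finset.mem_biUnion.2 ⟨e, Finset.mem_filter.2 ⟨he, hsS, h1⟩, hxm⟩)
    · refine hI'E (e \ C) ?_ hsub2
      exact Finset.mem_image.2 ⟨e, Finset.mem_filter.2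
        ⟨Finset.mem_filter.2 ⟨he, hsS, hge⟩, hsub2.trans hI'V⟩, rfl⟩
  · have hdis : Disjoint (C \ R) I' :=
      Finset.disjoint_of_subset_left Finset.sdiff_subset
        (Finset.disjoint_of_subset_right hI'Sv hd)
    rw [Finset.card_union_of_disjoint hdis]
    push_cast
    have hRc : R.card ≤ E0.card := by
      calc R.card ≤ ∑ e ∈ E0, (pk e).toFinset.card := Finset.card_biUnion_le
        _ ≤ ∑ e ∈ E0, 1 := Finset.sum_le_sum fun e _ => by
            cases h : pk e <;> simp
        _ = E0.card := by simp
    have hT : (E1.biUnion (fun e => e \ C)).card ≤ E1.card := by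
      calc _ ≤ ∑ e ∈ E1, (e \ C).card := Finset.card_biUnion_le
        _ = ∑ e ∈ E1, 1 := Finset.sum_congr rfl fun e he => (Finset.mem_filter.1 he).2.2
        _ = E1.card := by simp
    have h1 : (C.card : ℝ) ≤ (C \ R).card + E0.card := by
      have : C.card ≤ (C \ R).card + R.card := by
        have := Finset.le_card_sdiff R C; omega
      exact_mod_cast this.trans (by omega)
    have h2 : (Sv.card : ℝ) ≤ V'.card + E1.card := by
      have : Sv.card ≤ V'.card + (E1.biUnion (fun e => e \ C)).card := by
        have := Finset.le_card_sdiff (E1.biUnion (fun e => e \ C)) Sv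
        rw [hV']; omega
      exact_mod_cast this.trans (by omega)
    have h3 : ∑ e ∈ E', b e.card ≤ ∑ e ∈ E2, b (e \ C).card := by
      calc ∑ e ∈ E', b e.card ≤ ∑ e ∈ E2.filter (fun e => e \ C ⊆ V'), b (e \ C).card := by
            refine Finset.sum_image_le_of_nonneg ?_
            intro i _
            exact hb _
        _ ≤ _ := Finset.sum_le_sum_of_subset_of_nonneg (Finset.filter_subset _ _)
            fun _ _ _ => hb _
    have h4 : ∑ e ∈ E, (if e \ C ⊆ Sv then ecost a b (e \ C).card else 0)
        = E0.card + a * E1.card + ∑ e ∈ E2, b (e \ C).card := by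
      have c0 : (E0.card : ℝ) = ∑ e ∈ E, if e \ C ⊆ Sv ∧ (e \ C).card = 0 then (1:ℝ) else 0 := by
        rw [hE0]; simp
      have c1 : a * (E1.card : ℝ)
          = ∑ e ∈ E, if e \ C ⊆ Sv ∧ (e \ C).card = 1 then a else 0 := by
        rw [hE1, ← Finset.sum_filter]; simp [mul_comm]
      have c2 : ∑ e ∈ E2, b (e \ C).card
          = ∑ e ∈ E, if e \ C ⊆ Sv ∧ 2 ≤ (e \ C).card then b (e \ C).card else 0 := by
        rw [hE2, Finset.sum_filter]
      rw [c0, c1, c2, ← Finset.sum_add_distrib, ← Finset.sum_add_distrib]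
      refine Finset.sum_congr rfl fun e _ => ?_
      by_cases hs : e \ C ⊆ Sv
      · rcases Nat.lt_or_ge (e \ C).card 2 with hlt | hge
        · have hcases : (e \ C).card = 0 ∨ (e \ C).card = 1 := by omega
          rcases hcases with h | h <;> simp only [hs, h, ecost] <;> simp
        · have n0 : (e \ C).card ≠ 0 := by omega
          have n1 : (e \ C).card ≠ 1 := by omega
          simp only [hs, ecost, n0, n1, hge] 
          simp
      · simp [hs]
    rw [h4]
    nlinarith [mul_le_mul_of_nonneg_left h2 ha]

lemma edgeExp {β : Type*} [DecidableEq β] (U e : Finset ι) (φ : ι → β)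
    (hφ : Function.Injective φ) (N : ι → Finset β) (Ω : Finset β) (D : ℕ)
    (heU : e ⊆ U) (hΩ : ∀ v ∈ U, φ v ∈ Ω ∧ N v ⊆ Ω) (hN : ∀ v ∈ U, (N v).card = D)
    (h2 : e.card = 2 → ∀ u ∈ e, ∀ v ∈ e, u ≠ v → φ u ∈ N v)
    (hdis : ∀ u ∈ e, ∀ v ∈ e, u ≠ v → Disjoint (N u) (N v))
    (θ : ℝ) (h0 : 0 ≤ θ) (h1 : θ ≤ 1) (c : ℕ → ℝ) (hc : ∀ j, 0 ≤ c j) :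
    bexp Ω θ (fun C => if e \ U.filter (fun v => φ v ∈ C) ⊆
        U.filter (fun v => φ v ∉ C ∧ Disjoint (N v) C)
        then c (e \ U.filter (fun v => φ v ∈ C)).card else 0)
      ≤ ∑ B ∈ e.powerset, (if e.card = 2 ∧ B.card = 1 then 0
          else c B.card * (θ ^ (e.card - B.card) * ((1 - θ) ^ D) ^ B.card)) := by
  have h1' : 0 ≤ 1 - θ := by linarith
  calc _ ≤ bexp Ω θ (fun C => ∑ B ∈ e.powerset, (if e.card = 2 ∧ B.card = 1 then 0 else c B.card) *
          (if (e \ B).image φ ⊆ C ∧ Disjoint (B.biUnion N) C then 1 else 0)) := by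
        refine bexp_mono Ω h0 h1 fun C hC => ?_
        have hnn : ∀ B ∈ e.powerset, 0 ≤ (if e.card = 2 ∧ B.card = 1 then 0 else c B.card) *
          (if (e \ B).image φ ⊆ C ∧ Disjoint (B.biUnion N) C then (1:ℝ) else 0) := by
          intro B _
          refine mul_nonneg ?_ ?_
          · split_ifs
            · exact le_rfl
            · exact hc _
          · split_ifs <;> norm_num
        split_ifs with hs
        · set B := e \ U.filter (fun v => φ v ∈ C) with hB
          have hBe : B ∈ e.powerset := Finset.mem_powerset.2 Finset.sdiff_subset
          refine le_trans ?_ (Finset.single_le_sum hnn hBe)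
          have hsub : (e \ B).image φ ⊆ C := by
            intro y hy
            obtain ⟨x, hx, rfl⟩ := Finset.mem_image.1 hy
            have hx' := Finset.mem_sdiff.1 hx
            by_contra hcon
            exact hx'.2 (by simp [hB, hx'.1, hcon])
          have hdj : Disjoint (B.biUnion N) C := by
            rw [Finset.disjoint_biUnion_left]
            intro v hv
            exact (Finset.mem_filter.1 (hs hv)).2.2
          have hne : ¬ (e.card = 2 ∧ B.card = 1) := by
            rintro ⟨he2, hB1⟩
            obtain ⟨v, hv⟩ := Finset.card_eq_one.1 hB1
            have hvB : v ∈ B := by rw [hv]; simp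
            have hve : v ∈ e := Finset.sdiff_subset hvB
            have : ∃ u ∈ e, u ≠ v := Finset.exists_mem_ne (by omega) v
            obtain ⟨u, hu, huv⟩ := this
            have huB : u ∉ B := by rw [hv]; simpa using huv
            have huC : φ u ∈ C := hsub (Finset.mem_image_of_mem φ (Finset.mem_sdiff.2 ⟨hu, huB⟩))
            exact Finset.disjoint_left.1 (Finset.mem_filter.1 (hs hvB)).2.2
              (h2 he2 u hu v hve huv) huC
          rw [if_neg hne, if_pos ⟨hsub, hdj⟩, mul_one]
        · exact Finset.sum_nonneg hnn
    _ = ∑ B ∈ e.powerset, (if e.card = 2 ∧ B.card = 1 then 0 else c B.card) *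
          bexp Ω θ (fun C => if (e \ B).image φ ⊆ C ∧ Disjoint (B.biUnion N) C then 1 else 0) := by
        rw [bexp_sum]
        exact Finset.sum_congr rfl fun B _ => bexp_const_mul _ _ _ _
    _ ≤ _ := by
        refine Finset.sum_le_sum fun B hB => ?_
        have hB := Finset.mem_powerset.1 hB
        by_cases hne : e.card = 2 ∧ B.card = 1
        · simp [hne]
        · rw [if_neg hne, if_neg hne]
          refine mul_le_mul_of_nonneg_left ?_ (hc _)
          by_cases hd : Disjoint ((e \ B).image φ) (B.biUnion N)
          · rw [bexp_ind Ω θ _ _ ?_ ?_ hd, Finset.card_image_of_injective _ hφ,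
              Finset.card_sdiff_of_subset hB, Finset.card_biUnion]
            · rw [Finset.sum_congr rfl (fun v hv => hN v (heU (hB hv)))]
              simp [pow_mul, mul_comm]
            · intro u hu v hv huv
              exact hdis u (hB hu) v (hB hv) huv
            · intro y hy
              obtain ⟨x, hx, rfl⟩ := Finset.mem_image.1 hy
              exact (hΩ x (heU (Finset.mem_sdiff.1 hx).1)).1
            · intro y hy
              obtain ⟨x, hx, hy⟩ := Finset.mem_biUnion.1 hy
              exact (hΩ x (heU (hB hx))).2 hy
          · have : (fun C => if (e \ B).image φ ⊆ C ∧ Disjoint (B.biUnion N) C then (1:ℝ) else 0)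
                = fun C => 0 := by
              funext C
              rw [if_neg]
              rintro ⟨ha, hb⟩
              exact hd (Finset.disjoint_of_subset_left ha hb.symm)
            rw [this]
            simp only [bexp, mul_zero, Finset.sum_const_zero]
            positivity

end stepSection

lemma edgeNumeric {ι : Type*} [DecidableEq ι] (e : Finset ι) (he : 2 ≤ e.card) (m : ℕ)
    (θ θ' g : ℝ) (hθ : 0 < θ) (hg : 0 < g) (hθ' : θ' * g = θ) :
    ∑ B ∈ e.powerset, (if e.card = 2 ∧ B.card = 1 then 0
          else ecost (m * θ' / 2) (fun j => 2 ^ (j ^ 2) * (m : ℝ) ^ (j - 1) * θ' ^ j) B.card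
            * (θ ^ (e.card - B.card) * g ^ B.card))
      ≤ 2 ^ (e.card ^ 2) * ((m : ℝ) + 1) ^ (e.card - 1) * θ ^ e.card := by
  set J := e.card with hJ
  set h : ℕ → ℝ := fun j => if J = 2 ∧ j = 1 then 0 else
    if j = 0 then 1 else if j = 1 then (m : ℝ) / 2 else 2 ^ (j ^ 2) * (m : ℝ) ^ (j - 1) with hh
  have hterm : ∀ B ∈ e.powerset, (if J = 2 ∧ B.card = 1 then 0
          else ecost (m * θ' / 2) (fun j => 2 ^ (j ^ 2) * (m : ℝ) ^ (j - 1) * θ' ^ j) B.card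
            * (θ ^ (J - B.card) * g ^ B.card)) = θ ^ J * h B.card := by
    intro B hB
    have hBJ : B.card ≤ J := Finset.card_le_card (Finset.mem_powerset.1 hB)
    generalize B.card = j at hBJ
    simp only [hh, ecost]
    by_cases c1 : J = 2 ∧ j = 1
    · simp [c1]
    · rw [if_neg c1, if_neg c1]
      by_cases c2 : j = 0
      · simp [c2]
      · rw [if_neg c2, if_neg c2]
        have hpow : θ' ^ j * g ^ j * θ ^ (J - j) = θ ^ J := by
          rw [← mul_pow, hθ', ← pow_add]
          congr 1; omega
        by_cases c3 : j = 1
        · subst c3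
          simp only [if_true]
          rw [pow_one, pow_one] at hpow
          rw [← hpow]; ring
        · rw [if_neg c3, if_neg c3, ← hpow]; ring
  rw [Finset.sum_congr rfl hterm, ← Finset.mul_sum, Finset.sum_powerset_apply_card h, ← hJ]
  rw [mul_comm]
  refine mul_le_mul_of_nonneg_right ?_ (by positivity)
  simp only [nsmul_eq_mul]
  have hm0 : (0:ℝ) ≤ m := Nat.cast_nonneg m
  rcases Nat.lt_or_ge J 3 with h3 | h3
  · have hJ2 : J = 2 := by omega
    rw [hJ2]
    simp only [Finset.sum_range_succ, Finset.sum_range_zero, hh, hJ2]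
    norm_num
    linarith
  · have hm1 : (1:ℝ) ≤ (m:ℝ) + 1 := by linarith
    have hsmall : ∀ j ∈ Finset.range J, ((J.choose j : ℕ) : ℝ) * h j
        ≤ (J.choose j : ℕ) * (2 ^ ((J - 1) ^ 2) * ((m:ℝ) + 1) ^ (J - 2)) := by
      intro j hj
      have hjJ := Finset.mem_range.1 hj
      refine mul_le_mul_of_nonneg_left ?_ (Nat.cast_nonneg _)
      have hK : (1:ℝ) ≤ 2 ^ ((J - 1) ^ 2) := one_le_pow₀ (by norm_num)
      have hP : (1:ℝ) ≤ ((m:ℝ) + 1) ^ (J - 2) := one_le_pow₀ hm1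
      simp only [hh]
      rw [if_neg (by omega)]
      split_ifs with c2 c3
      · nlinarith
      · have : (m:ℝ) + 1 ≤ ((m:ℝ) + 1) ^ (J - 2) := by
          calc (m:ℝ) + 1 = ((m:ℝ) + 1) ^ 1 := (pow_one _).symm
            _ ≤ _ := pow_le_pow_right₀ hm1 (by omega)
        nlinarith
      · refine mul_le_mul ?_ ?_ (by positivity) (by positivity)
        · exact pow_le_pow_right₀ (by norm_num) (Nat.pow_le_pow_left (by omega) 2)
        · calc (m:ℝ) ^ (j - 1) ≤ ((m:ℝ) + 1) ^ (j - 1) :=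
                pow_le_pow_left₀ hm0 (by linarith) _
            _ ≤ _ := pow_le_pow_right₀ hm1 (by omega)
    rw [Finset.sum_range_succ]
    have hsum : ∑ j ∈ Finset.range J, ((J.choose j : ℕ) : ℝ) ≤ 2 ^ J := by
      have := Nat.sum_range_choose J
      rw [Finset.sum_range_succ] at this
      have h' : ∑ j ∈ Finset.range J, J.choose j ≤ 2 ^ J := by omega
      exact_mod_cast h'
    have hlast : h J = 2 ^ (J ^ 2) * (m:ℝ) ^ (J - 1) := by
      simp only [hh]
      rw [if_neg (by omega), if_neg (by omega), if_neg (by omega)]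
    have hpw : (2:ℝ) ^ J * 2 ^ ((J - 1) ^ 2) ≤ 2 ^ (J ^ 2) := by
      rw [← pow_add]
      refine pow_le_pow_right₀ (by norm_num) ?_
      obtain ⟨t, ht⟩ : ∃ t, J = t + 3 := ⟨J - 3, by omega⟩
      rw [ht]
      have : t + 3 - 1 = t + 2 := by omega
      rw [this]
      nlinarith
    have hA : ∑ j ∈ Finset.range J, ((J.choose j : ℕ) : ℝ) * h j
        ≤ 2 ^ (J ^ 2) * ((m:ℝ) + 1) ^ (J - 2) := by
      calc _ ≤ ∑ j ∈ Finset.range J, ((J.choose j : ℕ) : ℝ)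
              * (2 ^ ((J - 1) ^ 2) * ((m:ℝ) + 1) ^ (J - 2)) := Finset.sum_le_sum hsmall
        _ = (∑ j ∈ Finset.range J, ((J.choose j : ℕ) : ℝ))
              * (2 ^ ((J - 1) ^ 2) * ((m:ℝ) + 1) ^ (J - 2)) := by rw [Finset.sum_mul]
        _ ≤ 2 ^ J * (2 ^ ((J - 1) ^ 2) * ((m:ℝ) + 1) ^ (J - 2)) :=
            mul_le_mul_of_nonneg_right hsum (by positivity)
        _ = (2 ^ J * 2 ^ ((J - 1) ^ 2)) * ((m:ℝ) + 1) ^ (J - 2) := by ring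
        _ ≤ _ := mul_le_mul_of_nonneg_right hpw (by positivity)
    have hB : (m:ℝ) ^ (J - 1) ≤ m * ((m:ℝ) + 1) ^ (J - 2) := by
      have : J - 1 = (J - 2) + 1 := by omega
      rw [this, pow_succ, mul_comm]
      exact mul_le_mul_of_nonneg_left (pow_le_pow_left₀ hm0 (by linarith) _) hm0
    have hC : ((m:ℝ) + 1) ^ (J - 1) = ((m:ℝ) + 1) ^ (J - 2) * (m + 1) := by
      have : J - 1 = (J - 2) + 1 := by omega
      rw [this, pow_succ]
    rw [hlast, Nat.choose_self, hC]
    have : (0:ℝ) < 2 ^ (J ^ 2) := by positivity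
    push_cast
    nlinarith [mul_le_mul_of_nonneg_left hB this.le]

section mainHG
variable {ι : Type*} [DecidableEq ι]

lemma randStep (U : Finset ι) (E : Finset (Finset ι)) (hG : GoodHG U E) (m D : ℕ) (θ g : ℝ)
    (hθ : 0 < θ) (hθ1 : θ ≤ 1) (hmθ : m * θ ≤ 1) (hg : 0 < g) (hgD : g = (1 - θ) ^ D)
    (hdeg : ∀ v ∈ U, (U.filter (fun u => u ≠ v ∧ {u, v} ∈ E)).card ≤ D)
    (IH : ∀ (U' : Finset ι) (E' : Finset (Finset ι)), GoodHG U' E' →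
      ∃ I ⊆ U', (∀ e ∈ E', ¬ e ⊆ I) ∧ ((m : ℝ) * (θ / g) / 2) * U'.card
        - ∑ e ∈ E', 2 ^ (e.card ^ 2) * (m : ℝ) ^ (e.card - 1) * (θ / g) ^ e.card
          ≤ (I.card : ℝ)) :
    ∃ I ⊆ U, (∀ e ∈ E, ¬ e ⊆ I) ∧ (((m : ℝ) + 1) * θ / 2) * U.card
        - ∑ e ∈ E, 2 ^ (e.card ^ 2) * ((m : ℝ) + 1) ^ (e.card - 1) * θ ^ e.card
          ≤ (I.card : ℝ) := by
  set N2 : ι → Finset ι := fun v => U.filter (fun u => u ≠ v ∧ {u, v} ∈ E) with hN2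
  set φ : ι → ι ⊕ (ι × ℕ) := Sum.inl with hφ
  have hφi : Function.Injective φ := Sum.inl_injective
  set N : ι → Finset (ι ⊕ (ι × ℕ)) := fun v =>
    (N2 v).disjSum ({v} ×ˢ Finset.range (D - (N2 v).card)) with hN
  set Ω : Finset (ι ⊕ (ι × ℕ)) := U.disjSum (U ×ˢ Finset.range D) with hΩ
  have hNcard : ∀ v ∈ U, (N v).card = D := by
    intro v hv
    have := hdeg v hv
    simp only [hN, Finset.card_disjSum, Finset.card_product, Finset.card_singleton,
      Finset.card_range, one_mul]
    simp only [hN2]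
    omega
  have hΩ' : ∀ v ∈ U, φ v ∈ Ω ∧ N v ⊆ Ω := by
    intro v hv
    refine ⟨by simp [hφ, hΩ, hv], ?_⟩
    refine Finset.disjSum_mono (Finset.filter_subset _ _) ?_
    refine Finset.product_subset_product (by simpa using hv) ?_
    exact Finset.range_subset_range.2 (Nat.sub_le _ _)
  have hφN : ∀ v, φ v ∉ N v := by
    intro v
    simp [hφ, hN, hN2]
  obtain ⟨hE, hlin, htri⟩ := hG
  have hdisj : ∀ e ∈ E, ∀ u ∈ e, ∀ v ∈ e, u ≠ v → Disjoint (N u) (N v) := by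
    intro e he u hu v hv huv
    rw [Finset.disjoint_left]
    rintro (w | w) h1 h2
    · simp only [hN, hN2, Finset.inl_mem_disjSum, Finset.mem_filter] at h1 h2
      obtain ⟨-, hwu, h1⟩ := h1
      obtain ⟨-, hwv, h2⟩ := h2
      have hne : ({w, u} : Finset ι) ≠ {w, v} := by
        intro h
        have : u ∈ ({w, v} : Finset ι) := by rw [← h]; simp
        simp only [Finset.mem_insert, Finset.mem_singleton] at this
        rcases this with h | h
        · exact hwu h.symm
        · exact huv h
      have hwe : w ∉ e := by
        intro hwe
        have e1 := hlin {w, u} h1 e he w u (by simp) hwe (by simp) hu hwu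
        have e2 := hlin {w, v} h2 e he w v (by simp) hwe (by simp) hv hwv
        exact hne (e1.trans e2.symm)
      rcases htri e he {w, u} h1 {w, v} h2 u w v hu (by simp) (by simp) (by simp) (by simp) hv
        (Ne.symm hwu) hwv (Ne.symm huv) with h | h | h
      · exact hwe (by rw [h]; simp)
      · exact hne h
      · exact hwe (by rw [← h]; simp)
    · simp only [hN, Finset.inr_mem_disjSum, Finset.mem_product, Finset.mem_singleton] at h1 h2
      exact huv (h1.1.symm.trans h2.1)
  have hm0 : (0:ℝ) ≤ m := Nat.cast_nonneg m
  set a : ℝ := (m : ℝ) * (θ / g) / 2 with ha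
  set b : ℕ → ℝ := fun j => 2 ^ (j ^ 2) * (m : ℝ) ^ (j - 1) * (θ / g) ^ j with hb
  have ha0 : 0 ≤ a := by positivity
  have hb0 : ∀ j, 0 ≤ b j := fun j => by simp only [hb]; positivity
  set F : Finset (ι ⊕ (ι × ℕ)) → ℝ := fun C =>
    ((U.filter (fun v => φ v ∈ C)).card : ℝ)
      + a * (U.filter (fun v => φ v ∉ C ∧ Disjoint (N v) C)).card
      - ∑ e ∈ E, (if e \ U.filter (fun v => φ v ∈ C) ⊆
        U.filter (fun v => φ v ∉ C ∧ Disjoint (N v) C)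
        then ecost a b (e \ U.filter (fun v => φ v ∈ C)).card else 0) with hF
  obtain ⟨C, hC, hCF⟩ := bexp_exists Ω hθ.le hθ1 F
  obtain ⟨I, hIU, hIE, hIc⟩ := detStep U E ⟨hE, hlin, htri⟩ (U.filter (fun v => φ v ∈ C))
    (U.filter (fun v => φ v ∉ C ∧ Disjoint (N v) C)) (Finset.filter_subset _ _)
    (Finset.filter_subset _ _) (by
      rw [Finset.disjoint_left]
      intro x h1 h2
      exact (Finset.mem_filter.1 h2).2.1 (Finset.mem_filter.1 h1).2) a b ha0 hb0 IH
  refine ⟨I, hIU, hIE, le_trans ?_ (hCF.trans hIc)⟩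
  have hFexp : bexp Ω θ F = bexp Ω θ (fun C => ((U.filter (fun v => φ v ∈ C)).card : ℝ))
      + a * bexp Ω θ (fun C => ((U.filter (fun v => φ v ∉ C ∧ Disjoint (N v) C)).card : ℝ))
      - ∑ e ∈ E, bexp Ω θ (fun C => (if e \ U.filter (fun v => φ v ∈ C) ⊆
        U.filter (fun v => φ v ∉ C ∧ Disjoint (N v) C)
        then ecost a b (e \ U.filter (fun v => φ v ∈ C)).card else 0)) := by
    rw [hF, bexp_sub, bexp_add, bexp_const_mul, bexp_sum]
  have hx1 : bexp Ω θ (fun C => ((U.filter (fun v => φ v ∈ C)).card : ℝ)) = θ * U.card := by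
    have : (fun C : Finset (ι ⊕ (ι × ℕ)) => ((U.filter (fun v => φ v ∈ C)).card : ℝ))
        = fun C => ∑ v ∈ U, if ({φ v} : Finset (ι ⊕ (ι × ℕ))) ⊆ C ∧ Disjoint ∅ C
          then (1:ℝ) else 0 := by
      funext C
      simp [Finset.singleton_subset_iff]
    rw [this, bexp_sum, Finset.sum_congr rfl (g := fun _ => θ)]
    · simp [mul_comm]
    · intro v hv
      rw [bexp_ind Ω θ _ _ (by simpa using (hΩ' v hv).1) (by simp) (by simp)]
      simp
  have hx2 : bexp Ω θ (fun C => ((U.filter (fun v => φ v ∉ C ∧ Disjoint (N v) C)).card : ℝ))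
      = (g * (1 - θ)) * U.card := by
    have : (fun C : Finset (ι ⊕ (ι × ℕ)) =>
        ((U.filter (fun v => φ v ∉ C ∧ Disjoint (N v) C)).card : ℝ))
        = fun C => ∑ v ∈ U, if ∅ ⊆ C ∧ Disjoint (insert (φ v) (N v)) C
          then (1:ℝ) else 0 := by
      funext C
      simp [Finset.disjoint_insert_left]
    rw [this, bexp_sum, Finset.sum_congr rfl (g := fun _ => g * (1 - θ))]
    · simp [mul_comm]
    · intro v hv
      rw [bexp_ind Ω θ _ _ (by simp)
        (Finset.insert_subset (hΩ' v hv).1 (hΩ' v hv).2) (by simp),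
        Finset.card_insert_of_notMem (hφN v), hNcard v hv, hgD]
      simp [pow_succ]
  have hx3 : ∀ e ∈ E, bexp Ω θ (fun C => (if e \ U.filter (fun v => φ v ∈ C) ⊆
        U.filter (fun v => φ v ∉ C ∧ Disjoint (N v) C)
        then ecost a b (e \ U.filter (fun v => φ v ∈ C)).card else 0))
        ≤ 2 ^ (e.card ^ 2) * ((m : ℝ) + 1) ^ (e.card - 1) * θ ^ e.card := by
    intro e he
    refine (edgeExp U e φ hφi N Ω D (hE e he).1 hΩ' hNcard ?_ (hdisj e he) θ hθ.le hθ1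
      (ecost a b) (ecost_nonneg ha0 hb0)).trans ?_
    · intro he2 u hu v hv huv
      have : e = {u, v} := by
        symm
        refine Finset.eq_of_subset_of_card_le ?_ (by rw [he2, Finset.card_pair huv])
        intro x hx
        simp only [Finset.mem_insert, Finset.mem_singleton] at hx
        rcases hx with rfl | rfl
        · exact hu
        · exact hv
      simp only [hφ, hN, hN2, Finset.inl_mem_disjSum, Finset.mem_filter]
      exact ⟨(hE e he).1 hu, huv, this ▸ he⟩
    · rw [← hgD]
      exact edgeNumeric e (hE e he).2 m θ (θ / g) g hθ hg (div_mul_cancel₀ _ hg.ne')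
  rw [hFexp, hx1, hx2]
  have hsum := Finset.sum_le_sum hx3
  have hag : a * g = m * θ / 2 := by
    rw [ha]; field_simp
  have hmain : (((m : ℝ) + 1) * θ / 2) ≤ θ + a * (g * (1 - θ)) := by
    have : a * (g * (1 - θ)) = m * θ / 2 * (1 - θ) := by rw [← mul_assoc, hag]
    rw [this]
    nlinarith
  have := mul_le_mul_of_nonneg_right hmain (Nat.cast_nonneg (α := ℝ) U.card)
  linarith

theorem mainHG (m : ℕ) : ∀ (θ : ℝ), 0 < θ → 2 ^ m * θ ≤ 1 / 4 →
    ∀ (U : Finset ι) (E : Finset (Finset ι)), GoodHG U E →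
    ∃ I ⊆ U, (∀ e ∈ E, ¬ e ⊆ I) ∧ ((m : ℝ) * θ / 2) * U.card
        - ∑ e ∈ E, 2 ^ (e.card ^ 2) * (m : ℝ) ^ (e.card - 1) * θ ^ e.card
          ≤ (I.card : ℝ) := by
  induction m with
  | zero =>
    intro θ hθ _ U E hG
    refine ⟨∅, by simp, ?_, ?_⟩
    · intro e he hs
      have := (hG.1 e he).2
      rw [Finset.subset_empty.1 hs] at this
      simp at this
    · have : ∀ e ∈ E, 0 ≤ (2:ℝ) ^ (e.card ^ 2) * ((0:ℕ) : ℝ) ^ (e.card - 1) * θ ^ e.card :=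
        fun e _ => by positivity
      have := Finset.sum_nonneg this
      simp only [Nat.cast_zero, zero_mul, zero_div, Finset.card_empty] at this ⊢
      linarith
  | succ m ih =>
    intro θ hθ hmθ U
    have hpm : (1:ℝ) ≤ 2 ^ m := one_le_pow₀ (by norm_num)
    have hmθ' : 2 ^ m * θ ≤ 1 / 8 := by rw [pow_succ] at hmθ; linarith
    have hθ8 : θ ≤ 1 / 8 := by nlinarith
    induction U using Finset.strongInduction with
    | H U ihU =>
    intro E hG
    by_cases hbig : ∃ v ∈ U, 1 / (32 * θ) ≤ ((E.filter (fun e => v ∈ e ∧ e.card = 2)).card : ℝ)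
    · obtain ⟨v, hv, hdv⟩ := hbig
      have hG' : GoodHG (U.erase v) (E.filter (fun e => v ∉ e)) := by
        obtain ⟨hE, hlin, htri⟩ := hG
        refine ⟨?_, ?_, ?_⟩
        · intro e he
          have he := Finset.mem_filter.1 he
          exact ⟨Finset.subset_erase.2 ⟨(hE e he.1).1, he.2⟩, (hE e he.1).2⟩
        · intro e he f hf
          exact hlin e (Finset.mem_filter.1 he).1 f (Finset.mem_filter.1 hf).1
        · intro e he f hf g hg
          exact htri e (Finset.mem_filter.1 he).1 f (Finset.mem_filter.1 hf).1 g
            (Finset.mem_filter.1 hg).1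
      obtain ⟨I, hIU, hIE, hIc⟩ := ihU _ (Finset.erase_ssubset hv) _ hG'
      refine ⟨I, hIU.trans (Finset.erase_subset _ _), ?_, le_trans ?_ hIc⟩
      · intro e he hs
        by_cases hve : v ∈ e
        · exact (Finset.mem_erase.1 (hIU (hs hve))).1 rfl
        · exact hIE e (Finset.mem_filter.2 ⟨he, hve⟩) hs
      · have hcard : ((U.erase v).card : ℝ) = U.card - 1 := by
          rw [Finset.card_erase_of_mem hv, Nat.cast_sub (Finset.card_pos.2 ⟨v, hv⟩)]
          simp
        rw [hcard]
        set w : Finset ι → ℝ := fun e =>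
          2 ^ (e.card ^ 2) * ((m + 1 : ℕ) : ℝ) ^ (e.card - 1) * θ ^ e.card with hw
        have hw0 : ∀ e, 0 ≤ w e := fun e => by simp only [hw]; positivity
        have hsplit := Finset.sum_filter_add_sum_filter_not E (fun e => v ∉ e) w
        have h2 : ∑ e ∈ E.filter (fun e => v ∈ e ∧ e.card = 2), w e
            ≤ ∑ e ∈ E.filter (fun e => ¬ v ∉ e), w e := by
          refine Finset.sum_le_sum_of_subset_of_nonneg ?_ fun e _ _ => hw0 e
          intro e he
          have he := Finset.mem_filter.1 he
          exact Finset.mem_filter.2 ⟨he.1, not_not.2 he.2.1⟩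
        have h3 : ∑ e ∈ E.filter (fun e => v ∈ e ∧ e.card = 2), w e
            = (E.filter (fun e => v ∈ e ∧ e.card = 2)).card * (16 * ((m + 1 : ℕ) : ℝ) * θ ^ 2) := by
          rw [Finset.sum_congr rfl (g := fun _ => 16 * ((m + 1 : ℕ) : ℝ) * θ ^ 2)]
          · simp
          · intro e he
            have he := (Finset.mem_filter.1 he).2.2
            simp only [hw, he]
            norm_num
        have h4 : ((m + 1 : ℕ) : ℝ) * θ / 2 ≤
            (E.filter (fun e => v ∈ e ∧ e.card = 2)).card * (16 * ((m + 1 : ℕ) : ℝ) * θ ^ 2) := by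
          calc ((m + 1 : ℕ) : ℝ) * θ / 2
              = 1 / (32 * θ) * (16 * ((m + 1 : ℕ) : ℝ) * θ ^ 2) := by field_simp; norm_num
            _ ≤ _ := mul_le_mul_of_nonneg_right hdv (by positivity)
        change _ - ∑ e ∈ E, w e ≤ _ - ∑ e ∈ E.filter (fun e => v ∉ e), w e
        rw [← hsplit]
        linarith
    · push Not at hbig
      set D := ⌈1 / (32 * θ)⌉₊ with hD
      have hDle : (D : ℝ) < 1 / (32 * θ) + 1 := Nat.ceil_lt_add_one (by positivity)
      have hg : (1:ℝ) / 2 ≤ (1 - θ) ^ D := by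
        have h1 := one_add_mul_le_pow (a := -θ) (by linarith) D
        have h2 : D * θ ≤ 1 / 32 + θ := by
          calc D * θ ≤ (1 / (32 * θ) + 1) * θ := mul_le_mul_of_nonneg_right hDle.le hθ.le
            _ = 1 / 32 + θ := by field_simp
        have h3 : (1 + -θ) = 1 - θ := by ring
        rw [h3] at h1
        linarith
      have hg0 : 0 < (1 - θ) ^ D := by linarith
      have hθg : θ / (1 - θ) ^ D ≤ 2 * θ := by
        rw [div_le_iff₀ hg0]; nlinarith
      have hm2 : (m : ℝ) ≤ 2 ^ m := by exact_mod_cast Nat.lt_two_pow_self.le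
      have := randStep U E hG m D θ ((1 - θ) ^ D) hθ (by linarith) (by nlinarith) hg0 rfl ?_ ?_
      · push_cast
        exact this
      · intro v hv
        have h1 : (U.filter (fun u => u ≠ v ∧ {u, v} ∈ E)).card
            ≤ (E.filter (fun e => v ∈ e ∧ e.card = 2)).card := by
          refine Finset.card_le_card_of_injOn (fun u => {u, v}) ?_ ?_
          · intro u hu
            have hu := (Finset.mem_filter.1 (Finset.mem_coe.1 hu)).2
            simp [hu.2, Finset.card_pair hu.1]
          · intro u hu u' hu' h
            have hu := (Finset.mem_filter.1 (Finset.mem_coe.1 hu)).2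
            have : u ∈ ({u', v} : Finset ι) := by
              have h' : ({u, v} : Finset ι) = {u', v} := h
              rw [← h']; simp
            simp only [Finset.mem_insert, Finset.mem_singleton] at this
            rcases this with h | h
            · exact h
            · exact absurd h hu.1
        have h2 : ((E.filter (fun e => v ∈ e ∧ e.card = 2)).card : ℝ) ≤ D :=
          (hbig v hv).le.trans (Nat.le_ceil _)
        exact h1.trans (by exact_mod_cast h2)
      · refine ih (θ / (1 - θ) ^ D) (by positivity) ?_
        calc 2 ^ m * (θ / (1 - θ) ^ D) ≤ 2 ^ m * (2 * θ) :=
              mul_le_mul_of_nonneg_left hθg (by positivity)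
          _ ≤ 1 / 4 := by linarith

end mainHG

/-- Number of vertices spanned by a family. -/
def spanN {n : ℕ} (F : Finset (Finset (Fin n))) : ℕ := (F.sup id).card

/-- Families spanning too few vertices. -/
def DenseF {n : ℕ} (q a : ℤ) (r : ℕ) (F : Finset (Finset (Fin n))) : Prop :=
  q * spanN F + a * ((F.card : ℤ) - 1) < q * r * F.card

section appl
variable {n : ℕ}

lemma spanN_union (G F : Finset (Finset (Fin n))) :
    spanN (G ∪ F) + spanN (G ∩ F) ≤ spanN G + spanN F := by
  unfold spanN
  rw [Finset.sup_union, Finset.sup_eq_union, ← Finset.card_union_add_card_inter (G.sup id) (F.sup id)]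
  refine Nat.add_le_add_left (Finset.card_le_card ?_) _
  exact Finset.subset_inter (Finset.sup_mono Finset.inter_subset_left)
    (Finset.sup_mono Finset.inter_subset_right)

lemma spanN_singleton (x : Finset (Fin n)) : spanN {x} = x.card := by
  simp [spanN]

lemma glue_tight {q a : ℤ} {r k v : ℕ} (hq : 0 < q) (hqk : q = k - 1) (hak : a = k * r - v)
    (G F : Finset (Finset (Fin n))) (hF : F.card = k) (hFv : spanN F ≤ v)
    (hG : q * spanN G + a * ((G.card : ℤ) - 1) ≤ q * r * G.card)
    (hnd : ¬ DenseF q a r (G ∩ F)) :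
    q * spanN (G ∪ F) + a * (((G ∪ F).card : ℤ) - 1) ≤ q * r * (G ∪ F).card := by
  have h1 := spanN_union G F
  have h2 := Finset.card_union_add_card_inter G F
  unfold DenseF at hnd
  push Not at hnd
  have h1' : (spanN (G ∪ F) : ℤ) ≤ spanN G + v - spanN (G ∩ F) := by omega
  have h2' : ((G ∪ F).card : ℤ) = G.card + k - (G ∩ F).card := by omega
  rw [h2']
  have h3 := mul_le_mul_of_nonneg_left h1' hq.le
  have h4 : q * v + a * q = q * r * k := by rw [hak]; ring
  have h5 : a * (k : ℤ) = a * q + a := by rw [hqk]; ring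
  linarith

lemma glue_strict {q a : ℤ} {r k v : ℕ} (hq : 0 < q) (hqk : q = k - 1) (hak : a = k * r - v)
    (hgcd : Int.gcd q a = 1)
    (G F : Finset (Finset (Fin n))) (hF : F.card = k) (hFv : spanN F ≤ v)
    (hG : q * spanN G + a * ((G.card : ℤ) - 1) ≤ q * r * G.card)
    (hj2 : 2 ≤ (G ∩ F).card) (hjk : (G ∩ F).card < k)
    (hnd : ¬ DenseF q a r (G ∩ F)) : DenseF q a r (G ∪ F) := by
  have h1 := spanN_union G F
  have h2 := Finset.card_union_add_card_inter G F
  unfold DenseF at hnd ⊢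
  push Not at hnd
  have hne : q * r * ((G ∩ F).card : ℤ) ≠ q * spanN (G ∩ F) + a * (((G ∩ F).card : ℤ) - 1) := by
    intro h
    have hdvd : q ∣ a * (((G ∩ F).card : ℤ) - 1) :=
      ⟨r * ((G ∩ F).card : ℤ) - spanN (G ∩ F), by linarith⟩
    have hdvd2 : q ∣ (((G ∩ F).card : ℤ) - 1) := Int.dvd_of_dvd_mul_right_of_gcd_one hdvd hgcd
    have := Int.le_of_dvd (by omega) hdvd2
    omega
  have hlt := lt_of_le_of_ne hnd hne
  have h1' : (spanN (G ∪ F) : ℤ) ≤ spanN G + v - spanN (G ∩ F) := by omega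
  have h2' : ((G ∪ F).card : ℤ) = G.card + k - (G ∩ F).card := by omega
  rw [h2']
  have h3 := mul_le_mul_of_nonneg_left h1' hq.le
  have h4 : q * v + a * q = q * r * k := by rw [hak]; ring
  have h5 : a * (k : ℤ) = a * q + a := by rw [hqk]; ring
  linarith

lemma good_bad {q a : ℤ} {r k v M : ℕ} (hk : 3 ≤ k) (hqk : q = k - 1)
    (hak : a = k * r - v) (hgcd : Int.gcd q a = 1) (hM : 3 * k ≤ M)
    (X : Finset (Finset (Fin n))) (hX : ∀ x ∈ X, x.card = r)
    (hnd : ∀ F ⊆ X, 2 ≤ F.card → F.card ≤ M → ¬ DenseF q a r F) :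
    GoodHG X (X.powerset.filter (fun F => F.card = k ∧ spanN F ≤ v)) := by
  have hq : 0 < q := by omega
  have htight : ∀ F : Finset (Finset (Fin n)), F.card = k → spanN F ≤ v →
      q * spanN F + a * ((F.card : ℤ) - 1) ≤ q * r * F.card := by
    intro F hF hFv
    have h1 : q * (spanN F : ℤ) ≤ q * v := mul_le_mul_of_nonneg_left (by omega) hq.le
    have h4 : q * v + a * q = q * r * k := by rw [hak]; ring
    have h5 : a * (k : ℤ) = a * q + a := by rw [hqk]; ring
    rw [hF]
    linarith
  have hlin : ∀ e ⊆ X, e.card = k → spanN e ≤ v → ∀ f ⊆ X, f.card = k → spanN f ≤ v →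
      e ≠ f → (e ∩ f).card ≤ 1 := by
    intro e he hek hev f hf hfk hfv hef
    by_contra hcon
    push Not at hcon
    have hlt : (e ∩ f).card < k := by
      by_contra h
      push Not at h
      have h1 : e ∩ f = e := Finset.eq_of_subset_of_card_le Finset.inter_subset_left (by omega)
      have h2 : e ∩ f = f := Finset.eq_of_subset_of_card_le Finset.inter_subset_right (by omega)
      exact hef (h1.symm.trans h2)
    have hd := glue_strict hq hqk hak hgcd e f hfk hfv (htight e hek hev) hcon hlt
      (hnd _ (Finset.inter_subset_left.trans he) hcon (by omega))
    have hc := Finset.card_union_add_card_inter e f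
    exact hnd _ (Finset.union_subset he hf) (by omega) (by omega) hd
  refine ⟨?_, ?_, ?_⟩
  · intro e he
    have he := Finset.mem_filter.1 he
    exact ⟨Finset.mem_powerset.1 he.1, by omega⟩
  · intro e he f hf x y hxe hxf hye hyf hxy
    have he := Finset.mem_filter.1 he
    have hf := Finset.mem_filter.1 hf
    by_contra hef
    have := hlin e (Finset.mem_powerset.1 he.1) he.2.1 he.2.2 f (Finset.mem_powerset.1 hf.1)
      hf.2.1 hf.2.2 hef
    exact hxy (Finset.card_le_one.1 this x (by simp [hxe, hxf]) y (by simp [hye, hyf]))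
  · intro e he f hf g hg x y z hxe hxf hyf hyg hzg hze hxy hyz hzx
    have he := Finset.mem_filter.1 he
    have hf := Finset.mem_filter.1 hf
    have hg := Finset.mem_filter.1 hg
    by_contra hcon
    push Not at hcon
    obtain ⟨hef, hfg, hge⟩ := hcon
    have heX := Finset.mem_powerset.1 he.1
    have hfX := Finset.mem_powerset.1 hf.1
    have hgX := Finset.mem_powerset.1 hg.1
    have l1 := hlin e heX he.2.1 he.2.2 f hfX hf.2.1 hf.2.2 hef
    have l2 := hlin f hfX hf.2.1 hf.2.2 g hgX hg.2.1 hg.2.2 hfg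
    have l3 := hlin g hgX hg.2.1 hg.2.2 e heX he.2.1 he.2.2 hge
    have hx1 : e ∩ f = {x} := by
      refine Finset.eq_singleton_iff_unique_mem.2 ⟨by simp [hxe, hxf], ?_⟩
      intro t ht
      exact Finset.card_le_one.1 l1 t ht x (by simp [hxe, hxf])
    have hnd1 : ¬ DenseF q a r (e ∩ f) := by
      unfold DenseF
      rw [hx1, spanN_singleton, hX x (heX hxe)]
      simp
    have ht := glue_tight hq hqk hak e f hf.2.1 hf.2.2 (htight e he.2.1 he.2.2) hnd1
    have hinter : (e ∪ f) ∩ g = (g ∩ e) ∪ (f ∩ g) := by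
      ext t; simp only [Finset.mem_inter, Finset.mem_union]; tauto
    have hle2 : ((e ∪ f) ∩ g).card ≤ 2 := by
      rw [hinter]
      exact (Finset.card_union_le _ _).trans (by omega)
    have hge2 : 2 ≤ ((e ∪ f) ∩ g).card := by
      have : ({y, z} : Finset (Finset (Fin n))) ⊆ (e ∪ f) ∩ g := by
        intro t ht
        simp only [Finset.mem_insert, Finset.mem_singleton] at ht
        rcases ht with rfl | rfl
        · simp [hyf, hyg]
        · simp [hze, hzg]
      have := Finset.card_le_card this
      rwa [Finset.card_pair hyz] at this
    have hefX := Finset.union_subset heX hfX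
    have hd := glue_strict hq hqk hak hgcd (e ∪ f) g hg.2.1 hg.2.2 ht hge2 (by omega)
      (hnd _ (Finset.inter_subset_left.trans hefX) hge2 (by omega))
    have hc := Finset.card_union_add_card_inter (e ∪ f) g
    have hc2 := Finset.card_union_add_card_inter e f
    exact hnd _ (Finset.union_subset hefX hgX) (by omega) (by omega) hd

lemma count_span (Q : Finset (Finset (Finset (Fin n)))) (w : ℕ)
    (hQ : ∀ F ∈ Q, spanN F = w) : (Q.card : ℝ) ≤ 2 ^ (2 ^ w) * (n : ℝ) ^ w := by
  have hsub : Q ⊆ (Finset.powersetCard w (Finset.univ : Finset (Fin n))).biUnion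
      (fun W => W.powerset.powerset) := by
    intro F hF
    rw [Finset.mem_biUnion]
    refine ⟨F.sup id, Finset.mem_powersetCard.2 ⟨Finset.subset_univ _, hQ F hF⟩, ?_⟩
    rw [Finset.mem_powerset]
    intro A hA
    rw [Finset.mem_powerset]
    exact Finset.le_sup (f := id) hA
  have h1 : Q.card ≤ n.choose w * 2 ^ (2 ^ w) := by
    refine (Finset.card_le_card hsub).trans (Finset.card_biUnion_le.trans ?_)
    rw [Finset.sum_congr rfl (g := fun _ => 2 ^ (2 ^ w))]
    · simp
    · intro W hW
      rw [Finset.card_powerset, Finset.card_powerset, (Finset.mem_powersetCard.1 hW).2]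
  have h2 : n.choose w ≤ n ^ w := Nat.choose_le_pow n w
  have h3 : Q.card ≤ 2 ^ (2 ^ w) * n ^ w := by
    refine h1.trans ?_
    rw [mul_comm]
    exact Nat.mul_le_mul_left _ h2
  exact_mod_cast h3

lemma count_bad (Q : Finset (Finset (Finset (Fin n)))) (v : ℕ) (hn : 1 ≤ n)
    (hQ : ∀ F ∈ Q, spanN F ≤ v) :
    (Q.card : ℝ) ≤ (v + 1) * 2 ^ (2 ^ v) * (n : ℝ) ^ v := by
  have hmap : ∀ F ∈ Q, spanN F ∈ Finset.range (v + 1) := fun F hF =>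
    Finset.mem_range.2 (Nat.lt_succ_of_le (hQ F hF))
  have h1 := Finset.card_eq_sum_card_fiberwise hmap
  rw [h1]
  push_cast
  have hn' : (1:ℝ) ≤ n := by exact_mod_cast hn
  calc _ ≤ ∑ w ∈ Finset.range (v + 1), (2:ℝ) ^ (2 ^ v) * (n : ℝ) ^ v := by
        refine Finset.sum_le_sum fun w hw => ?_
        have hwv : w ≤ v := Nat.lt_succ_iff.1 (Finset.mem_range.1 hw)
        refine (count_span _ w (fun F hF => (Finset.mem_filter.1 hF).2)).trans ?_
        refine mul_le_mul ?_ (pow_le_pow_right₀ hn' hwv) (by positivity) (by positivity)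
        exact pow_le_pow_right₀ (by norm_num) (Nat.pow_le_pow_right (by norm_num) hwv)
    _ = _ := by simp; ring

lemma sum_dense (Q : Finset (Finset (Finset (Fin n)))) (L : ℕ) (hn : 1 ≤ n) (p α : ℝ)
    (hL : ∀ F ∈ Q, spanN F ≤ L)
    (hQ : ∀ F ∈ Q, p ^ F.card ≤ (n : ℝ) ^ (α - spanN F)) :
    ∑ F ∈ Q, p ^ F.card ≤ (L + 1) * 2 ^ (2 ^ L) * (n : ℝ) ^ α := by
  have hmap : ∀ F ∈ Q, spanN F ∈ Finset.range (L + 1) := fun F hF =>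
    Finset.mem_range.2 (Nat.lt_succ_of_le (hL F hF))
  have hn0 : (0:ℝ) < n := by exact_mod_cast hn
  refine (Finset.sum_le_sum hQ).trans ?_
  rw [← Finset.sum_fiberwise_of_maps_to hmap]
  calc _ ≤ ∑ w ∈ Finset.range (L + 1), (2:ℝ) ^ (2 ^ L) * (n : ℝ) ^ α := by
        refine Finset.sum_le_sum fun w hw => ?_
        have hwv : w ≤ L := Nat.lt_succ_iff.1 (Finset.mem_range.1 hw)
        rw [Finset.sum_congr rfl (g := fun _ => (n : ℝ) ^ (α - w))]
        · rw [Finset.sum_const, nsmul_eq_mul]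
          have := count_span (Q.filter (fun F => spanN F = w)) w
            (fun F hF => (Finset.mem_filter.1 hF).2)
          calc _ ≤ (2 ^ (2 ^ w) * (n : ℝ) ^ w) * (n : ℝ) ^ (α - w) :=
                mul_le_mul_of_nonneg_right this (by positivity)
            _ = 2 ^ (2 ^ w) * (n : ℝ) ^ α := by
                rw [mul_assoc, ← Real.rpow_natCast (n : ℝ) w, ← Real.rpow_add hn0]
                congr 2; ring
            _ ≤ _ := by
                refine mul_le_mul_of_nonneg_right ?_ (by positivity)
                exact pow_le_pow_right₀ (by norm_num) (Nat.pow_le_pow_right (by norm_num) hwv)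
        · intro F hF
          rw [(Finset.mem_filter.1 hF).2]
    _ = _ := by simp; ring

lemma spanN_le (r : ℕ) (F : Finset (Finset (Fin n))) (hF : ∀ A ∈ F, A.card = r) :
    spanN F ≤ r * F.card := by
  have : spanN F ≤ ∑ A ∈ F, A.card := by
    unfold spanN
    rw [Finset.sup_eq_biUnion]
    exact Finset.card_biUnion_le
  rw [Finset.sum_congr rfl hF] at this
  simpa [mul_comm] using this

open Classical in
lemma perN {q a : ℤ} {r k v M : ℕ} (hk : 3 ≤ k) (hqk : q = k - 1)
    (hak : a = k * r - v) (hgcd : Int.gcd q a = 1) (hM : 3 * k ≤ M)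
    (m : ℕ) (θ p : ℝ) (hθ : 0 < θ) (hmθ : 2 ^ m * θ ≤ 1 / 4) (hp0 : 0 ≤ p) (hp1 : p ≤ 1) :
    ∃ H ⊆ Finset.powersetCard r (Finset.univ : Finset (Fin n)),
      (∀ F ⊆ H, 2 ≤ F.card → F.card ≤ M → ¬ DenseF q a r F) ∧
      (∀ F ⊆ H, F.card = k → ¬ spanN F ≤ v) ∧
      ((m : ℝ) * θ / 2) * (p * n.choose r
          - ∑ F ∈ (Finset.powersetCard r (Finset.univ : Finset (Fin n))).powerset.filter
              (fun F => 2 ≤ F.card ∧ F.card ≤ M ∧ DenseF q a r F), p ^ F.card)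
        - 2 ^ (k ^ 2) * (m : ℝ) ^ (k - 1) * θ ^ k * (p ^ k *
          ((Finset.powersetCard r (Finset.univ : Finset (Fin n))).powerset.filter
            (fun F => F.card = k ∧ spanN F ≤ v)).card) ≤ (H.card : ℝ) := by
  set Ω := Finset.powersetCard r (Finset.univ : Finset (Fin n)) with hΩ
  set 𝒟 := Ω.powerset.filter (fun F => 2 ≤ F.card ∧ F.card ≤ M ∧ DenseF q a r F) with h𝒟
  set ℬ := Ω.powerset.filter (fun F => F.card = k ∧ spanN F ≤ v) with hℬ
  set c1 : ℝ := (m : ℝ) * θ / 2 with hc1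
  set c2 : ℝ := 2 ^ (k ^ 2) * (m : ℝ) ^ (k - 1) * θ ^ k with hc2
  have hc1' : 0 ≤ c1 := by positivity
  have hc2' : 0 ≤ c2 := by positivity
  set f : Finset (Finset (Fin n)) → ℝ := fun X =>
    c1 * ((∑ x ∈ Ω, if ({x} : Finset (Finset (Fin n))) ⊆ X ∧ Disjoint ∅ X then (1:ℝ) else 0)
      - ∑ F ∈ 𝒟, if F ⊆ X ∧ Disjoint ∅ X then (1:ℝ) else 0)
    - c2 * ∑ F ∈ ℬ, if F ⊆ X ∧ Disjoint ∅ X then (1:ℝ) else 0 with hf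
  obtain ⟨X, hXΩ, hX⟩ := bexp_exists Ω hp0 hp1 f
  have hexp : bexp Ω p f = c1 * (p * n.choose r - ∑ F ∈ 𝒟, p ^ F.card)
      - c2 * (p ^ k * ℬ.card) := by
    rw [hf, bexp_sub, bexp_const_mul, bexp_const_mul, bexp_sub, bexp_sum, bexp_sum, bexp_sum]
    have e1 : ∑ x ∈ Ω, bexp Ω p (fun X => if ({x} : Finset (Finset (Fin n))) ⊆ X ∧
        Disjoint ∅ X then (1:ℝ) else 0) = p * n.choose r := by
      rw [Finset.sum_congr rfl (g := fun _ => p)]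
      · simp [hΩ, mul_comm]
      · intro x hx
        rw [bexp_ind Ω p _ _ (by simpa using hx) (by simp) (by simp)]
        simp
    have e2 : ∀ Q : Finset (Finset (Finset (Fin n))), Q ⊆ Ω.powerset →
        ∑ F ∈ Q, bexp Ω p (fun X => if F ⊆ X ∧ Disjoint ∅ X then (1:ℝ) else 0)
          = ∑ F ∈ Q, p ^ F.card := by
      intro Q hQ
      refine Finset.sum_congr rfl fun F hF => ?_
      rw [bexp_ind Ω p _ _ (Finset.mem_powerset.1 (hQ hF)) (by simp) (by simp)]
      simp
    rw [e1, e2 𝒟 (Finset.filter_subset _ _), e2 ℬ (Finset.filter_subset _ _)]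
    congr 2
    rw [Finset.sum_congr rfl (g := fun _ => p ^ k)]
    · simp [mul_comm]
    · intro F hF
      rw [(Finset.mem_filter.1 hF).2.1]
  rw [hexp] at hX
  set 𝒟X := 𝒟.filter (fun F => F ⊆ X) with h𝒟X
  have hpick : ∀ F : Finset (Finset (Fin n)), ∃ x : Option (Finset (Fin n)),
      F ∈ 𝒟 → ∃ y ∈ F, x = some y := by
    intro F
    by_cases hF : F ∈ 𝒟
    · have : F.Nonempty := Finset.card_pos.1 (by
        have := (Finset.mem_filter.1 hF).2.1; omega)
      obtain ⟨y, hy⟩ := this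
      exact ⟨some y, fun _ => ⟨y, hy, rfl⟩⟩
    · exact ⟨none, fun h => absurd h hF⟩
  choose pk hpk using hpick
  set R : Finset (Finset (Fin n)) := 𝒟X.biUnion (fun F => (pk F).toFinset) with hR
  have hRc : R.card ≤ 𝒟X.card := by
    calc R.card ≤ ∑ e ∈ 𝒟X, (pk e).toFinset.card := Finset.card_biUnion_le
      _ ≤ ∑ e ∈ 𝒟X, 1 := Finset.sum_le_sum fun e _ => by
          cases h : pk e <;> simp
      _ = 𝒟X.card := by simp
  set X' := X \ R with hX'
  have hX'X : X' ⊆ X := Finset.sdiff_subset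
  have hX'Ω : X' ⊆ Ω := hX'X.trans hXΩ
  have hnd : ∀ F ⊆ X', 2 ≤ F.card → F.card ≤ M → ¬ DenseF q a r F := by
    intro F hF h2 hFM hd
    have hF𝒟 : F ∈ 𝒟 := Finset.mem_filter.2
      ⟨Finset.mem_powerset.2 (hF.trans hX'Ω), h2, hFM, hd⟩
    obtain ⟨y, hy, hpe⟩ := hpk F hF𝒟
    refine (Finset.mem_sdiff.1 (hF hy)).2 ?_
    exact Finset.mem_biUnion.2 ⟨F, Finset.mem_filter.2 ⟨hF𝒟, hF.trans hX'X⟩, by simp [hpe]⟩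
  obtain ⟨ℰ, hℰ, hgood⟩ : ∃ ℰ : Finset (Finset (Finset (Fin n))),
      (∀ F, F ∈ ℰ ↔ F ⊆ X' ∧ F.card = k ∧ spanN F ≤ v) ∧ GoodHG X' ℰ :=
    ⟨_, fun F => by rw [Finset.mem_filter, Finset.mem_powerset], good_bad hk hqk hak hgcd hM X'
    (fun x hx => (Finset.mem_powersetCard.1 (hX'Ω hx)).2) hnd⟩
  obtain ⟨I, hIX, hIE, hIc⟩ := mainHG m θ hθ hmθ X' ℰ hgood
  refine ⟨I, hIX.trans hX'Ω, fun F hF => hnd F (hF.trans hIX), ?_, ?_⟩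
  · intro F hF hFk hFv
    exact hIE F ((hℰ F).2 ⟨hF.trans hIX, hFk, hFv⟩) hF
  · refine hX.trans (le_trans ?_ hIc)
    have s1 : (∑ x ∈ Ω, if ({x} : Finset (Finset (Fin n))) ⊆ X ∧ Disjoint ∅ X
        then (1:ℝ) else 0) = X.card := by
      simp only [Finset.singleton_subset_iff, Finset.disjoint_empty_left, and_true]
      rw [← Finset.sum_filter, Finset.filter_mem_eq_inter, Finset.inter_eq_right.2 hXΩ]
      simp
    have s2 : (∑ F ∈ 𝒟, if F ⊆ X ∧ Disjoint ∅ X then (1:ℝ) else 0) = 𝒟X.card := by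
      simp [h𝒟X]
    have s3 : (∑ F ∈ ℬ, if F ⊆ X ∧ Disjoint ∅ X then (1:ℝ) else 0)
        = (ℬ.filter (fun F => F ⊆ X)).card := by
      simp
    have hX'c : (X.card : ℝ) - 𝒟X.card ≤ X'.card := by
      have : X.card ≤ X'.card + R.card := by
        have := Finset.le_card_sdiff R X
        rw [hX']; omega
      have : X.card ≤ X'.card + 𝒟X.card := by omega
      have : (X.card : ℝ) ≤ X'.card + 𝒟X.card := by exact_mod_cast this
      linarith
    have hsum : ∑ e ∈ ℰ,
        (2:ℝ) ^ (e.card ^ 2) * (m : ℝ) ^ (e.card - 1) * θ ^ e.card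
        ≤ c2 * (ℬ.filter (fun F => F ⊆ X)).card := by
      rw [Finset.sum_congr rfl (g := fun _ => c2)]
      · rw [Finset.sum_const, nsmul_eq_mul, mul_comm]
        refine mul_le_mul_of_nonneg_left ?_ hc2'
        have : ℰ.card
            ≤ (ℬ.filter (fun F => F ⊆ X)).card := by
          refine Finset.card_le_card fun F hF => ?_
          have hF := (hℰ F).1 hF
          have hFX := hF.1
          exact Finset.mem_filter.2 ⟨Finset.mem_filter.2
            ⟨Finset.mem_powerset.2 (hFX.trans hX'Ω), hF.2⟩, hFX.trans hX'X⟩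
        exact_mod_cast this
      · intro e he
        rw [((hℰ e).1 he).2.1]
    simp only [hf]
    rw [s1, s2, s3]
    have := mul_le_mul_of_nonneg_left hX'c hc1'
    exact sub_le_sub this hsum

end appl
lemma realineq (k r v m : ℕ) (hk : 3 ≤ k) (hm : 1 ≤ m) (n α δ c0 cr C1 C2 z : ℝ) (hn : 1 ≤ n)
    (hα : (α - r) * (k - 1) + v = r)
    (hc0 : 0 < c0) (hC1 : C1 ≤ cr / 2 * n ^ δ)
    (hcc : 2 ^ (k ^ 2) * C2 * c0 ^ (k - 1) ≤ cr / 8)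
    (hz : 0 < z) (hzm : z ^ (k - 1) = m) :
    c0 * cr / 8 * (n ^ α * z) ≤
      ((m : ℝ) * (c0 / (n ^ δ * z ^ (k - 2))) / 2) *
          (n ^ (α - r + δ) * (cr * n ^ r) - C1 * n ^ α)
        - 2 ^ (k ^ 2) * (m : ℝ) ^ (k - 1) * (c0 / (n ^ δ * z ^ (k - 2))) ^ k *
          ((n ^ (α - r + δ)) ^ k * (C2 * n ^ v)) := by
  have hn0 : 0 < n := by linarith
  obtain ⟨q, rfl⟩ : ∃ q, k = q + 2 := ⟨k - 2, by omega⟩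
  have e1 : q + 2 - 1 = q + 1 := rfl
  have e2 : q + 2 - 2 = q := rfl
  rw [e1] at hcc hzm
  rw [e1, e2]
  set t := n ^ (α - r) with ht
  set y := n ^ δ with hy
  have ht0 : 0 < t := by positivity
  have hy0 : 0 < y := by positivity
  have hp : n ^ (α - r + δ) = t * y := Real.rpow_add hn0 _ _
  have hx : n ^ α = t * n ^ r := by
    rw [ht, ← Real.rpow_natCast n r, ← Real.rpow_add hn0]; congr 1; ring
  have htq : t ^ (q + 1) * n ^ v = n ^ r := by
    rw [ht, ← Real.rpow_natCast n r, ← Real.rpow_natCast n v, ← Real.rpow_natCast (n ^ (α - r)),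
      ← Real.rpow_mul hn0.le, ← Real.rpow_add hn0]
    congr 1
    push_cast at hα ⊢
    linarith
  rw [hp]
  set x := n ^ α with hxd
  have hx0 : 0 < x := by positivity
  have f1 : (m : ℝ) * (c0 / (y * z ^ q)) = c0 * z / y := by
    rw [← hzm]; field_simp; try ring
  have f2 : (m : ℝ) ^ (q + 1) * (c0 / (y * z ^ q)) ^ (q + 2) * ((t * y) ^ (q + 2) * n ^ v)
      = c0 ^ (q + 1) * (c0 * (x * z)) := by
    have : (c0 / (y * z ^ q)) ^ (q + 2) * (t * y) ^ (q + 2) = (c0 * t / z ^ q) ^ (q + 2) := by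
      rw [← mul_pow]; congr 1; field_simp
    calc _ = (m : ℝ) ^ (q + 1) * ((c0 / (y * z ^ q)) ^ (q + 2) * (t * y) ^ (q + 2)) * n ^ v := by
          ring
      _ = (z ^ (q + 1)) ^ (q + 1) * ((c0 * t) ^ (q + 2) / (z ^ q) ^ (q + 2)) * n ^ v := by
          rw [this, ← hzm, div_pow]
      _ = z * (c0 * t) ^ (q + 2) * n ^ v := by
          have : (z ^ (q + 1)) ^ (q + 1) = z * (z ^ q) ^ (q + 2) := by ring
          rw [this]; field_simp
      _ = c0 ^ (q + 1) * (c0 * ((t * (t ^ (q + 1) * n ^ v)) * z)) := by ring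
      _ = _ := by rw [htq, hx]
  have f3 : 2 ^ ((q + 2) ^ 2) * (m : ℝ) ^ (q + 1) * (c0 / (y * z ^ q)) ^ (q + 2) *
      ((t * y) ^ (q + 2) * (C2 * n ^ v))
      = (2 ^ ((q + 2) ^ 2) * C2 * c0 ^ (q + 1)) * (c0 * (x * z)) := by
    calc _ = 2 ^ ((q + 2) ^ 2) * C2 * ((m : ℝ) ^ (q + 1) * (c0 / (y * z ^ q)) ^ (q + 2) *
      ((t * y) ^ (q + 2) * n ^ v)) := by ring
      _ = _ := by rw [f2]; ring
  rw [f3, f1]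
  have g1 : t * y * (cr * n ^ r) = cr * y * x := by rw [hx]; ring
  rw [g1]
  have g2 : cr / 2 * y * x ≤ cr * y * x - C1 * x := by
    have := mul_le_mul_of_nonneg_right hC1 hx0.le
    linarith
  have g3 : c0 * z / y / 2 * (cr / 2 * y * x) ≤ c0 * z / y / 2 * (cr * y * x - C1 * x) :=
    mul_le_mul_of_nonneg_left g2 (by positivity)
  have g4 : c0 * z / y / 2 * (cr / 2 * y * x) = c0 * cr / 4 * (x * z) := by field_simp; try ring
  have g5 := mul_le_mul_of_nonneg_right hcc (show 0 ≤ c0 * (x * z) by positivity)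
  nlinarith

lemma choose_lower (r n : ℕ) (hn : 2 * r ≤ n) :
    (1 / (2 ^ r * r.factorial) : ℝ) * (n : ℝ) ^ r ≤ n.choose r := by
  have h := Nat.pow_le_choose (α := ℝ) r n
  refine le_trans ?_ h
  have h2 : (n : ℝ) / 2 ≤ ((n + 1 - r : ℕ) : ℝ) := by
    rw [Nat.cast_sub (by omega)]
    have : (2 * r : ℝ) ≤ n := by exact_mod_cast hn
    push_cast; linarith
  have h3 := pow_le_pow_left₀ (by positivity) h2 r
  calc _ = ((n : ℝ) / 2) ^ r / r.factorial := by rw [div_pow]; field_simp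
    _ ≤ _ := by gcongr

open Classical in
lemma perN2 {n : ℕ} {q a : ℤ} {r k v M : ℕ} (hk : 3 ≤ k) (hqk : q = k - 1)
    (hak : a = k * r - v) (hgcd : Int.gcd q a = 1) (hM : 3 * k ≤ M) (hv : r + 1 ≤ v)
    (hn : 1 ≤ n) (hnr : 2 * r ≤ n)
    (m : ℕ) (θ α δ : ℝ) (hθ : 0 < θ) (hmθ : 2 ^ m * θ ≤ 1 / 4)
    (hα : α = (a : ℝ) / q) (hδ : δ = 1 / (q * M)) :
    ∃ H ⊆ Finset.powersetCard r (Finset.univ : Finset (Fin n)),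
      (∀ F ⊆ H, 2 ≤ F.card → F.card ≤ M → ¬ DenseF q a r F) ∧
      (∀ F ⊆ H, F.card = k → ¬ spanN F ≤ v) ∧
      ((m : ℝ) * θ / 2) * ((n : ℝ) ^ (α - r + δ) * ((1 / (2 ^ r * r.factorial) : ℝ) * (n : ℝ) ^ r)
          - (((r * M : ℕ) : ℝ) + 1) * 2 ^ (2 ^ (r * M)) * (n : ℝ) ^ α)
        - 2 ^ (k ^ 2) * (m : ℝ) ^ (k - 1) * θ ^ k * (((n : ℝ) ^ (α - r + δ)) ^ k *
          (((v + 1) * 2 ^ (2 ^ v)) * (n : ℝ) ^ v)) ≤ (H.card : ℝ) := by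
  have hn1 : (1:ℝ) ≤ n := by exact_mod_cast hn
  have hn0 : (0:ℝ) < n := by linarith
  have hq2 : 2 ≤ q := by omega
  have hq2' : (2:ℝ) ≤ q := by exact_mod_cast hq2
  have hq0 : (0:ℝ) < q := by linarith
  have hM1 : (1:ℝ) ≤ M := by exact_mod_cast (show 1 ≤ M by omega)
  have hM0 : (0:ℝ) < M := by linarith
  have hδq : δ * M = 1 / q := by rw [hδ]; field_simp
  have hδ0 : 0 < δ := by rw [hδ]; positivity
  have hδ1 : δ ≤ 1 / q := by
    rw [← hδq]; nlinarith
  have hαq : α * q = a := by rw [hα]; field_simp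
  set p : ℝ := (n : ℝ) ^ (α - r + δ) with hp
  have hp0 : 0 ≤ p := by positivity
  have hqi : (1 / (q:ℝ)) * q = 1 := by field_simp
  have hp1 : p ≤ 1 := by
    refine Real.rpow_le_one_of_one_le_of_nonpos hn1 ?_
    have h1 : a + 1 ≤ q * r := by
      rw [hak, hqk]
      have : ((r:ℤ) + 1 ≤ v) := by exact_mod_cast hv
      linarith
    have h1' : (a : ℝ) + 1 ≤ q * r := by exact_mod_cast h1
    have : α + 1 / q ≤ r := by
      by_contra hcon
      push Not at hcon
      have := mul_lt_mul_of_pos_right hcon hq0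
      linarith
    linarith
  obtain ⟨H, hH, h1, h2, h3⟩ := perN (n := n) hk hqk hak hgcd hM m θ p hθ hmθ hp0 hp1
  refine ⟨H, hH, h1, h2, le_trans ?_ h3⟩
  have hc := choose_lower r n hnr
  set 𝒟 := (Finset.powersetCard r (Finset.univ : Finset (Fin n))).powerset.filter
              (fun F => 2 ≤ F.card ∧ F.card ≤ M ∧ DenseF q a r F) with h𝒟
  set ℬ := (Finset.powersetCard r (Finset.univ : Finset (Fin n))).powerset.filter
            (fun F => F.card = k ∧ spanN F ≤ v) with hℬ
  have hb := count_bad ℬ v hn (fun F hF => (Finset.mem_filter.1 hF).2.2)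
  have hd := sum_dense 𝒟 (r * M) hn p α
    (fun F hF => by
      have hF := Finset.mem_filter.1 hF
      refine (spanN_le r F fun A hA =>
        (Finset.mem_powersetCard.1 (Finset.mem_powerset.1 hF.1 hA)).2).trans ?_
      exact Nat.mul_le_mul_left _ hF.2.2.1)
    (fun F hF => by
      have hF := (Finset.mem_filter.1 hF).2
      have hden : q * spanN F + a * ((F.card : ℤ) - 1) + 1 ≤ q * r * F.card := hF.2.2
      have hden' : (q : ℝ) * spanN F + a * ((F.card : ℝ) - 1) + 1 ≤ q * r * F.card := by
        exact_mod_cast hden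
      have hfM : (F.card : ℝ) ≤ M := by exact_mod_cast hF.2.1
      rw [hp, ← Real.rpow_natCast, ← Real.rpow_mul hn0.le]
      refine Real.rpow_le_rpow_of_exponent_le hn1 ?_
      have h5 : δ * F.card ≤ 1 / q := by
        rw [← hδq]; exact mul_le_mul_of_nonneg_left hfM hδ0.le
      have h6 : (α - r) * F.card + 1 / q ≤ α - spanN F := by
        by_contra hcon
        push Not at hcon
        have := mul_lt_mul_of_pos_right hcon hq0
        rw [← hαq] at hden'
        linarith
      linarith)
  have k1 : p * ((1 / (2 ^ r * r.factorial) : ℝ) * (n : ℝ) ^ r)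
          - (((r * M : ℕ) : ℝ) + 1) * 2 ^ (2 ^ (r * M)) * (n : ℝ) ^ α
      ≤ p * n.choose r - ∑ F ∈ 𝒟, p ^ F.card := by
    have := mul_le_mul_of_nonneg_left hc hp0
    linarith
  have k2 := mul_le_mul_of_nonneg_left k1 (show 0 ≤ (m : ℝ) * θ / 2 by positivity)
  have k3 := mul_le_mul_of_nonneg_left (mul_le_mul_of_nonneg_left hb (pow_nonneg hp0 k))
    (show 0 ≤ 2 ^ (k ^ 2) * (m : ℝ) ^ (k - 1) * θ ^ k by positivity)
  linarith

lemma asymp {q a : ℤ} {r k v M : ℕ} (hk : 3 ≤ k) (hqk : q = k - 1)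
    (hak : a = k * r - v) (hgcd : Int.gcd q a = 1) (hM : 3 * k ≤ M) (hv : r + 1 ≤ v) :
    ∃ c : ℝ, 0 < c ∧ ∃ N : ℕ, ∀ n : ℕ, N ≤ n →
      ∃ H ⊆ Finset.powersetCard r (Finset.univ : Finset (Fin n)),
      (∀ F ⊆ H, 2 ≤ F.card → F.card ≤ M → ¬ DenseF q a r F) ∧
      (∀ F ⊆ H, F.card = k → ¬ spanN F ≤ v) ∧
      c * (n : ℝ) ^ ((a : ℝ) / q) * Real.log n ^ ((1 : ℝ) / q) ≤ H.card := by
  have hq2 : 2 ≤ q := by omega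
  have hq2' : (2:ℝ) ≤ q := by exact_mod_cast hq2
  have hq0 : (0:ℝ) < q := by linarith
  have hM0 : (0:ℝ) < M := by exact_mod_cast (show 0 < M by omega)
  have hqkR : (q : ℝ) = k - 1 := by rw [hqk]; push_cast; ring
  have hakR : (a : ℝ) = k * r - v := by rw [hak]; push_cast; ring
  obtain ⟨α, hα⟩ : ∃ α : ℝ, α = (a : ℝ) / q := ⟨_, rfl⟩
  obtain ⟨δ, hδ⟩ : ∃ δ : ℝ, δ = 1 / (q * M) := ⟨_, rfl⟩
  obtain ⟨cr, hcr⟩ : ∃ cr : ℝ, cr = 1 / (2 ^ r * r.factorial) := ⟨_, rfl⟩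
  obtain ⟨C1, hC1⟩ : ∃ C1 : ℝ, C1 = (((r * M : ℕ) : ℝ) + 1) * 2 ^ (2 ^ (r * M)) := ⟨_, rfl⟩
  obtain ⟨C2, hC2⟩ : ∃ C2 : ℝ, C2 = (v + 1) * 2 ^ (2 ^ v) := ⟨_, rfl⟩
  have hδ0 : 0 < δ := by rw [hδ]; positivity
  have hcr0 : 0 < cr := by
    rw [hcr]
    have : (0:ℝ) < r.factorial := by exact_mod_cast r.factorial_pos
    positivity
  have hC20 : 0 < C2 := by rw [hC2]; positivity
  have hαe : (α - r) * ((k:ℝ) - 1) + v = r := by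
    rw [← hqkR]
    have : α * q = a := by rw [hα]; field_simp
    rw [sub_mul, this, hakR, hqkR]; ring
  obtain ⟨D, hD⟩ : ∃ D : ℝ, D = 2 ^ (k ^ 2) * C2 := ⟨_, rfl⟩
  have hD0 : 0 < D := by rw [hD]; positivity
  obtain ⟨c0, hc0, hc01, hcc⟩ : ∃ c0 : ℝ, 0 < c0 ∧ c0 ≤ 1 ∧ D * c0 ^ (k - 1) ≤ cr / 8 := by
    refine ⟨min 1 (cr / 8 / D), by positivity, min_le_left _ _, ?_⟩
    have h0 : 0 ≤ min 1 (cr / 8 / D) := by positivity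
    have h1 : (min 1 (cr / 8 / D)) ^ (k - 1) ≤ min 1 (cr / 8 / D) :=
      pow_le_of_le_one h0 (min_le_left _ _) (by omega)
    calc _ ≤ D * (cr / 8 / D) := mul_le_mul_of_nonneg_left (h1.trans (min_le_right _ _)) hD0.le
      _ = _ := by field_simp
  rw [hD] at hcc
  refine ⟨c0 * cr / 8 * (δ / 4) ^ ((1:ℝ) / q), by positivity, ?_⟩
  have ev1 := ((tendsto_rpow_atTop hδ0).comp tendsto_natCast_atTop_atTop).eventually_ge_atTop
    (C1 / (cr / 2))
  have ev2 := ((tendsto_rpow_atTop (half_pos hδ0)).comp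
    tendsto_natCast_atTop_atTop).eventually_ge_atTop (4:ℝ)
  have ev3 := (Real.tendsto_log_atTop.comp tendsto_natCast_atTop_atTop).eventually_ge_atTop
    (4 / δ)
  have ev4 := Filter.eventually_ge_atTop (2 * r + 1)
  obtain ⟨N, hN⟩ := Filter.eventually_atTop.1 (ev1.and (ev2.and (ev3.and ev4)))
  refine ⟨N, fun n hn => ?_⟩
  obtain ⟨h1, h2, h3, h4⟩ := hN n hn
  simp only [Function.comp] at h1 h2 h3
  have hn1 : (1:ℝ) ≤ n := by exact_mod_cast (show 1 ≤ n by omega)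
  have hn0 : (0:ℝ) < n := by linarith
  have hlog : 1 ≤ δ / 4 * Real.log n := by
    have := mul_le_mul_of_nonneg_left h3 (show 0 ≤ δ / 4 by positivity)
    calc (1:ℝ) = δ / 4 * (4 / δ) := by field_simp
      _ ≤ _ := this
  have hlog0 : 0 ≤ Real.log n := Real.log_nonneg hn1
  obtain ⟨m, hm⟩ : ∃ m : ℕ, m = ⌊δ / 2 * Real.log n⌋₊ := ⟨_, rfl⟩
  have hmu : (m : ℝ) ≤ δ / 2 * Real.log n := by
    rw [hm]; exact Nat.floor_le (by positivity)
  have hml : δ / 4 * Real.log n ≤ m := by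
    have := Nat.lt_floor_add_one (δ / 2 * Real.log n)
    rw [← hm] at this
    linarith
  have hm1 : 1 ≤ m := by
    have : (1:ℝ) ≤ m := hlog.trans hml
    exact_mod_cast this
  have hm1' : (1:ℝ) ≤ m := by exact_mod_cast hm1
  obtain ⟨z, hz⟩ : ∃ z : ℝ, z = (m : ℝ) ^ ((1:ℝ) / q) := ⟨_, rfl⟩
  have hz1 : 1 ≤ z := by rw [hz]; exact Real.one_le_rpow hm1' (by positivity)
  have hz0 : 0 < z := by linarith
  have hzm : z ^ (k - 1) = m := by
    rw [hz, ← Real.rpow_natCast, ← Real.rpow_mul (by linarith)]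
    have : (1:ℝ) / q * ((k - 1 : ℕ) : ℝ) = 1 := by
      rw [Nat.cast_sub (by omega), hqkR]
      have : (k:ℝ) - 1 ≠ 0 := by rw [← hqkR]; exact hq0.ne'
      push_cast
      field_simp
    rw [this, Real.rpow_one]
  have hzl : (δ / 4) ^ ((1:ℝ) / q) * Real.log n ^ ((1:ℝ) / q) ≤ z := by
    rw [← Real.mul_rpow (by positivity) hlog0, hz]
    exact Real.rpow_le_rpow (by positivity) hml (by positivity)
  have hy : (n : ℝ) ^ δ = (n:ℝ) ^ (δ / 2) * (n:ℝ) ^ (δ / 2) := by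
    rw [← Real.rpow_add hn0]; congr 1; ring
  have h2m : (2:ℝ) ^ m ≤ (n:ℝ) ^ (δ / 2) := by
    calc (2:ℝ) ^ m ≤ (Real.exp 1) ^ m := by
          refine pow_le_pow_left₀ (by norm_num) ?_ m
          have := Real.add_one_le_exp (1:ℝ)
          linarith
      _ = Real.exp m := by rw [← Real.exp_nat_mul]; simp
      _ ≤ Real.exp (Real.log n * (δ / 2)) := Real.exp_le_exp.2 (by linarith)
      _ = _ := by rw [Real.rpow_def_of_pos hn0]
  have hmθ : 2 ^ m * (c0 / ((n:ℝ) ^ δ * z ^ (k - 2))) ≤ 1 / 4 := by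
    have hw0 : 0 < (n:ℝ) ^ (δ / 2) := by positivity
    have hzp : 1 ≤ z ^ (k - 2) := one_le_pow₀ hz1
    rw [hy, ← mul_div_assoc, div_le_div_iff₀ (by positivity) (by norm_num)]
    have a1 : 2 ^ m * c0 ≤ (n:ℝ) ^ (δ / 2) * 1 := mul_le_mul h2m hc01 hc0.le hw0.le
    have a2 : (n:ℝ) ^ (δ / 2) * 4 ≤ (n:ℝ) ^ (δ / 2) * (n:ℝ) ^ (δ / 2) :=
      mul_le_mul_of_nonneg_left h2 hw0.le
    have a3 : (n:ℝ) ^ (δ / 2) * (n:ℝ) ^ (δ / 2) * 1 ≤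
        (n:ℝ) ^ (δ / 2) * (n:ℝ) ^ (δ / 2) * z ^ (k - 2) :=
      mul_le_mul_of_nonneg_left hzp (by positivity)
    linarith
  obtain ⟨H, hH, p1, p2, p3⟩ := perN2 (n := n) hk hqk hak hgcd hM hv (by omega) (by omega) m
    (c0 / ((n:ℝ) ^ δ * z ^ (k - 2))) α δ (by positivity) hmθ hα hδ
  refine ⟨H, hH, p1, p2, le_trans ?_ p3⟩
  rw [← hcr, ← hC1, ← hC2]
  refine le_trans ?_ (realineq k r v m hk hm1 n α δ c0 cr C1 C2 z hn1 hαe hc0 ?_ hcc hz0 hzm)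
  · rw [← hα]
    have b := mul_le_mul_of_nonneg_left hzl
      (show 0 ≤ c0 * cr / 8 * (n:ℝ) ^ α by positivity)
    linarith
  · have := (div_le_iff₀ (show 0 < cr / 2 by positivity)).1 h1
    linarith

/-- Proposition 2.2: simultaneous `𝒢_r(v_i, e_i)`-freeness for a family of parameter pairs
`(v_i, e_i)`, `1 ≤ i ≤ s`, with `Ω(n^((e₁r-v₁)/(e₁-1)) (log n)^(1/(e₁-1)))` edges. -/
theorem stmt_7 (s r : ℕ) (hs : 1 ≤ s) (hr : 3 ≤ r) (v e : ℕ → ℕ)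
    (hve : ∀ i, 1 ≤ i → i ≤ s → r + 1 ≤ v i ∧ 2 ≤ e i)
    (he1 : 3 ≤ e 1)
    (hgcd : Int.gcd ((e 1 : ℤ) - 1) ((e 1 : ℤ) * r - v 1) = 1)
    (hlt : ∀ i, 2 ≤ i → i ≤ s →
      ((e 1 : ℝ) * r - v 1) / ((e 1 : ℝ) - 1) < ((e i : ℝ) * r - v i) / ((e i : ℝ) - 1)) :
    ∃ c : ℝ, 0 < c ∧ ∃ N : ℕ, ∀ n : ℕ, N ≤ n →
      ∃ H : Finset (Finset (Fin n)),
        (∀ A ∈ H, A.card = r) ∧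
        c * (n : ℝ) ^ (((e 1 : ℝ) * r - v 1) / ((e 1 : ℝ) - 1)) *
          Real.log n ^ ((1 : ℝ) / ((e 1 : ℝ) - 1)) ≤ H.card ∧
        ∀ i, 1 ≤ i → i ≤ s → ∀ S ⊆ H, S.card = e i → v i + 1 ≤ (S.sup id).card := by
  obtain ⟨M, hM⟩ : ∃ M : ℕ, M = 3 * e 1 + ∑ i ∈ Finset.range (s + 1), e i := ⟨_, rfl⟩
  obtain ⟨c, hc, N, hN⟩ := asymp (M := M) he1 rfl rfl hgcd (by omega)
    (hve 1 le_rfl hs).1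
  refine ⟨c, hc, N, fun n hn => ?_⟩
  obtain ⟨H, hH, h1, h2, h3⟩ := hN n hn
  refine ⟨H, fun A hA => (Finset.mem_powersetCard.1 (hH hA)).2, ?_, ?_⟩
  · push_cast at h3
    exact h3
  · intro i hi1 his S hS hSc
    by_contra hcon
    have hsp : spanN S ≤ v i := by unfold spanN; omega
    rcases Nat.eq_or_lt_of_le hi1 with rfl | hi2
    · exact h2 S hS hSc hsp
    · have hei := (hve i hi1 his).2
      have hle : e i ≤ ∑ i ∈ Finset.range (s + 1), e i :=
        Finset.single_le_sum (f := e) (fun _ _ => Nat.zero_le _)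
          (Finset.mem_range.2 (by omega))
      refine h1 S hS (by omega) (by omega) ?_
      have hl := hlt i hi2 his
      have d1 : (0:ℝ) < (e 1 : ℝ) - 1 := by
        have : (3:ℝ) ≤ e 1 := by exact_mod_cast he1
        linarith
      have d2 : (0:ℝ) < (e i : ℝ) - 1 := by
        have : (2:ℝ) ≤ e i := by exact_mod_cast hei
        linarith
      rw [div_lt_div_iff₀ d1 d2] at hl
      have hl' : ((e 1 : ℤ) * r - v 1) * ((e i : ℤ) - 1) < ((e i : ℤ) * r - v i) * ((e 1 : ℤ) - 1) := by
        exact_mod_cast hl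
      unfold DenseF
      rw [hSc]
      have h5 : ((e 1 : ℤ) - 1) * spanN S ≤ ((e 1 : ℤ) - 1) * v i :=
        mul_le_mul_of_nonneg_left (by exact_mod_cast hsp) (by omega)
      linarith
end

section
/- For all fixed integers r ≥ 3, q and e with e > q+r ≥ 3 and gcd(e-1, r+q) = 1, there exist a constant c > 0 and an integer N such that for every n ≥ N there exists an r-graph H on vertex set [n] with at least c · n^{r-1+(r+q)/(e-1)} · (log n)^{1/(e-1)} edges which is ℋ_r(q,e)-free, i.e., for every integer i with 1 ≤ i ≤ e, the union of any i distinct edges of H contains at least i-q vertices. -/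
namespace AK

open Finset
set_option linter.unusedSectionVars false


/-! ### Finite product expectations -/

section Expectation

variable {ι : Type*} [Fintype ι] [DecidableEq ι]

/-- Weight of a point of the product Bernoulli space. -/
noncomputable def wt (p : ι → ℝ) (ω : ι → Bool) : ℝ := ∏ i, (if ω i = true then p i else 1 - p i)

/-- Expectation for the product Bernoulli measure. -/
noncomputable def Ex (p : ι → ℝ) (f : (ι → Bool) → ℝ) : ℝ := ∑ ω, wt p ω * f ω

theorem Ex_one (p : ι → ℝ) : Ex p (fun _ => 1) = 1 := by
  unfold Ex wt
  simp only [mul_one]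
  have := Finset.prod_univ_sum (fun _ : ι => (Finset.univ : Finset Bool))
    (fun i b => if b = true then p i else 1 - p i)
  rw [Fintype.piFinset_univ] at this
  rw [← this]
  simp

theorem Ex_add (p : ι → ℝ) (f g : (ι → Bool) → ℝ) :
    Ex p (fun ω => f ω + g ω) = Ex p f + Ex p g := by
  unfold Ex; rw [← Finset.sum_add_distrib]; simp only [mul_add]

theorem Ex_sub (p : ι → ℝ) (f g : (ι → Bool) → ℝ) :
    Ex p (fun ω => f ω - g ω) = Ex p f - Ex p g := by
  unfold Ex; rw [← Finset.sum_sub_distrib]; simp only [mul_sub]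

theorem Ex_const_mul (p : ι → ℝ) (c : ℝ) (f : (ι → Bool) → ℝ) :
    Ex p (fun ω => c * f ω) = c * Ex p f := by
  unfold Ex; rw [Finset.mul_sum]; refine Finset.sum_congr rfl fun ω _ => by ring

theorem Ex_const (p : ι → ℝ) (c : ℝ) : Ex p (fun _ => c) = c := by
  have := Ex_const_mul p c (fun _ => 1)
  rw [Ex_one] at this; simpa using this

theorem Ex_sum {κ : Type*} (p : ι → ℝ) (s : Finset κ) (f : κ → (ι → Bool) → ℝ) :
    Ex p (fun ω => ∑ k ∈ s, f k ω) = ∑ k ∈ s, Ex p (f k) := by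
  unfold Ex; rw [Finset.sum_comm]; simp only [Finset.mul_sum]

theorem wt_nonneg {p : ι → ℝ} (h0 : ∀ i, 0 ≤ p i) (h1 : ∀ i, p i ≤ 1) (ω : ι → Bool) :
    0 ≤ wt p ω := by
  unfold wt
  refine Finset.prod_nonneg fun i _ => ?_
  split_ifs
  · exact h0 i
  · linarith [h1 i]

theorem Ex_mono {p : ι → ℝ} (h0 : ∀ i, 0 ≤ p i) (h1 : ∀ i, p i ≤ 1) {f g : (ι → Bool) → ℝ}
    (h : ∀ ω, f ω ≤ g ω) : Ex p f ≤ Ex p g := by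
  unfold Ex
  exact Finset.sum_le_sum fun ω _ => mul_le_mul_of_nonneg_left (h ω) (wt_nonneg h0 h1 ω)

theorem Ex_nonneg {p : ι → ℝ} (h0 : ∀ i, 0 ≤ p i) (h1 : ∀ i, p i ≤ 1) {f : (ι → Bool) → ℝ}
    (h : ∀ ω, 0 ≤ f ω) : 0 ≤ Ex p f := by
  have := Ex_mono h0 h1 h
  rwa [Ex_const] at this

theorem exists_ge_Ex {p : ι → ℝ} (h0 : ∀ i, 0 ≤ p i) (h1 : ∀ i, p i ≤ 1) (f : (ι → Bool) → ℝ) :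
    ∃ ω, Ex p f ≤ f ω := by
  by_contra hcon
  push Not at hcon
  obtain ⟨ω₀, -, hω₀⟩ := Finset.exists_max_image (Finset.univ : Finset (ι → Bool)) f
    ⟨fun _ => true, Finset.mem_univ _⟩
  have : Ex p f ≤ Ex p (fun _ => f ω₀) := Ex_mono h0 h1 fun ω => hω₀ ω (Finset.mem_univ _)
  rw [Ex_const] at this
  exact absurd (hcon ω₀) (not_lt.mpr this)

theorem Ex_mul_of_disjoint (p : ι → ℝ) {f g : (ι → Bool) → ℝ} {A B : Set ι}
    (hf : DependsOn f A) (hg : DependsOn g B) (hAB : Disjoint A B) :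
    Ex p (fun ω => f ω * g ω) = Ex p f * Ex p g := by
  classical
  let Φ := Equiv.piEquivPiSubtypeProd (fun i : ι => i ∈ A) (fun _ => Bool)
  let w1 : ({i // i ∈ A} → Bool) → ℝ := fun x => ∏ i, (if x i = true then p i else 1 - p i)
  let w2 : ({i // i ∉ A} → Bool) → ℝ := fun x => ∏ i, (if x i = true then p i else 1 - p i)
  let F : ({i // i ∈ A} → Bool) → ℝ := fun x => f (Φ.symm (x, fun _ => true))
  let G : ({i // i ∉ A} → Bool) → ℝ := fun y => g (Φ.symm (fun _ => true, y))
  have hw : ∀ x y, wt p (Φ.symm (x, y)) = w1 x * w2 y := by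
    intro x y
    simp only [wt, w1, w2]
    rw [← Fintype.prod_subtype_mul_prod_subtype (fun i => i ∈ A)]
    congr 1
    · refine Finset.prod_congr rfl fun i _ => ?_
      simp [Φ, Equiv.piEquivPiSubtypeProd, i.2]
    · refine Finset.prod_congr rfl fun i _ => ?_
      simp [Φ, Equiv.piEquivPiSubtypeProd, i.2]
  have hF : ∀ x y, f (Φ.symm (x, y)) = F x := by
    intro x y
    refine hf fun i hi => ?_
    simp [Φ, Equiv.piEquivPiSubtypeProd, hi]
  have hG : ∀ x y, g (Φ.symm (x, y)) = G y := by
    intro x y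
    refine hg fun i hi => ?_
    have : i ∉ A := fun h => Set.disjoint_left.mp hAB h hi
    simp [Φ, Equiv.piEquivPiSubtypeProd, this]
  have key : ∀ h : (ι → Bool) → ℝ, Ex p h =
      ∑ x, ∑ y, w1 x * w2 y * h (Φ.symm (x, y)) := by
    intro h
    unfold Ex
    rw [← Fintype.sum_prod_type', ← Equiv.sum_comp Φ.symm]
    refine Finset.sum_congr rfl fun z _ => ?_
    rw [← hw]
  have hS1 : (∑ x, w1 x) * (∑ y, w2 y) = 1 := by
    rw [← Ex_one p, key, Finset.sum_mul_sum]
    simp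
  rw [key, key f, key g]
  simp only [hF, hG]
  have e1 : ∑ x, ∑ y, w1 x * w2 y * (F x * G y) = (∑ x, w1 x * F x) * ∑ y, w2 y * G y := by
    rw [Finset.sum_mul_sum]
    refine Finset.sum_congr rfl fun x _ => Finset.sum_congr rfl fun y _ => by ring
  have e2 : ∑ x, ∑ y, w1 x * w2 y * F x = (∑ x, w1 x * F x) * ∑ y, w2 y := by
    rw [Finset.sum_mul_sum]
    refine Finset.sum_congr rfl fun x _ => Finset.sum_congr rfl fun y _ => by ring
  have e3 : ∑ x, ∑ y, w1 x * w2 y * G y = (∑ x, w1 x) * ∑ y, w2 y * G y := by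
    rw [Finset.sum_mul_sum]
    refine Finset.sum_congr rfl fun x _ => Finset.sum_congr rfl fun y _ => by ring
  rw [e1, e2, e3]
  linear_combination (-(∑ x, w1 x * F x) * ∑ y, w2 y * G y) * hS1

theorem dependsOn_mul {f g : (ι → Bool) → ℝ} {A : Set ι} (hf : DependsOn f A)
    (hg : DependsOn g A) : DependsOn (fun ω => f ω * g ω) A := by
  intro x y h
  simp only [hf h, hg h]

theorem dependsOn_mono {f : (ι → Bool) → ℝ} {A B : Set ι} (hf : DependsOn f A)
    (h : A ⊆ B) : DependsOn f B := fun _ _ hxy => hf fun i hi => hxy i (h hi)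

theorem dependsOn_prod {κ : Type*} {s : Finset κ} {f : κ → (ι → Bool) → ℝ} {A : Set ι}
    (hf : ∀ k ∈ s, DependsOn (f k) A) : DependsOn (fun ω => ∏ k ∈ s, f k ω) A := by
  intro x y h
  exact Finset.prod_congr rfl fun k hk => hf k hk h

theorem dependsOn_sum {κ : Type*} {s : Finset κ} {f : κ → (ι → Bool) → ℝ} {A : Set ι}
    (hf : ∀ k ∈ s, DependsOn (f k) A) : DependsOn (fun ω => ∑ k ∈ s, f k ω) A := by
  intro x y h
  exact Finset.sum_congr rfl fun k hk => hf k hk h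

theorem Ex_prod_of_disjoint {κ : Type*} [DecidableEq κ] (p : ι → ℝ) (s : Finset κ)
    (f : κ → (ι → Bool) → ℝ) (A : κ → Set ι) (hf : ∀ k ∈ s, DependsOn (f k) (A k))
    (hA : ∀ k ∈ s, ∀ l ∈ s, k ≠ l → Disjoint (A k) (A l)) :
    Ex p (fun ω => ∏ k ∈ s, f k ω) = ∏ k ∈ s, Ex p (f k) := by
  induction s using Finset.induction_on with
  | empty => simp [Ex_one]
  | insert a s ha ih =>
    rw [Finset.prod_insert ha, ← ih (fun k hk => hf k (mem_insert_of_mem hk))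
      (fun k hk l hl => hA k (mem_insert_of_mem hk) l (mem_insert_of_mem hl))]
    simp only [Finset.prod_insert ha]
    refine Ex_mul_of_disjoint p (A := A a) (B := ⋃ k ∈ s, A k) (hf a (mem_insert_self _ _)) ?_ ?_
    · refine dependsOn_prod fun k hk => dependsOn_mono (hf k (mem_insert_of_mem hk)) ?_
      exact Set.subset_biUnion_of_mem (u := A) hk
    · simp only [Set.disjoint_iUnion_right]
      intro k hk
      refine hA a (mem_insert_self _ _) k (mem_insert_of_mem hk) ?_
      rintro rfl; exact ha hk

/-- The coordinate indicator. -/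
def sel (i : ι) (ω : ι → Bool) : ℝ := if ω i = true then 1 else 0

theorem dependsOn_sel (i : ι) : DependsOn (sel i) {i} := by
  intro x y h
  simp [sel, h i rfl]

theorem Ex_sel (p : ι → ℝ) (i : ι) : Ex p (sel i) = p i := by
  have h := Finset.prod_univ_sum (fun _ : ι => (Finset.univ : Finset Bool))
    (fun j b => (if b = true then p j else 1 - p j) * (if j = i then (if b = true then 1 else 0) else 1))
  rw [Fintype.piFinset_univ] at h
  have : Ex p (sel i) = ∏ j, (if j = i then p i else 1) := by
    unfold Ex
    trans ∑ ω : ι → Bool, ∏ j, ((if ω j = true then p j else 1 - p j) *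
      (if j = i then (if ω j = true then 1 else 0) else 1))
    · refine Finset.sum_congr rfl fun ω _ => ?_
      rw [Finset.prod_mul_distrib]
      simp [wt, sel]
    · rw [← h]
      refine Finset.prod_congr rfl fun j _ => ?_
      by_cases hj : j = i
      · subst hj; simp
      · simp [hj]
  rw [this]; simp

theorem Ex_prod_sel (p : ι → ℝ) (s : Finset ι) :
    Ex p (fun ω => ∏ i ∈ s, sel i ω) = ∏ i ∈ s, p i := by
  rw [Ex_prod_of_disjoint p s (fun i => sel i) (fun i => {i}) (fun i _ => dependsOn_sel i)]
  · exact Finset.prod_congr rfl fun i _ => Ex_sel p i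
  · intro k _ l _ h; simpa using h

/-- Chebyshev's inequality for a sum of independent bounded nonnegative variables. -/
theorem chebyshev {κ : Type*} [DecidableEq κ] {p : ι → ℝ} (h0 : ∀ i, 0 ≤ p i) (h1 : ∀ i, p i ≤ 1)
    (s : Finset κ) (Z : κ → (ι → Bool) → ℝ) (A : κ → Set ι)
    (hZ : ∀ k ∈ s, DependsOn (Z k) (A k))
    (hA : ∀ k ∈ s, ∀ l ∈ s, k ≠ l → Disjoint (A k) (A l))
    (C : ℝ) (hC : ∀ k ∈ s, ∀ ω, 0 ≤ Z k ω ∧ Z k ω ≤ C) (μ l : ℝ)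
    (hμ : ∑ k ∈ s, Ex p (Z k) ≤ μ) (hl : 0 < l) (hC0 : 0 ≤ C) :
    Ex p (fun ω => if μ + l < ∑ k ∈ s, Z k ω then 1 else 0) ≤ C * μ / l ^ 2 := by
  set m := ∑ k ∈ s, Ex p (Z k) with hm
  have hsq : Ex p (fun ω => (∑ k ∈ s, Z k ω) ^ 2) ≤ m ^ 2 + C * m := by
    have e1 : Ex p (fun ω => (∑ k ∈ s, Z k ω) ^ 2) =
        ∑ k ∈ s, ∑ l ∈ s, Ex p (fun ω => Z k ω * Z l ω) := by
      simp only [sq, Finset.sum_mul_sum]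
      rw [Ex_sum]
      exact Finset.sum_congr rfl fun k _ => Ex_sum _ _ _
    have e2 : ∀ k ∈ s, ∀ l ∈ s, Ex p (fun ω => Z k ω * Z l ω) ≤
        Ex p (Z k) * Ex p (Z l) + (if k = l then C * Ex p (Z k) else 0) := by
      intro k hk l hl
      by_cases hkl : k = l
      · subst hkl
        rw [if_pos rfl]
        have a1 : Ex p (fun ω => Z k ω * Z k ω) ≤ Ex p (fun ω => C * Z k ω) :=
          Ex_mono h0 h1 fun ω => mul_le_mul_of_nonneg_right (hC k hk ω).2 (hC k hk ω).1
        rw [Ex_const_mul] at a1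
        nlinarith [mul_self_nonneg (Ex p (Z k))]
      · rw [if_neg hkl, add_zero]
        exact (Ex_mul_of_disjoint p (hZ k hk) (hZ l hl) (hA k hk l hl hkl)).le
    rw [e1]
    calc _ ≤ ∑ k ∈ s, ∑ l ∈ s, (Ex p (Z k) * Ex p (Z l) + (if k = l then C * Ex p (Z k) else 0)) :=
          Finset.sum_le_sum fun k hk => Finset.sum_le_sum fun l hl => e2 k hk l hl
      _ = m ^ 2 + C * m := by
          simp only [Finset.sum_add_distrib]
          rw [sq, hm, Finset.sum_mul_sum, Finset.mul_sum]
          congr 1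
          refine Finset.sum_congr rfl fun k hk => ?_
          simp [hk]
  have hb : ∀ ω, (if μ + l < ∑ k ∈ s, Z k ω then (1 : ℝ) else 0) ≤
      (1 / l ^ 2) * ((∑ k ∈ s, Z k ω) ^ 2 - (2 * m) * (∑ k ∈ s, Z k ω) + m ^ 2) := by
    intro ω
    split_ifs with h
    · rw [div_mul_eq_mul_div, one_mul, le_div_iff₀ (by positivity)]
      nlinarith
    · have : 0 ≤ (∑ k ∈ s, Z k ω - m) ^ 2 := sq_nonneg _
      have h2 : (∑ k ∈ s, Z k ω) ^ 2 - (2 * m) * (∑ k ∈ s, Z k ω) + m ^ 2 =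
        (∑ k ∈ s, Z k ω - m) ^ 2 := by ring
      rw [h2]; positivity
  refine (Ex_mono h0 h1 hb).trans ?_
  rw [Ex_const_mul, Ex_add, Ex_sub, Ex_const_mul, Ex_const, Ex_sum, ← hm]
  rw [div_mul_eq_mul_div, one_mul]
  refine div_le_div_of_nonneg_right ?_ (by positivity)
  nlinarith [mul_le_mul_of_nonneg_left hμ hC0]

end Expectation

section Nibble

variable {α : Type*} [Fintype α] [DecidableEq α]

/-- No cycles of length 2, 3, 4. -/
structure Unc (E : Finset (Finset α)) : Prop where
  lin : ∀ e ∈ E, ∀ f ∈ E, e ≠ f → ∀ x y, x ∈ e → x ∈ f → y ∈ e → y ∈ f → x = y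
  tri : ∀ e ∈ E, ∀ f ∈ E, ∀ g ∈ E, e ≠ f → f ≠ g → g ≠ e → ∀ x y z, x ≠ y → y ≠ z → z ≠ x →
    x ∈ e → x ∈ f → y ∈ f → y ∈ g → z ∈ g → z ∈ e → False
  quad : ∀ e ∈ E, ∀ f ∈ E, ∀ g ∈ E, ∀ h ∈ E, e ≠ f → e ≠ g → e ≠ h → f ≠ g → f ≠ h → g ≠ h →
    ∀ x y z w, x ≠ y → x ≠ z → x ≠ w → y ≠ z → y ≠ w → z ≠ w →
    x ∈ e → x ∈ f → y ∈ f → y ∈ g → z ∈ g → z ∈ h → w ∈ h → w ∈ e → False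

theorem Unc.mono {E F : Finset (Finset α)} (h : Unc E) (hF : F ⊆ E) : Unc F where
  lin e he f hf := h.lin e (hF he) f (hF hf)
  tri e he f hf g hg := h.tri e (hF he) f (hF hf) g (hF hg)
  quad e he f hf g hg k hk := h.quad e (hF he) f (hF hf) g (hF hg) k (hF hk)

/-- The other active vertices of an edge. -/
def tr (V e : Finset α) (v : α) : Finset α := (e ∩ V).erase v

/-- The degree counting edges with `j` other active vertices. -/
def dg (V : Finset α) (E : Finset (Finset α)) (v : α) (j : ℕ) : ℕ :=
  (E.filter fun e => v ∈ e ∧ (tr V e v).card = j).card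

/-- Independence for the traces. -/
def Indep (V : Finset α) (E : Finset (Finset α)) (I : Finset α) : Prop :=
  I ⊆ V ∧ ∀ e ∈ E, (e ∩ V).Nonempty → ¬ (e ∩ V ⊆ I)

/-- State of the nibble. -/
structure NState (k : ℕ) (a t : ℝ) (V : Finset α) (E : Finset (Finset α)) : Prop where
  unc : Unc E
  size : ∀ e ∈ E, ∀ v ∈ e, v ∈ V → 1 ≤ (tr V e v).card ∧ (tr V e v).card ≤ k
  deg : ∀ v ∈ V, ∀ j, 1 ≤ j → j ≤ k → (dg V E v j : ℝ) ≤ k.choose j * a ^ (k - j) * t ^ j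

/-- Edges of `E` through `v`. -/
def inc (E : Finset (Finset α)) (v : α) : Finset (Finset α) := E.filter fun e => v ∈ e

theorem mem_inc {E : Finset (Finset α)} {v : α} {e : Finset α} : e ∈ inc E v ↔ e ∈ E ∧ v ∈ e := by
  simp [inc]

theorem mem_tr {V e : Finset α} {v w : α} : w ∈ tr V e v ↔ w ≠ v ∧ w ∈ e ∧ w ∈ V := by
  simp [tr]

theorem sum_inc_le {k : ℕ} {a t : ℝ} {V : Finset α} {E : Finset (Finset α)}
    (hs : NState k a t V E) {v : α} (hv : v ∈ V) (h : ℕ → ℝ) (hh : ∀ j, 0 ≤ h j) :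
    ∑ e ∈ inc E v, h (tr V e v).card ≤
      ∑ j ∈ Icc 1 k, k.choose j * a ^ (k - j) * t ^ j * h j := by
  have hm : ∀ e ∈ inc E v, (tr V e v).card ∈ Icc 1 k := by
    intro e he
    rw [mem_inc] at he
    exact Finset.mem_Icc.mpr (hs.size e he.1 v he.2 hv)
  rw [← Finset.sum_fiberwise_of_maps_to hm]
  refine Finset.sum_le_sum fun j hj => ?_
  rw [Finset.mem_Icc] at hj
  have h1 : ∑ e ∈ inc E v with (tr V e v).card = j, h (tr V e v).card = dg V E v j * h j := by
    rw [Finset.sum_congr rfl (g := fun _ => h j) (fun e he => by rw [(Finset.mem_filter.mp he).2])]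
    rw [Finset.sum_const, nsmul_eq_mul]
    congr 2
    simp only [inc, dg, Finset.filter_filter]
  rw [h1]
  exact mul_le_mul_of_nonneg_right (hs.deg v hv j hj.1 hj.2) (hh j)

/-- Bernoulli parameters: selection with probability `p`, coin `c`. -/
def prb (p : ℝ) (c : α → ℝ) : α ⊕ α → ℝ := Sum.elim (fun _ => p) c

/-- Indicator that `u` is not hit by an edge from `F`. -/
def nh (V : Finset α) (F : Finset (Finset α)) (u : α) (ω : α ⊕ α → Bool) : ℝ :=
  ∏ f ∈ F, (1 - ∏ w ∈ tr V f u, sel (Sum.inl w) ω)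

theorem dependsOn_prodsel (s : Finset α) :
    DependsOn (fun ω : α ⊕ α → Bool => ∏ w ∈ s, sel (Sum.inl w) ω)
      {i | ∃ w ∈ s, i = Sum.inl w} := by
  refine dependsOn_prod fun w hw => dependsOn_mono (dependsOn_sel _) ?_
  intro i hi
  exact ⟨w, hw, hi⟩

theorem dependsOn_one_sub {ι : Type*} {f : (ι → Bool) → ℝ} {A : Set ι} (h : DependsOn f A) :
    DependsOn (fun ω => 1 - f ω) A := by
  intro x y hxy
  simp only [h hxy]

theorem dependsOn_nh (V : Finset α) (F : Finset (Finset α)) (u : α) :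
    DependsOn (nh V F u) {i | ∃ f ∈ F, ∃ w ∈ tr V f u, i = Sum.inl w} := by
  unfold nh
  refine dependsOn_prod fun f hf => dependsOn_one_sub (dependsOn_mono (dependsOn_prodsel _) ?_)
  rintro i ⟨w, hw, rfl⟩
  exact ⟨f, hf, w, hw, rfl⟩

theorem Ex_nh (p : ℝ) (c : α → ℝ) (V : Finset α) {E F : Finset (Finset α)} (hE : Unc E) (u : α)
    (hF : F ⊆ inc E u) :
    Ex (prb p c) (nh V F u) = ∏ f ∈ F, (1 - p ^ (tr V f u).card) := by
  unfold nh
  rw [Ex_prod_of_disjoint (prb p c) F (fun f ω => 1 - ∏ w ∈ tr V f u, sel (Sum.inl w) ω)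
    (fun f => {i | ∃ w ∈ tr V f u, i = Sum.inl w})
    (fun f _ => dependsOn_one_sub (dependsOn_prodsel _))]
  · refine Finset.prod_congr rfl fun f _ => ?_
    rw [Ex_sub, Ex_const]
    congr 1
    have := Ex_prod_sel (prb p c) ((tr V f u).map ⟨Sum.inl, Sum.inl_injective⟩)
    simpa [prb] using this
  · intro f hf g hg hfg
    rw [Set.disjoint_left]
    rintro i ⟨w, hw, rfl⟩ ⟨w', hw', h⟩
    obtain rfl := Sum.inl_injective h
    have hf' := mem_inc.mp (hF hf)
    have hg' := mem_inc.mp (hF hg)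
    rw [mem_tr] at hw hw'
    exact hw.1 (hE.lin f hf'.1 g hg'.1 hfg _ _ hw.2.1 hw'.2.1 hf'.2 hg'.2)

theorem sel_nonneg {ι : Type*} (i : ι) (ω : ι → Bool) : 0 ≤ sel i ω := by
  unfold sel; split_ifs <;> norm_num

theorem sel_le_one {ι : Type*} (i : ι) (ω : ι → Bool) : sel i ω ≤ 1 := by
  unfold sel; split_ifs <;> norm_num

theorem nh_factor (s : Finset α) (ω : α ⊕ α → Bool) :
    0 ≤ 1 - ∏ w ∈ s, sel (Sum.inl w) ω ∧ 1 - ∏ w ∈ s, sel (Sum.inl w) ω ≤ 1 := by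
  have h1 : ∏ w ∈ s, sel (Sum.inl w) ω ≤ 1 :=
    Finset.prod_le_one (fun w _ => sel_nonneg _ ω) (fun w _ => sel_le_one _ ω)
  have h2 : 0 ≤ ∏ w ∈ s, sel (Sum.inl w) ω := Finset.prod_nonneg (fun w _ => sel_nonneg _ ω)
  constructor <;> linarith

theorem nh_nonneg (V : Finset α) (F : Finset (Finset α)) (u : α) (ω : α ⊕ α → Bool) :
    0 ≤ nh V F u ω := Finset.prod_nonneg fun f _ => (nh_factor _ ω).1

theorem nh_le_one (V : Finset α) (F : Finset (Finset α)) (u : α) (ω : α ⊕ α → Bool) :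
    nh V F u ω ≤ 1 := Finset.prod_le_one (fun f _ => (nh_factor _ ω).1) fun f _ => (nh_factor _ ω).2

/-- Relaxed survival indicator of `u` with respect to the edges other than `e`. -/
def gs (V : Finset α) (E : Finset (Finset α)) (e : Finset α) (u : α) (ω : α ⊕ α → Bool) : ℝ :=
  sel (Sum.inr u) ω * nh V ((inc E u).erase e) u ω

/-- Support of `gs`. -/
def gsup (E : Finset (Finset α)) (e : Finset α) (u : α) : Set (α ⊕ α) :=
  {i | Sum.elim id id i = u ∨ ∃ f ∈ E, f ≠ e ∧ u ∈ f ∧ Sum.elim id id i ∈ f}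

theorem dependsOn_gs (V : Finset α) (E : Finset (Finset α)) (e : Finset α) (u : α) :
    DependsOn (gs V E e u) (gsup E e u) := by
  unfold gs
  refine dependsOn_mul (dependsOn_mono (dependsOn_sel _) ?_) (dependsOn_mono (dependsOn_nh _ _ _) ?_)
  · rintro i rfl
    left; rfl
  · rintro i ⟨f, hf, w, hw, rfl⟩
    rw [Finset.mem_erase, mem_inc] at hf
    rw [mem_tr] at hw
    exact Or.inr ⟨f, hf.2.1, hf.1, hf.2.2, hw.2.1⟩

theorem Ex_gs (p : ℝ) (c : α → ℝ) (V : Finset α) {E : Finset (Finset α)} (hE : Unc E)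
    (e : Finset α) (u : α) :
    Ex (prb p c) (gs V E e u) = c u * ∏ f ∈ (inc E u).erase e, (1 - p ^ (tr V f u).card) := by
  unfold gs
  rw [Ex_mul_of_disjoint (prb p c) (dependsOn_sel (Sum.inr u)) (dependsOn_nh V _ u), Ex_sel,
    Ex_nh p c V hE u (Finset.erase_subset _ _)]
  · rfl
  · rw [Set.disjoint_left]
    rintro i rfl ⟨f, _, w, _, h⟩
    cases h

/-- Term of the degree variable. -/
def zt (V : Finset α) (E : Finset (Finset α)) (v : α) (e A : Finset α) (ω : α ⊕ α → Bool) : ℝ :=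
  ∏ w ∈ tr V e v, (if w ∈ A then gs V E e w ω else sel (Sum.inl w) ω)

/-- Contribution of the edge `e` to the new degree of `v`. -/
def ze (V : Finset α) (E : Finset (Finset α)) (v : α) (i : ℕ) (e : Finset α)
    (ω : α ⊕ α → Bool) : ℝ :=
  ∑ A ∈ (tr V e v).powersetCard i, zt V E v e A ω

theorem gs_nonneg (V : Finset α) (E : Finset (Finset α)) (e : Finset α) (u : α)
    (ω : α ⊕ α → Bool) : 0 ≤ gs V E e u ω := mul_nonneg (sel_nonneg _ _) (nh_nonneg _ _ _ _)

theorem gs_le_one (V : Finset α) (E : Finset (Finset α)) (e : Finset α) (u : α)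
    (ω : α ⊕ α → Bool) : gs V E e u ω ≤ 1 :=
  mul_le_one₀ (sel_le_one _ _) (nh_nonneg _ _ _ _) (nh_le_one _ _ _ _)

theorem zt_nonneg (V : Finset α) (E : Finset (Finset α)) (v : α) (e A : Finset α)
    (ω : α ⊕ α → Bool) : 0 ≤ zt V E v e A ω := by
  refine Finset.prod_nonneg fun w _ => ?_
  split_ifs
  · exact gs_nonneg _ _ _ _ _
  · exact sel_nonneg _ _

theorem zt_le_one (V : Finset α) (E : Finset (Finset α)) (v : α) (e A : Finset α)
    (ω : α ⊕ α → Bool) : zt V E v e A ω ≤ 1 := by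
  refine Finset.prod_le_one (fun w _ => ?_) fun w _ => ?_
  · split_ifs
    · exact gs_nonneg _ _ _ _ _
    · exact sel_nonneg _ _
  · split_ifs
    · exact gs_le_one _ _ _ _ _
    · exact sel_le_one _ _

theorem ze_bounds {k : ℕ} (V : Finset α) (E : Finset (Finset α)) (v : α) (i : ℕ) (e : Finset α)
    (h : (tr V e v).card ≤ k) (ω : α ⊕ α → Bool) :
    0 ≤ ze V E v i e ω ∧ ze V E v i e ω ≤ 2 ^ k := by
  constructor
  · exact Finset.sum_nonneg fun A _ => zt_nonneg _ _ _ _ _ _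
  · calc ze V E v i e ω ≤ ∑ A ∈ (tr V e v).powersetCard i, (1 : ℝ) :=
        Finset.sum_le_sum fun A _ => zt_le_one _ _ _ _ _ _
      _ = ((tr V e v).card.choose i : ℝ) := by simp
      _ ≤ ((2 ^ (tr V e v).card : ℕ) : ℝ) := by exact_mod_cast Nat.choose_le_two_pow _ _
      _ ≤ 2 ^ k := by push_cast; exact pow_le_pow_right₀ (by norm_num) h

theorem sel_inl_dep (E : Finset (Finset α)) (e : Finset α) (w : α) :
    DependsOn (sel (Sum.inl w : α ⊕ α)) (gsup E e w) := by
  refine dependsOn_mono (dependsOn_sel _) ?_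
  rintro i rfl
  left; rfl

theorem dependsOn_zfac (V : Finset α) (E : Finset (Finset α)) (e A : Finset α) (w : α) :
    DependsOn (fun ω : α ⊕ α → Bool => if w ∈ A then gs V E e w ω else sel (Sum.inl w) ω)
      (gsup E e w) := by
  by_cases h : w ∈ A
  · simp only [h, if_true]; exact dependsOn_gs V E e w
  · simp only [h, if_false]; exact sel_inl_dep E e w

theorem gsup_disjoint {E : Finset (Finset α)} (hE : Unc E) {e : Finset α} (he : e ∈ E) {x y : α}
    (hx : x ∈ e) (hy : y ∈ e) (hxy : x ≠ y) : Disjoint (gsup E e x) (gsup E e y) := by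
  rw [Set.disjoint_left]
  intro i h1 h2
  simp only [gsup, Set.mem_setOf_eq] at h1 h2
  generalize Sum.elim id id i = z at h1 h2
  rcases h1 with rfl | ⟨f, hf, hfe, hxf, hzf⟩
  · rcases h2 with h2 | ⟨g, hg, hge, hyg, hzg⟩
    · exact hxy h2
    · exact hxy (hE.lin e he g hg (Ne.symm hge) _ _ hx hzg hy hyg)
  · rcases h2 with rfl | ⟨g, hg, hge, hyg, hzg⟩
    · exact hxy (hE.lin e he f hf (Ne.symm hfe) _ _ hx hxf hy hzf)
    · have hxg : x ∉ g := fun h => hxy (hE.lin e he g hg (Ne.symm hge) _ _ hx h hy hyg)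
      have hyf : y ∉ f := fun h => hxy (hE.lin e he f hf (Ne.symm hfe) _ _ hx hxf hy h)
      refine hE.tri e he f hf g hg (Ne.symm hfe) ?_ hge x z y ?_ ?_ (Ne.symm hxy) hx hxf hzf hzg hyg hy
      · rintro rfl; exact hxg hxf
      · rintro rfl; exact hxg hzg
      · rintro rfl; exact hyf hzf

theorem Ex_zt (p : ℝ) (c : α → ℝ) (V : Finset α) {E : Finset (Finset α)} (hE : Unc E)
    {e : Finset α} (he : e ∈ E) (v : α) (A : Finset α) :
    Ex (prb p c) (zt V E v e A) =
      ∏ w ∈ tr V e v, (if w ∈ A then Ex (prb p c) (gs V E e w) else p) := by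
  unfold zt
  rw [Ex_prod_of_disjoint (prb p c) (tr V e v)
    (fun w ω => if w ∈ A then gs V E e w ω else sel (Sum.inl w) ω) (fun w => gsup E e w)
    (fun w _ => dependsOn_zfac V E e A w)]
  · refine Finset.prod_congr rfl fun w _ => ?_
    split_ifs
    · rfl
    · exact Ex_sel _ _
  · intro x hx y hy hxy
    rw [mem_tr] at hx hy
    exact gsup_disjoint hE he hx.2.1 hy.2.1 hxy

/-- Support of `ze`. -/
def zsup (E : Finset (Finset α)) (v : α) (e : Finset α) : Set (α ⊕ α) :=
  {i | ∃ w ∈ e, w ≠ v ∧ i ∈ gsup E e w}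

theorem dependsOn_ze (V : Finset α) (E : Finset (Finset α)) (v : α) (i : ℕ) (e : Finset α) :
    DependsOn (ze V E v i e) (zsup E v e) := by
  unfold ze zt
  refine dependsOn_sum fun A _ => dependsOn_prod fun w hw => dependsOn_mono (dependsOn_zfac _ _ _ _ _) ?_
  rw [mem_tr] at hw
  intro j hj
  exact ⟨w, hw.2.1, hw.1, hj⟩

theorem zsup_disjoint {E : Finset (Finset α)} (hE : Unc E) {v : α} {e e' : Finset α} (he : e ∈ E)
    (he' : e' ∈ E) (hve : v ∈ e) (hve' : v ∈ e') (hne : e ≠ e') :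
    Disjoint (zsup E v e) (zsup E v e') := by
  rw [Set.disjoint_left]
  rintro i ⟨x, hx, hxv, h1⟩ ⟨y, hy, hyv, h2⟩
  simp only [gsup, Set.mem_setOf_eq] at h1 h2
  generalize Sum.elim id id i = z at h1 h2
  have hxe' : x ∉ e' := fun h => hxv (hE.lin e he e' he' hne _ _ hx h hve hve')
  have hye : y ∉ e := fun h => hyv (hE.lin e he e' he' hne _ _ h hy hve hve')
  have hxy : x ≠ y := by rintro rfl; exact hxe' hy
  have T : ∀ f ∈ E, f ≠ e → x ∈ f → v ∉ f ∧ f ≠ e' ∧ y ∉ f := by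
    intro f hf hfe hxf
    have hvf : v ∉ f := fun h => hxv (hE.lin e he f hf (Ne.symm hfe) _ _ hx hxf hve h)
    have hfe' : f ≠ e' := by rintro rfl; exact hxe' hxf
    refine ⟨hvf, hfe', fun hyf => ?_⟩
    exact hE.tri e he f hf e' he' (Ne.symm hfe) hfe' (Ne.symm hne) x y v hxy hyv (Ne.symm hxv)
      hx hxf hyf hy hve' hve
  have T' : ∀ f ∈ E, f ≠ e' → y ∈ f → v ∉ f ∧ f ≠ e ∧ x ∉ f := by
    intro f hf hfe hxf
    have hvf : v ∉ f := fun h => hyv (hE.lin e' he' f hf (Ne.symm hfe) _ _ hy hxf hve' h)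
    have hfe' : f ≠ e := by rintro rfl; exact hye hxf
    refine ⟨hvf, hfe', fun hyf => ?_⟩
    exact hE.tri e' he' f hf e he (Ne.symm hfe) hfe' hne y x v (Ne.symm hxy) hxv (Ne.symm hyv)
      hy hxf hyf hx hve hve'
  rcases h1 with rfl | ⟨f, hf, hfe, hxf, hzf⟩
  · rcases h2 with h2 | ⟨g, hg, hge, hyg, hzg⟩
    · exact hxy h2
    · exact (T' g hg hge hyg).2.2 hzg
  · obtain ⟨a1, a2, a3⟩ := T f hf hfe hxf
    rcases h2 with rfl | ⟨g, hg, hge, hyg, hzg⟩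
    · exact a3 hzf
    · obtain ⟨b1, b2, b3⟩ := T' g hg hge hyg
      refine hE.quad e he f hf g hg e' he' (Ne.symm hfe) (Ne.symm b2) hne ?_ a2 hge
        x z y v ?_ hxy hxv ?_ ?_ hyv hx hxf hzf hzg hyg hy hve' hve
      · rintro rfl; exact b3 hxf
      · rintro rfl; exact b3 hzg
      · rintro rfl; exact a3 hzf
      · rintro rfl; exact a1 hzf

end Nibble
section Step

variable {α : Type*} [Fintype α] [DecidableEq α]

theorem binom_id (k i : ℕ) (hi : 1 ≤ i) (hik : i ≤ k) (a t p x : ℝ) :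
    ∑ j ∈ Icc 1 k, (k.choose j : ℝ) * a ^ (k - j) * t ^ j * ((j.choose i : ℝ) * x ^ i * p ^ (j - i))
      = k.choose i * (a + t * p) ^ (k - i) * (t * x) ^ i := by
  have h1 : (range (k - i + 1)).image (· + i) ⊆ Icc 1 k := by
    intro j hj
    simp only [Finset.mem_image, Finset.mem_range] at hj
    obtain ⟨m, hm, rfl⟩ := hj
    rw [Finset.mem_Icc]; omega
  rw [← Finset.sum_subset h1]
  · rw [Finset.sum_image (fun x _ y _ h => by simpa using h), add_comm a, add_pow,
      Finset.mul_sum, Finset.sum_mul]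
    refine Finset.sum_congr rfl fun m hm => ?_
    rw [Finset.mem_range] at hm
    have h2 : (k.choose (m + i) : ℝ) * ((m + i).choose i) = k.choose i * (k - i).choose m := by
      have := Nat.choose_mul (n := k) (k := m + i) (s := i) (by omega)
      rw [Nat.add_sub_cancel] at this
      exact_mod_cast this
    have h3 : k - (m + i) = k - i - m := by omega
    rw [h3, Nat.add_sub_cancel, mul_pow, mul_pow, pow_add]
    linear_combination (a ^ (k - i - m) * (t ^ m * t ^ i) * (x ^ i * p ^ m)) * h2
  · intro j hj hj'
    rw [Finset.mem_Icc] at hj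
    have : j < i := by
      by_contra hlt
      apply hj'
      simp only [Finset.mem_image, Finset.mem_range]
      exact ⟨j - i, by omega, by omega⟩
    rw [Nat.choose_eq_zero_of_lt this]; simp

theorem binom_sum (k : ℕ) (a t p : ℝ) :
    ∑ j ∈ Icc 1 k, (k.choose j : ℝ) * a ^ (k - j) * t ^ j * p ^ j = (a + t * p) ^ k - a ^ k := by
  rw [add_comm a, add_pow, Finset.sum_range_succ']
  simp only [pow_zero, Nat.sub_zero, Nat.choose_zero_right, one_mul, Nat.cast_one, mul_one,
    add_sub_cancel_right]
  rw [Finset.range_eq_Ico, Finset.sum_Ico_add' (fun m => (t * p) ^ m * a ^ (k - m) * (k.choose m : ℝ)) 0 k 1]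
  have : Finset.Ico (0 + 1) (k + 1) = Icc 1 k := by ext; simp
  rw [this]
  refine Finset.sum_congr rfl fun j _ => ?_
  rw [mul_pow]; ring

/-- Target survival probability. -/
noncomputable def q0 (p : ℝ) : ℝ := Real.exp (-1 / (1 - p))

theorem q0_pos (p : ℝ) : 0 < q0 p := Real.exp_pos _

theorem one_sub_ge_exp {x p : ℝ} (hx0 : 0 ≤ x) (hx : x ≤ p) (hp : p < 1) :
    Real.exp (-x / (1 - p)) ≤ 1 - x := by
  have h1 : 0 < 1 - p := by linarith
  have h2 : (1 - x)⁻¹ ≤ Real.exp (x / (1 - p)) := by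
    have h3 : x / (1 - x) ≤ x / (1 - p) := div_le_div_of_nonneg_left hx0 h1 (by linarith)
    have h4 := Real.add_one_le_exp (x / (1 - p))
    have h5 : (1 - x)⁻¹ = x / (1 - x) + 1 := by
      have : (1 - x) ≠ 0 := by linarith
      field_simp; ring
    linarith
  rw [neg_div, Real.exp_neg]
  exact inv_le_of_inv_le₀ (by linarith) h2

theorem q0_le {p : ℝ} (hp0 : 0 ≤ p) (hp : p < 1) : q0 p ≤ Real.exp (-1) * (1 - p) := by
  have h := one_sub_ge_exp hp0 le_rfl hp
  have h1 : (1 - p) ≠ 0 := by linarith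
  have : -1 / (1 - p) = -1 + -p / (1 - p) := by field_simp; ring
  unfold q0
  rw [this, Real.exp_add]
  exact mul_le_mul_of_nonneg_left h (Real.exp_pos _).le

theorem q0_ge {p : ℝ} (hp0 : 0 ≤ p) (hp : p ≤ 1 / 2) : Real.exp (-1) * (1 - 2 * p) ≤ q0 p := by
  have h1 : (1 - p) ≠ 0 := by linarith
  have : -1 / (1 - p) = -1 + -p / (1 - p) := by field_simp; ring
  unfold q0
  rw [this, Real.exp_add]
  refine mul_le_mul_of_nonneg_left ?_ (Real.exp_pos _).le
  have h2 := Real.add_one_le_exp (-p / (1 - p))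
  have h3 : p / (1 - p) ≤ 2 * p := by
    rw [div_le_iff₀ (by linarith)]; nlinarith
  rw [neg_div] at *
  linarith

section
variable {k : ℕ} {a a' t p : ℝ} {V : Finset α} {E : Finset (Finset α)}

theorem prod_nh_ge (hp0 : 0 < p) (hp : p ≤ 1 / 2) (hap : a' = a + t * p)
    (hak : a' ^ k - a ^ k ≤ 1) (hs : NState k a t V E) {v : α} (hv : v ∈ V) :
    q0 p ≤ ∏ f ∈ inc E v, (1 - p ^ (tr V f v).card) := by
  have hsum : ∑ f ∈ inc E v, p ^ (tr V f v).card ≤ 1 := by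
    refine (sum_inc_le hs hv (fun j => p ^ j) fun j => by positivity).trans ?_
    rw [binom_sum, ← hap]; exact hak
  calc q0 p ≤ Real.exp (∑ f ∈ inc E v, -(p ^ (tr V f v).card) / (1 - p)) := by
        unfold q0
        rw [Real.exp_le_exp, ← Finset.sum_div, Finset.sum_neg_distrib]
        exact div_le_div_of_nonneg_right (by linarith) (by linarith)
    _ = ∏ f ∈ inc E v, Real.exp (-(p ^ (tr V f v).card) / (1 - p)) := Real.exp_sum _ _
    _ ≤ _ := by
        refine Finset.prod_le_prod (fun f _ => (Real.exp_pos _).le) fun f hf => ?_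
        rw [mem_inc] at hf
        refine one_sub_ge_exp (by positivity) ?_ (by linarith)
        exact pow_le_of_le_one hp0.le (by linarith) (by have := (hs.size f hf.1 v hf.2 hv).1; omega)

/-- The equalizing coin. -/
noncomputable def coin (p : ℝ) (V : Finset α) (E : Finset (Finset α)) (u : α) : ℝ :=
  if u ∈ V then q0 p / ∏ f ∈ inc E u, (1 - p ^ (tr V f u).card) else 0

theorem coin_mem (hp0 : 0 < p) (hp : p ≤ 1 / 2) (hap : a' = a + t * p)
    (hak : a' ^ k - a ^ k ≤ 1) (hs : NState k a t V E) (i : α ⊕ α) :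
    0 ≤ prb p (coin p V E) i ∧ prb p (coin p V E) i ≤ 1 := by
  rcases i with u | u
  · simp only [prb, Sum.elim_inl]; constructor <;> linarith
  · simp only [prb, Sum.elim_inr, coin]
    split_ifs with h
    · have h1 := prod_nh_ge hp0 hp hap hak hs h
      have h2 := q0_pos p
      exact ⟨div_nonneg h2.le (h2.le.trans h1), div_le_one_of_le₀ h1 (h2.le.trans h1)⟩
    · norm_num

theorem Ex_gs_le (hp0 : 0 < p) (hp : p ≤ 1 / 2) (hap : a' = a + t * p)
    (hak : a' ^ k - a ^ k ≤ 1) (hs : NState k a t V E) {u : α} (hu : u ∈ V) {e : Finset α}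
    (he : e ∈ inc E u) :
    Ex (prb p (coin p V E)) (gs V E e u) ≤ Real.exp (-1) := by
  rw [Ex_gs p _ V hs.unc e u]
  have h1 := prod_nh_ge hp0 hp hap hak hs hu
  have h2 := q0_pos p
  have h3 := Finset.mul_prod_erase (inc E u) (fun f => 1 - p ^ (tr V f u).card) he
  rw [coin, if_pos hu]
  have hx : p ^ (tr V e u).card ≤ p :=
    pow_le_of_le_one hp0.le (by linarith)
      (by have := (hs.size e (mem_inc.mp he).1 u (mem_inc.mp he).2 hu).1; omega)
  set x := 1 - p ^ (tr V e u).card with hxdef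
  set P := ∏ f ∈ (inc E u).erase e, (1 - p ^ (tr V f u).card) with hP
  rw [← h3]
  rw [← h3] at h1
  have hPpos : 0 < P := by
    have : 0 < x * P := lt_of_lt_of_le h2 h1
    exact (pos_iff_pos_of_mul_pos this).mp (by linarith)
  have hxpos : 0 < x := by linarith
  have : q0 p / (x * P) * P = q0 p / x := by field_simp
  rw [this, div_le_iff₀ hxpos]
  refine (q0_le hp0.le (by linarith)).trans ?_
  exact mul_le_mul_of_nonneg_left (by linarith) (Real.exp_pos _).le

theorem Ex_ze_le (hp0 : 0 < p) (hp : p ≤ 1 / 2) (hap : a' = a + t * p)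
    (hak : a' ^ k - a ^ k ≤ 1) (hs : NState k a t V E) {v : α} {e : Finset α}
    (he : e ∈ inc E v) (i : ℕ) :
    Ex (prb p (coin p V E)) (ze V E v i e) ≤
      ((tr V e v).card.choose i : ℝ) * Real.exp (-1) ^ i * p ^ ((tr V e v).card - i) := by
  have h01 := coin_mem hp0 hp hap hak hs
  unfold ze
  rw [Ex_sum]
  have key : ∀ A ∈ (tr V e v).powersetCard i, Ex (prb p (coin p V E)) (zt V E v e A) ≤
      Real.exp (-1) ^ i * p ^ ((tr V e v).card - i) := by
    intro A hA
    rw [Finset.mem_powersetCard] at hA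
    rw [Ex_zt p _ V hs.unc (mem_inc.mp he).1]
    calc _ ≤ ∏ w ∈ tr V e v, (if w ∈ A then Real.exp (-1) else p) := by
          refine Finset.prod_le_prod (fun w _ => ?_) fun w hw => ?_
          · split_ifs
            · exact Ex_nonneg (fun i => (h01 i).1) (fun i => (h01 i).2) fun ω => gs_nonneg _ _ _ _ _
            · exact hp0.le
          · split_ifs
            · rw [mem_tr] at hw
              exact Ex_gs_le hp0 hp hap hak hs hw.2.2 (mem_inc.mpr ⟨(mem_inc.mp he).1, hw.2.1⟩)
            · exact le_rfl
      _ = _ := by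
          rw [Finset.prod_ite, Finset.prod_const, Finset.prod_const]
          have e1 : (tr V e v).filter (fun w => w ∈ A) = A := by
            ext w; simp only [Finset.mem_filter]
            exact ⟨fun h => h.2, fun h => ⟨hA.1 h, h⟩⟩
          have e2 : (tr V e v).filter (fun w => w ∉ A) = tr V e v \ A := by
            ext w; simp
          rw [e1, e2, Finset.card_sdiff_of_subset hA.1, hA.2]
  refine (Finset.sum_le_sum key).trans ?_
  rw [Finset.sum_const, Finset.card_powersetCard, nsmul_eq_mul, mul_assoc]

theorem sum_Ex_ze_le (hp0 : 0 < p) (hp : p ≤ 1 / 2) (hap : a' = a + t * p)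
    (hak : a' ^ k - a ^ k ≤ 1) (hs : NState k a t V E) {v : α} (hv : v ∈ V) (i : ℕ)
    (hi : 1 ≤ i) (hik : i ≤ k) :
    ∑ e ∈ inc E v, Ex (prb p (coin p V E)) (ze V E v i e) ≤
      k.choose i * a' ^ (k - i) * (t * Real.exp (-1)) ^ i := by
  refine (Finset.sum_le_sum fun e he => Ex_ze_le hp0 hp hap hak hs he i).trans ?_
  refine (sum_inc_le hs hv (fun j => (j.choose i : ℝ) * Real.exp (-1) ^ i * p ^ (j - i))
    fun j => by positivity).trans ?_
  rw [binom_id k i hi hik, hap]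

theorem bad_le (hp0 : 0 < p) (hp : p ≤ 1 / 2) (hap : a' = a + t * p) (ha' : 1 ≤ a')
    (hak : a' ^ k - a ^ k ≤ 1) (hs : NState k a t V E) {v : α} (hv : v ∈ V) (i : ℕ)
    (hi : 1 ≤ i) (hik : i ≤ k) {δ : ℝ} (hδ : 0 < δ) (ht : 1 ≤ t * Real.exp (-1)) :
    Ex (prb p (coin p V E)) (fun ω => if k.choose i * a' ^ (k - i) *
      ((1 + δ) * (t * Real.exp (-1))) ^ i < ∑ e ∈ inc E v, ze V E v i e ω then 1 else 0) ≤
      2 ^ k / (δ ^ 2 * (t * Real.exp (-1))) := by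
  have h01 := coin_mem hp0 hp hap hak hs
  set μ : ℝ := k.choose i * a' ^ (k - i) * (t * Real.exp (-1)) ^ i with hμ
  have hμt : t * Real.exp (-1) ≤ μ := by
    have c1 : (1 : ℝ) ≤ k.choose i := by exact_mod_cast Nat.choose_pos hik
    have c2 : (1 : ℝ) ≤ a' ^ (k - i) := one_le_pow₀ ha'
    have c3 : t * Real.exp (-1) ≤ (t * Real.exp (-1)) ^ i := le_self_pow₀ ht (by omega)
    have c4 : (1 : ℝ) ≤ k.choose i * a' ^ (k - i) := one_le_mul_of_one_le_of_one_le c1 c2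
    calc t * Real.exp (-1) ≤ (t * Real.exp (-1)) ^ i := c3
      _ ≤ μ := le_mul_of_one_le_left (by linarith) c4
  have hμ0 : 0 < μ := by linarith
  have hch := chebyshev (p := prb p (coin p V E)) (fun i => (h01 i).1) (fun i => (h01 i).2)
    (inc E v) (fun e => ze V E v i e) (fun e => zsup E v e) (fun e _ => dependsOn_ze V E v i e)
    (fun e he f hf hne => zsup_disjoint hs.unc (mem_inc.mp he).1 (mem_inc.mp hf).1
      (mem_inc.mp he).2 (mem_inc.mp hf).2 hne) (2 ^ k)
    (fun e he ω => ze_bounds V E v i e (hs.size e (mem_inc.mp he).1 v (mem_inc.mp he).2 hv).2 ω)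
    μ (δ * μ) (sum_Ex_ze_le hp0 hp hap hak hs hv i hi hik) (by positivity) (by positivity)
  have hle : μ + δ * μ ≤ k.choose i * a' ^ (k - i) * ((1 + δ) * (t * Real.exp (-1))) ^ i := by
    rw [mul_pow]
    have : (1 + δ) ≤ (1 + δ) ^ i := le_self_pow₀ (by linarith) (by omega)
    calc μ + δ * μ = (1 + δ) * μ := by ring
      _ ≤ (1 + δ) ^ i * μ := mul_le_mul_of_nonneg_right this hμ0.le
      _ = _ := by rw [hμ]; ring
  calc _ ≤ Ex (prb p (coin p V E)) (fun ω => if μ + δ * μ < ∑ e ∈ inc E v, ze V E v i e ω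
            then 1 else 0) := by
        refine Ex_mono (fun i => (h01 i).1) (fun i => (h01 i).2) fun ω => ?_
        split_ifs with h1 h2
        · exact le_rfl
        · exact absurd (lt_of_le_of_lt hle h1) h2
        · norm_num
        · exact le_rfl
    _ ≤ _ := hch
    _ = 2 ^ k / (δ ^ 2 * μ) := by field_simp
    _ ≤ _ := by
        apply div_le_div_of_nonneg_left (by positivity) (by positivity)
        exact mul_le_mul_of_nonneg_left hμt (by positivity)

end

/-- `u` is hit by the selection. -/
def Hit (V : Finset α) (F : Finset (Finset α)) (u : α) (ω : α ⊕ α → Bool) : Prop :=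
  ∃ f ∈ F, ∀ w ∈ tr V f u, ω (Sum.inl w) = true

open Classical in
theorem nh_eq (V : Finset α) (F : Finset (Finset α)) (u : α) (ω : α ⊕ α → Bool) :
    nh V F u ω = if Hit V F u ω then 0 else 1 := by
  unfold nh
  split_ifs with h
  · obtain ⟨f, hf, hw⟩ := h
    refine Finset.prod_eq_zero hf ?_
    rw [Finset.prod_eq_one, sub_self]
    intro w hw'
    simp [sel, hw w hw']
  · refine Finset.prod_eq_one fun f hf => ?_
    simp only [Hit, not_exists, not_and] at h
    have := h f hf
    push Not at this
    obtain ⟨w, hw, hw2⟩ := this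
    rw [Finset.prod_eq_zero hw, sub_zero]
    simp [sel, hw2]

section Det

variable (k : ℕ) (a' t' : ℝ) (V : Finset α) (E : Finset (Finset α)) (ω : α ⊕ α → Bool)

/-- Bad vertices: new degree too large. -/
def Bad (v : α) : Prop :=
  ∃ i ∈ Icc 1 k, k.choose i * a' ^ (k - i) * t' ^ i < ∑ e ∈ inc E v, ze V E v i e ω

open Classical in
/-- Selected vertices kept. -/
noncomputable def S1 : Finset α := V.filter fun v => ω (Sum.inl v) = true ∧ ¬ Hit V (inc E v) v ω

open Classical in
/-- Surviving vertices. -/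
noncomputable def V1 : Finset α :=
  V.filter fun v => ω (Sum.inl v) = false ∧ ω (Sum.inr v) = true ∧ ¬ Hit V (inc E v) v ω

open Classical in
/-- Surviving good vertices. -/
noncomputable def V2 : Finset α := (V1 V E ω).filter fun v => ¬ Bad k a' t' V E ω v

open Classical in
/-- Surviving edges. -/
noncomputable def E2 : Finset (Finset α) :=
  E.filter fun e => ∀ w ∈ e, w ∈ V → w ∉ V2 k a' t' V E ω → ω (Sum.inl w) = true

variable {k a' t' V E ω}

theorem mem_S1 {v : α} : v ∈ S1 V E ω ↔ v ∈ V ∧ ω (Sum.inl v) = true ∧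
    ¬ Hit V (inc E v) v ω := by
  simp only [S1, Finset.mem_filter]

theorem mem_V2 {v : α} : v ∈ V2 k a' t' V E ω ↔ v ∈ V ∧ ω (Sum.inl v) = false ∧
    ω (Sum.inr v) = true ∧ ¬ Hit V (inc E v) v ω ∧ ¬ Bad k a' t' V E ω v := by
  simp only [V2, V1, Finset.mem_filter]; tauto

theorem mem_E2 {e : Finset α} : e ∈ E2 k a' t' V E ω ↔ e ∈ E ∧
    ∀ w ∈ e, w ∈ V → w ∉ V2 k a' t' V E ω → ω (Sum.inl w) = true := by
  simp only [E2, Finset.mem_filter]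

theorem state_step {a t : ℝ} (hs : NState k a t V E) :
    NState k a' t' (V2 k a' t' V E ω) (E2 k a' t' V E ω) := by
  have hsub : ∀ e v, tr (V2 k a' t' V E ω) e v ⊆ tr V e v := by
    intro e v w hw
    rw [mem_tr] at hw ⊢
    exact ⟨hw.1, hw.2.1, (mem_V2.mp hw.2.2).1⟩
  refine ⟨hs.unc.mono (fun e he => (mem_E2.mp he).1), ?_, ?_⟩
  · intro e he v hve hv
    obtain ⟨he1, he2⟩ := mem_E2.mp he
    have hv' := mem_V2.mp hv
    refine ⟨?_, (Finset.card_le_card (hsub e v)).trans (hs.size e he1 v hve hv'.1).2⟩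
    by_contra hcon
    have hemp : tr (V2 k a' t' V E ω) e v = ∅ := Finset.card_eq_zero.mp (by omega)
    apply hv'.2.2.2.1
    refine ⟨e, mem_inc.mpr ⟨he1, hve⟩, fun w hw => ?_⟩
    rw [mem_tr] at hw
    refine he2 w hw.2.1 hw.2.2 fun hw2 => ?_
    have : w ∈ tr (V2 k a' t' V E ω) e v := mem_tr.mpr ⟨hw.1, hw.2.1, hw2⟩
    rw [hemp] at this
    simp at this
  · intro v hv i hi hik
    have hv' := mem_V2.mp hv
    have hbad : ¬ (k.choose i * a' ^ (k - i) * t' ^ i < ∑ e ∈ inc E v, ze V E v i e ω) := by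
      intro h
      exact hv'.2.2.2.2 ⟨i, Finset.mem_Icc.mpr ⟨hi, hik⟩, h⟩
    refine le_trans ?_ (not_lt.mp hbad)
    have hdg : (dg (V2 k a' t' V E ω) (E2 k a' t' V E ω) v i : ℝ) =
        ∑ e ∈ (E2 k a' t' V E ω).filter (fun e => v ∈ e ∧
          (tr (V2 k a' t' V E ω) e v).card = i), (1 : ℝ) := by
      simp [dg]
    rw [hdg]
    calc _ ≤ ∑ e ∈ (E2 k a' t' V E ω).filter (fun e => v ∈ e ∧
          (tr (V2 k a' t' V E ω) e v).card = i), ze V E v i e ω := by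
          refine Finset.sum_le_sum fun e he => ?_
          rw [Finset.mem_filter] at he
          obtain ⟨he1, he2⟩ := mem_E2.mp he.1
          have hz : zt V E v e (tr (V2 k a' t' V E ω) e v) ω = 1 := by
            refine Finset.prod_eq_one fun w hw => ?_
            have hw' := mem_tr.mp hw
            split_ifs with h
            · have hw2 := mem_V2.mp (mem_tr.mp h).2.2
              unfold gs
              rw [nh_eq, if_neg]
              · simp [sel, hw2.2.2.1]
              · rintro ⟨f, hf, hfw⟩
                exact hw2.2.2.2.1 ⟨f, Finset.mem_of_mem_erase hf, hfw⟩
            · have : ω (Sum.inl w) = true := by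
                refine he2 w hw'.2.1 hw'.2.2 fun hw2 => h ?_
                exact mem_tr.mpr ⟨hw'.1, hw'.2.1, hw2⟩
              simp [sel, this]
          rw [← hz]
          unfold ze
          refine Finset.single_le_sum (f := fun A => zt V E v e A ω)
            (fun A _ => zt_nonneg _ _ _ _ _ _) ?_
          rw [Finset.mem_powersetCard]
          exact ⟨hsub e v, he.2.2⟩
      _ ≤ _ := by
          refine Finset.sum_le_sum_of_subset_of_nonneg ?_ ?_
          · intro e he
            rw [Finset.mem_filter] at he
            exact mem_inc.mpr ⟨(mem_E2.mp he.1).1, he.2.1⟩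
          · intro e he _
            exact Finset.sum_nonneg fun A _ => zt_nonneg _ _ _ _ _ _

theorem indep_step (I : Finset α) (hI : Indep (V2 k a' t' V E ω) (E2 k a' t' V E ω) I) :
    Indep V E (S1 V E ω ∪ I) := by
  refine ⟨?_, ?_⟩
  · intro x hx
    rw [Finset.mem_union] at hx
    rcases hx with hx | hx
    · exact (mem_S1.mp hx).1
    · exact (mem_V2.mp (hI.1 hx)).1
  · intro e he hne hsub
    have hS : ∀ w ∈ e, w ∈ V → w ∉ V2 k a' t' V E ω → w ∈ S1 V E ω := by
      intro w hw hwV hw2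
      have := hsub (Finset.mem_inter.mpr ⟨hw, hwV⟩)
      rw [Finset.mem_union] at this
      rcases this with h | h
      · exact h
      · exact absurd (hI.1 h) hw2
    have heE2 : e ∈ E2 k a' t' V E ω := by
      refine mem_E2.mpr ⟨he, fun w hw hwV hw2 => ?_⟩
      exact (mem_S1.mp (hS w hw hwV hw2)).2.1
    by_cases hemp : (e ∩ V2 k a' t' V E ω).Nonempty
    · refine hI.2 e heE2 hemp fun x hx => ?_
      rw [Finset.mem_inter] at hx
      have hx2 := mem_V2.mp hx.2
      have := hsub (Finset.mem_inter.mpr ⟨hx.1, hx2.1⟩)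
      rw [Finset.mem_union] at this
      rcases this with h | h
      · have h1 := (mem_S1.mp h).2.1
        rw [hx2.2.1] at h1
        exact absurd h1 (by simp)
      · exact h
    · rw [Finset.not_nonempty_iff_eq_empty] at hemp
      have hno : ∀ w ∈ e, w ∉ V2 k a' t' V E ω := by
        intro w hw hw2
        have : w ∈ e ∩ V2 k a' t' V E ω := Finset.mem_inter.mpr ⟨hw, hw2⟩
        rw [hemp] at this
        simp at this
      obtain ⟨u, hu⟩ := hne
      rw [Finset.mem_inter] at hu
      have hu1 := (mem_S1.mp (hS u hu.1 hu.2 (hno u hu.1))).2.2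
      apply hu1
      refine ⟨e, mem_inc.mpr ⟨he, hu.1⟩, fun w hw => ?_⟩
      rw [mem_tr] at hw
      exact (mem_S1.mp (hS w hw.2.1 hw.2.2 (hno w hw.2.1))).2.1

theorem disj_step : Disjoint (S1 V E ω) (V2 k a' t' V E ω) := by
  rw [Finset.disjoint_left]
  intro x h1 h2
  have h3 := (mem_S1.mp h1).2.1
  rw [(mem_V2.mp h2).2.1] at h3
  exact absurd h3 (by simp)

open Classical in
theorem card_V2_ge : ∑ v ∈ V, ((1 - sel (Sum.inl v) ω) * (sel (Sum.inr v) ω * nh V (inc E v) v ω) -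
    ∑ i ∈ Icc 1 k, (if k.choose i * a' ^ (k - i) * t' ^ i < ∑ e ∈ inc E v, ze V E v i e ω
      then (1 : ℝ) else 0)) ≤ (V2 k a' t' V E ω).card := by
  have h1 : ((V2 k a' t' V E ω).card : ℝ) = ∑ v ∈ V, (if v ∈ V2 k a' t' V E ω then (1 : ℝ) else 0) := by
    rw [Finset.sum_ite_mem]
    have : V ∩ V2 k a' t' V E ω = V2 k a' t' V E ω :=
      Finset.inter_eq_right.mpr fun x hx => (mem_V2.mp hx).1
    rw [this]; simp
  rw [h1]
  refine Finset.sum_le_sum fun v hv => ?_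
  have hnn : ∀ i ∈ Icc 1 k, (0 : ℝ) ≤ (if k.choose i * a' ^ (k - i) * t' ^ i <
      ∑ e ∈ inc E v, ze V E v i e ω then (1 : ℝ) else 0) := by
    intro i _; split_ifs <;> norm_num
  have hsum := Finset.sum_nonneg hnn
  rw [nh_eq]
  by_cases hb : Bad k a' t' V E ω v
  · obtain ⟨i, hi, hlt⟩ := hb
    have h2 := Finset.single_le_sum hnn hi
    rw [if_pos hlt] at h2
    have h3 : (1 - sel (Sum.inl v) ω) * (sel (Sum.inr v) ω *
        (if Hit V (inc E v) v ω then (0 : ℝ) else 1)) ≤ 1 := by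
      unfold sel
      split_ifs <;> norm_num
    have h4 : (0 : ℝ) ≤ (if v ∈ V2 k a' t' V E ω then (1 : ℝ) else 0) := by
      split_ifs <;> norm_num
    linarith
  · by_cases hh : v ∈ V2 k a' t' V E ω
    · rw [if_pos hh]
      have h3 : (1 - sel (Sum.inl v) ω) * (sel (Sum.inr v) ω *
          (if Hit V (inc E v) v ω then (0 : ℝ) else 1)) ≤ 1 := by
        unfold sel
        split_ifs <;> norm_num
      linarith
    · rw [if_neg hh]
      have h5 : ¬ (ω (Sum.inl v) = false ∧ ω (Sum.inr v) = true ∧ ¬ Hit V (inc E v) v ω) := by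
        intro h; exact hh (mem_V2.mpr ⟨hv, h.1, h.2.1, h.2.2, hb⟩)
      have h3 : (1 - sel (Sum.inl v) ω) * (sel (Sum.inr v) ω *
          (if Hit V (inc E v) v ω then (0 : ℝ) else 1)) = 0 := by
        unfold sel
        split_ifs with x1 x2 x3 <;> simp_all
      linarith

open Classical in
theorem card_S1_eq : ((S1 V E ω).card : ℝ) = ∑ v ∈ V, sel (Sum.inl v) ω * nh V (inc E v) v ω := by
  unfold S1
  rw [Finset.card_filter]
  push_cast
  refine Finset.sum_congr rfl fun v _ => ?_
  rw [nh_eq]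
  unfold sel
  split_ifs <;> simp_all

end Det

theorem step {k : ℕ} {a a' t p δ : ℝ} {V : Finset α} {E : Finset (Finset α)}
    (hp0 : 0 < p) (hp : p ≤ 1 / 2) (hap : a' = a + t * p) (ha' : 1 ≤ a')
    (hak : a' ^ k - a ^ k ≤ 1) (hs : NState k a t V E) (hδ : 0 < δ)
    (ht : 1 ≤ t * Real.exp (-1)) {G : ℝ} (hG : 0 ≤ G) :
    ∃ (S V' : Finset α) (E' : Finset (Finset α)), Disjoint S V' ∧
      NState k a' ((1 + δ) * (t * Real.exp (-1))) V' E' ∧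
      (∀ I, Indep V' E' I → Indep V E (S ∪ I)) ∧
      V.card * (p * q0 p + G * ((1 - p) * q0 p - k * (2 ^ k / (δ ^ 2 * (t * Real.exp (-1)))))) ≤
        S.card + G * V'.card := by
  classical
  have h01 := coin_mem hp0 hp hap hak hs
  set P := prb p (coin p V E) with hP
  set t' := (1 + δ) * (t * Real.exp (-1)) with ht'
  set b : ℝ := 2 ^ k / (δ ^ 2 * (t * Real.exp (-1))) with hb
  let F1 : α → (α ⊕ α → Bool) → ℝ := fun v ω => sel (Sum.inl v) ω * nh V (inc E v) v ω
  let F2 : α → (α ⊕ α → Bool) → ℝ := fun v ω =>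
    (1 - sel (Sum.inl v) ω) * (sel (Sum.inr v) ω * nh V (inc E v) v ω)
  let F3 : α → ℕ → (α ⊕ α → Bool) → ℝ := fun v i ω =>
    if k.choose i * a' ^ (k - i) * t' ^ i < ∑ e ∈ inc E v, ze V E v i e ω then (1 : ℝ) else 0
  let F : (α ⊕ α → Bool) → ℝ := fun ω =>
    ∑ v ∈ V, F1 v ω + G * ∑ v ∈ V, (F2 v ω - ∑ i ∈ Icc 1 k, F3 v i ω)
  obtain ⟨ω, hω⟩ := exists_ge_Ex (p := P) (fun i => (h01 i).1) (fun i => (h01 i).2) F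
  refine ⟨S1 V E ω, V2 k a' t' V E ω, E2 k a' t' V E ω, disj_step, state_step hs,
    fun I hI => indep_step I hI, ?_⟩
  have hFle : F ω ≤ (S1 V E ω).card + G * (V2 k a' t' V E ω).card := by
    rw [card_S1_eq]
    have := card_V2_ge (k := k) (a' := a') (t' := t') (V := V) (E := E) (ω := ω)
    exact add_le_add le_rfl (mul_le_mul_of_nonneg_left this hG)
  refine le_trans ?_ (hω.trans hFle)
  have hdis : ∀ v, Disjoint ({Sum.inl v} : Set (α ⊕ α))
      {i | ∃ f ∈ inc E v, ∃ w ∈ tr V f v, i = Sum.inl w} := by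
    intro v
    rw [Set.disjoint_left]
    rintro i rfl ⟨f, _, w, hw, h⟩
    exact (mem_tr.mp hw).1 (Sum.inl_injective h).symm
  have hdis2 : ∀ v, Disjoint ({Sum.inr v} : Set (α ⊕ α))
      {i | ∃ f ∈ inc E v, ∃ w ∈ tr V f v, i = Sum.inl w} := by
    intro v
    rw [Set.disjoint_left]
    rintro i rfl ⟨f, _, w, hw, h⟩
    cases h
  have hnh : ∀ v, Ex P (nh V (inc E v) v) = ∏ f ∈ inc E v, (1 - p ^ (tr V f v).card) :=
    fun v => Ex_nh p _ V hs.unc v (Finset.Subset.refl _)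
  have e1 : ∀ v ∈ V, p * q0 p ≤ Ex P (F1 v) := by
    intro v hv
    rw [Ex_mul_of_disjoint P (dependsOn_sel (Sum.inl v)) (dependsOn_nh V _ v) (hdis v), Ex_sel, hnh]
    exact mul_le_mul_of_nonneg_left (prod_nh_ge hp0 hp hap hak hs hv) hp0.le
  have e2 : ∀ v ∈ V, Ex P (F2 v) = (1 - p) * q0 p := by
    intro v hv
    have d1 : DependsOn (fun ω => sel (Sum.inr v) ω * nh V (inc E v) v ω)
        ({Sum.inr v} ∪ {i | ∃ f ∈ inc E v, ∃ w ∈ tr V f v, i = Sum.inl w}) :=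
      dependsOn_mul (dependsOn_mono (dependsOn_sel _) Set.subset_union_left)
        (dependsOn_mono (dependsOn_nh V _ v) Set.subset_union_right)
    rw [Ex_mul_of_disjoint P (dependsOn_one_sub (dependsOn_sel (Sum.inl v))) d1,
      Ex_mul_of_disjoint P (dependsOn_sel (Sum.inr v)) (dependsOn_nh V _ v) (hdis2 v),
      Ex_sub, Ex_const, Ex_sel, Ex_sel, hnh]
    · simp only [hP, prb, Sum.elim_inl, Sum.elim_inr, coin, if_pos hv]
      have h1 := prod_nh_ge hp0 hp hap hak hs hv
      have h2 := q0_pos p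
      rw [div_mul_cancel₀]
      linarith
    · rw [Set.disjoint_union_right]
      exact ⟨by simp, hdis v⟩
  have e3 : ∀ v ∈ V, ∀ i ∈ Icc 1 k, Ex P (F3 v i) ≤ b := by
    intro v hv i hi
    rw [Finset.mem_Icc] at hi
    exact bad_le hp0 hp hap ha' hak hs hv i hi.1 hi.2 hδ ht
  have hEF : Ex P F = ∑ v ∈ V, Ex P (F1 v) +
      G * ∑ v ∈ V, (Ex P (F2 v) - ∑ i ∈ Icc 1 k, Ex P (F3 v i)) := by
    simp only [F]
    rw [Ex_add, Ex_sum, Ex_const_mul, Ex_sum]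
    congr 2
    refine Finset.sum_congr rfl fun v _ => ?_
    rw [Ex_sub, Ex_sum]
  rw [hEF]
  have s1 : (V.card : ℝ) * (p * q0 p) ≤ ∑ v ∈ V, Ex P (F1 v) := by
    have := Finset.card_nsmul_le_sum V (fun v => Ex P (F1 v)) _ e1
    simpa using this
  have s2 : (V.card : ℝ) * ((1 - p) * q0 p - k * b) ≤
      ∑ v ∈ V, (Ex P (F2 v) - ∑ i ∈ Icc 1 k, Ex P (F3 v i)) := by
    have := Finset.card_nsmul_le_sum V (fun v => Ex P (F2 v) - ∑ i ∈ Icc 1 k, Ex P (F3 v i))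
      ((1 - p) * q0 p - k * b) (fun v hv => by
        have h1 : ∑ i ∈ Icc 1 k, Ex P (F3 v i) ≤ k * b := by
          have := Finset.sum_le_card_nsmul (Icc 1 k) (fun i => Ex P (F3 v i)) b (e3 v hv)
          simpa using this
        rw [e2 v hv]
        linarith)
    simpa using this
  nlinarith [mul_le_mul_of_nonneg_left s2 hG]

end Step
section Iterate

/-- Time scale. -/
noncomputable def aa (k : ℕ) (s : ℕ) : ℝ := (s : ℝ) ^ ((1 : ℝ) / k)

theorem aa_pow {k : ℕ} (hk : 1 ≤ k) (s : ℕ) : aa k s ^ k = s := by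
  unfold aa
  rw [one_div]
  exact Real.rpow_inv_natCast_pow (by positivity) (by omega)

theorem aa_nonneg (k s : ℕ) : 0 ≤ aa k s := by unfold aa; positivity

theorem aa_mono (k : ℕ) {s s' : ℕ} (h : s ≤ s') : aa k s ≤ aa k s' := by
  unfold aa
  exact Real.rpow_le_rpow (by positivity) (by exact_mod_cast h) (by positivity)

theorem aa_lt {k : ℕ} (hk : 1 ≤ k) (s : ℕ) : aa k s < aa k (s + 1) := by
  unfold aa
  exact Real.rpow_lt_rpow (by positivity) (by push_cast; linarith) (by positivity)

theorem aa_succ_le {k : ℕ} (hk : 1 ≤ k) (s : ℕ) : aa k (s + 1) - aa k s ≤ 1 := by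
  have h : aa k (s + 1) ^ k ≤ (aa k s + 1) ^ k := by
    rw [aa_pow hk]
    have h1 := aa_pow hk s
    have h2 := pow_add_pow_le (aa_nonneg k s) zero_le_one (n := k) (by omega)
    rw [h1, one_pow] at h2
    push_cast
    exact h2
  have := le_of_pow_le_pow_left₀ (by omega) (by linarith [aa_nonneg k s]) h
  linarith

theorem one_le_aa_succ {k : ℕ} (s : ℕ) : 1 ≤ aa k (s + 1) := by
  unfold aa
  refine Real.one_le_rpow (by push_cast; linarith [Nat.cast_nonneg (α := ℝ) s]) (by positivity)

theorem coef_aux {k : ℕ} {δ t x p Q : ℝ} (hδ : 0 < δ) (hδ1 : δ ≤ 1) (ht0 : 0 < t)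
    (htB : (3 + 9 * (k * 2 ^ k) : ℝ) ≤ δ ^ 3 * t) (hem : 1 / 3 < x) (hp0 : 0 < p)
    (hp1 : p ≤ 1) (hpt : p ≤ 1 / t) (hq1 : x * (1 - 2 * p) ≤ Q) :
    x * (1 - δ) ≤ (1 - p) * Q - k * (2 ^ k / (δ ^ 2 * (t * x))) := by
  have hx0 : 0 < x := by linarith
  have c1 : x * (1 - 3 * (1 / t)) ≤ (1 - p) * Q := by
    have h1 : x * ((1 - p) * (1 - 2 * p)) ≤ (1 - p) * Q := by
      have := mul_le_mul_of_nonneg_left hq1 (show 0 ≤ 1 - p by linarith)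
      linarith
    refine le_trans (mul_le_mul_of_nonneg_left ?_ hx0.le) h1
    have : 0 ≤ p * p := by positivity
    linarith
  have c2 : k * (2 ^ k / (δ ^ 2 * (t * x))) ≤ x * (9 * (k * 2 ^ k) / (δ ^ 2 * t)) := by
    have h2 : k * (2 ^ k / (δ ^ 2 * (t * x))) = (k * 2 ^ k / (δ ^ 2 * t)) * (1 / x) := by
      field_simp
    rw [h2]
    have h3 : 1 / x ≤ 9 * x := by
      rw [div_le_iff₀ hx0]; nlinarith
    calc _ ≤ (k * 2 ^ k / (δ ^ 2 * t)) * (9 * x) :=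
          mul_le_mul_of_nonneg_left h3 (by positivity)
      _ = _ := by ring
  have c3 : 3 * (1 / t) ≤ 3 / (δ ^ 2 * t) := by
    rw [mul_one_div]
    apply div_le_div_of_nonneg_left (by norm_num) (by positivity)
    have : δ ^ 2 ≤ 1 := pow_le_one₀ hδ.le hδ1
    exact mul_le_of_le_one_left ht0.le this
  have c4 : 3 / (δ ^ 2 * t) + 9 * (k * 2 ^ k) / (δ ^ 2 * t) ≤ δ := by
    rw [← add_div, div_le_iff₀ (by positivity)]
    calc _ ≤ _ := htB
      _ = _ := by ring
  have c5 : x * (3 * (1 / t)) + x * (9 * (k * 2 ^ k) / (δ ^ 2 * t)) ≤ x * δ := by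
    rw [← mul_add]
    exact mul_le_mul_of_nonneg_left (by linarith) (by linarith)
  have c6 : x * (1 - 3 * (1 / t)) = x - x * (3 * (1 / t)) := by ring
  have c7 : x * (1 - δ) = x - x * δ := by ring
  linarith

theorem coef_aux2 {R : ℕ} {δ t x D : ℝ} (hδ : 0 < δ) (ht0 : 0 < t) (hx0 : 0 < x) :
    ((1 - δ) / (1 + δ)) ^ R * D / (4 * ((1 + δ) * (t * x))) * (x * (1 - δ)) =
      ((1 - δ) / (1 + δ)) ^ (R + 1) * D / (4 * t) := by
  have : 1 + δ ≠ 0 := by positivity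
  have : x ≠ 0 := hx0.ne'
  have : t ≠ 0 := ht0.ne'
  rw [pow_succ]
  field_simp

set_option maxHeartbeats 1000000 in
theorem iterate {α : Type} [Fintype α] [DecidableEq α] {k : ℕ} (hk : 1 ≤ k) (T : ℕ) {δ : ℝ}
    (hδ : 0 < δ) (hδ1 : δ ≤ 1) : ∀ (R s : ℕ), s + R = T → ∀ (t : ℝ) (V : Finset α)
    (E : Finset (Finset α)), (3 + 9 * (k * 2 ^ k) : ℝ) ≤ δ ^ 3 * (t * Real.exp (-R)) →
    NState k (aa k s) t V E →
    ∃ I, Indep V E I ∧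
      (V.card : ℝ) * (((1 - δ) / (1 + δ)) ^ R * (aa k T - aa k s) / (4 * t)) ≤ I.card := by
  intro R
  induction R with
  | zero =>
    intro s hsT t V E _ _
    refine ⟨∅, ⟨Finset.empty_subset _, ?_⟩, ?_⟩
    · intro e _ hne hsub
      obtain ⟨x, hx⟩ := hne
      exact absurd (hsub hx) (by simp)
    · have : s = T := by omega
      subst this
      simp
  | succ R ih =>
    intro s hsT t V E hB hs
    have hk2 : (2 : ℝ) ≤ k * 2 ^ k := by
      have h1 : (1 : ℝ) ≤ k := by exact_mod_cast hk
      have h2 : (2 : ℝ) ≤ 2 ^ k := le_self_pow₀ (by norm_num) (by omega)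
      nlinarith
    have hδ3 : δ ^ 3 ≤ 1 := pow_le_one₀ hδ.le hδ1
    have ex1 : Real.exp (-((R + 1 : ℕ) : ℝ)) ≤ 1 := Real.exp_le_one_iff.mpr (by
      have := Nat.cast_nonneg (α := ℝ) (R + 1); linarith)
    have ex0 := Real.exp_pos (-((R + 1 : ℕ) : ℝ))
    have hδ30 : 0 < δ ^ 3 := by positivity
    have hte : 0 < t * Real.exp (-((R + 1 : ℕ) : ℝ)) := by
      by_contra hcon
      nlinarith [not_lt.mp hcon]
    have ht0 : 0 < t := (pos_iff_pos_of_mul_pos hte).mpr ex0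
    have htB : (3 + 9 * (k * 2 ^ k) : ℝ) ≤ δ ^ 3 * t :=
      hB.trans (mul_le_mul_of_nonneg_left (by nlinarith) hδ30.le)
    have ht21 : 21 ≤ t := by nlinarith
    have hexpm : Real.exp (-1) * Real.exp 1 = 1 := by rw [← Real.exp_add]; simp
    have he3 : Real.exp 1 < 3 := by have := Real.exp_one_lt_d9; linarith
    have he27 : 2.7 < Real.exp 1 := by have := Real.exp_one_gt_d9; linarith
    have hem : 1 / 3 < Real.exp (-1) := by
      have := Real.exp_pos (-1); nlinarith
    have hem2 : Real.exp (-1) < 1 := by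
      have := Real.exp_pos (-1); nlinarith
    set x := Real.exp (-1) with hx
    set p := (aa k (s + 1) - aa k s) / t with hpdef
    have hd0 : 0 < aa k (s + 1) - aa k s := by linarith [aa_lt hk s]
    have hp0 : 0 < p := div_pos hd0 ht0
    have hpt : p ≤ 1 / t := div_le_div_of_nonneg_right (aa_succ_le hk s) ht0.le
    have h1t : 1 / t ≤ 1 / 21 := one_div_le_one_div_of_le (by norm_num) ht21
    have hap : aa k (s + 1) = aa k s + t * p := by
      rw [hpdef]; field_simp; ring
    have hak : aa k (s + 1) ^ k - aa k s ^ k ≤ 1 := by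
      rw [aa_pow hk, aa_pow hk]; push_cast; linarith
    set t' := (1 + δ) * (t * x) with ht'
    have ht'0 : 0 < t' := by have : 0 < x := by linarith
                             positivity
    set κ := (1 - δ) / (1 + δ) with hκ
    have hκ0 : 0 ≤ κ := div_nonneg (by linarith) (by linarith)
    have hκ1 : κ ≤ 1 := by rw [hκ, div_le_one (by linarith)]; linarith
    set G := κ ^ R * (aa k T - aa k (s + 1)) / (4 * t') with hG
    have hTs : 0 ≤ aa k T - aa k (s + 1) := by linarith [aa_mono k (show s + 1 ≤ T by omega)]
    have hG0 : 0 ≤ G := by positivity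
    obtain ⟨S, V', E', hdis, hs', hind, hcard⟩ := step (δ := δ) hp0 (by linarith) hap
      (one_le_aa_succ s) hak hs hδ (by nlinarith) hG0
    obtain ⟨I, hI, hIc⟩ := ih (s + 1) (by omega) t' V' E' (by
      refine hB.trans (mul_le_mul_of_nonneg_left ?_ hδ30.le)
      have : Real.exp (-((R + 1 : ℕ) : ℝ)) = x * Real.exp (-(R : ℝ)) := by
        rw [hx, ← Real.exp_add]; congr 1; push_cast; ring
      rw [this, ht']
      have h2 : 0 < t * x * Real.exp (-(R : ℝ)) := by
        have := Real.exp_pos (-(R : ℝ)); have : 0 < x := by linarith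
        positivity
      nlinarith) hs'
    refine ⟨S ∪ I, hind I hI, ?_⟩
    have hdis' : Disjoint S I := Finset.disjoint_of_subset_right hI.1 hdis
    rw [Finset.card_union_of_disjoint hdis']
    push_cast
    have hq1 : x * (1 - 2 * p) ≤ q0 p := q0_ge hp0.le (by linarith)
    have hq14 : 1 / 4 ≤ q0 p := by nlinarith
    have hcoef : x * (1 - δ) ≤ (1 - p) * q0 p - k * (2 ^ k / (δ ^ 2 * (t * x))) :=
      coef_aux hδ hδ1 ht0 htB hem hp0 (by linarith) hpt hq1
    have hGc := mul_le_mul_of_nonneg_left hcoef hG0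
    have hGx : G * (x * (1 - δ)) = κ ^ (R + 1) * (aa k T - aa k (s + 1)) / (4 * t) :=
      coef_aux2 hδ ht0 (by linarith)
    have hpq : κ ^ (R + 1) * (aa k (s + 1) - aa k s) / (4 * t) ≤ p * q0 p := by
      have : p * (1 / 4) ≤ p * q0 p := mul_le_mul_of_nonneg_left hq14 hp0.le
      refine le_trans ?_ this
      have hk1 : κ ^ (R + 1) ≤ 1 := pow_le_one₀ hκ0 hκ1
      have : p * (1 / 4) = (aa k (s + 1) - aa k s) / (4 * t) := by rw [hpdef]; field_simp
      rw [this]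
      refine div_le_div_of_nonneg_right ?_ (by positivity)
      nlinarith
    have hsum : κ ^ (R + 1) * (aa k T - aa k s) / (4 * t) ≤
        p * q0 p + G * ((1 - p) * q0 p - k * (2 ^ k / (δ ^ 2 * (t * x)))) := by
      have : κ ^ (R + 1) * (aa k T - aa k s) / (4 * t) =
        κ ^ (R + 1) * (aa k (s + 1) - aa k s) / (4 * t) +
          κ ^ (R + 1) * (aa k T - aa k (s + 1)) / (4 * t) := by ring
      rw [this]
      linarith
    calc _ ≤ _ := mul_le_mul_of_nonneg_left hsum (Nat.cast_nonneg _)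
      _ ≤ _ := hcard
      _ ≤ _ := by
        rw [mul_comm G]
        linarith

/-- Independent sets in hypergraphs without short cycles. -/
theorem akpss {k : ℕ} (hk : 1 ≤ k) : ∃ c : ℝ, 0 < c ∧ ∃ t₀ : ℝ, ∀ t : ℝ, t₀ ≤ t →
    ∀ {α : Type} [Fintype α] [DecidableEq α] (V : Finset α) (E : Finset (Finset α)),
      Unc E → (∀ e ∈ E, e ⊆ V ∧ e.card = k + 1) →
      (∀ v ∈ V, ((E.filter fun e => v ∈ e).card : ℝ) ≤ t ^ k) →
      ∃ I ⊆ V, (∀ e ∈ E, ¬ e ⊆ I) ∧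
        c * (V.card / t * Real.log t ^ ((1 : ℝ) / k)) ≤ I.card := by
  have hlim : ∀ᶠ y : ℝ in Filter.atTop, 64 * (3 + 9 * (k * 2 ^ k) : ℝ) * y ^ 3 ≤ Real.exp y := by
    have h := (Real.isLittleO_pow_exp_atTop (n := 3)).bound
      (show (0 : ℝ) < (64 * (3 + 9 * (k * 2 ^ k) : ℝ))⁻¹ by positivity)
    filter_upwards [h, Filter.eventually_ge_atTop 0] with y hy hy0
    rw [Real.norm_of_nonneg (by positivity), Real.norm_of_nonneg (Real.exp_pos _).le,
      inv_mul_eq_div, le_div_iff₀ (by positivity)] at hy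
    linarith
  obtain ⟨y₀, hy₀⟩ := Filter.eventually_atTop.mp hlim
  refine ⟨1 / 8 * (1 / 4 : ℝ) ^ ((1 : ℝ) / k), by positivity, Real.exp (2 * max y₀ 2), ?_⟩
  intro t ht α _ _ V E hE hcard hdeg
  have ht0 : 0 < t := lt_of_lt_of_le (Real.exp_pos _) ht
  set y := Real.log t / 2 with hy
  have hyge : max y₀ 2 ≤ y := by
    have := Real.log_le_log (Real.exp_pos _) ht
    rw [Real.log_exp] at this
    rw [hy]; linarith
  have hy2 : 2 ≤ y := (le_max_right _ _).trans hyge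
  have hB := hy₀ y ((le_max_left _ _).trans hyge)
  set T := ⌊y⌋₊ with hT
  have hTy : (T : ℝ) ≤ y := Nat.floor_le (by linarith)
  have hyT : y < T + 1 := Nat.lt_floor_add_one y
  have hT1 : (1 : ℝ) < T := by linarith
  have hT0 : (0 : ℝ) < T := by linarith
  set δ : ℝ := 1 / (4 * T) with hδ
  have hδ0 : 0 < δ := by positivity
  have hδ1 : δ ≤ 1 / 4 := by
    rw [hδ]; apply one_div_le_one_div_of_le <;> linarith
  have hδT : δ * T = 1 / 4 := by rw [hδ]; field_simp
  have hcond : (3 + 9 * (k * 2 ^ k) : ℝ) ≤ δ ^ 3 * (t * Real.exp (-T)) := by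
    have h1 : t = Real.exp (y + y) := by rw [hy, add_halves, Real.exp_log ht0]
    have h2 : Real.exp y ≤ t * Real.exp (-T) := by
      rw [h1, ← Real.exp_add, Real.exp_le_exp]; linarith
    have h3 : δ ^ 3 * (64 * T ^ 3) = 1 := by
      have : δ ^ 3 * (64 * T ^ 3) = (4 * (δ * T)) ^ 3 := by ring
      rw [this, hδT]; norm_num
    have h4 : (T : ℝ) ^ 3 ≤ y ^ 3 := pow_le_pow_left₀ hT0.le hTy 3
    calc (3 + 9 * (k * 2 ^ k) : ℝ) = δ ^ 3 * (64 * (3 + 9 * (k * 2 ^ k) : ℝ) * T ^ 3) := by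
          linear_combination (-(3 + 9 * (k * 2 ^ k) : ℝ)) * h3
      _ ≤ δ ^ 3 * (64 * (3 + 9 * (k * 2 ^ k) : ℝ) * y ^ 3) := by gcongr
      _ ≤ δ ^ 3 * (t * Real.exp (-T)) := by
          refine mul_le_mul_of_nonneg_left (hB.trans h2) (by positivity)
  have htr : ∀ e ∈ E, ∀ v ∈ e, (tr V e v).card = k := by
    intro e he v hv
    unfold tr
    rw [Finset.inter_eq_left.mpr (hcard e he).1, Finset.card_erase_of_mem hv, (hcard e he).2]
    rfl
  have ha0 : aa k 0 = 0 := by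
    unfold aa
    rw [Nat.cast_zero, Real.zero_rpow]
    have : (k : ℝ) ≠ 0 := by positivity
    positivity
  have hs : NState k (aa k 0) t V E := by
    refine ⟨hE, ?_, ?_⟩
    · intro e he v hv _
      rw [htr e he v hv]; exact ⟨hk, le_rfl⟩
    · intro v hv j hj hjk
      by_cases hjk' : j = k
      · subst hjk'
        simp only [Nat.choose_self, Nat.cast_one, Nat.sub_self, pow_zero, one_mul]
        refine le_trans ?_ (hdeg v hv)
        unfold dg
        exact_mod_cast Finset.card_le_card (fun e he => by
          rw [Finset.mem_filter] at he ⊢; exact ⟨he.1, he.2.1⟩)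
      · have : dg V E v j = 0 := by
          unfold dg
          rw [Finset.card_eq_zero, Finset.filter_eq_empty_iff]
          rintro e he ⟨hv, hc⟩
          rw [htr e he v hv] at hc
          omega
        rw [this, ha0, Nat.cast_zero]
        positivity
  obtain ⟨I, hI, hIc⟩ := iterate hk T hδ0 (by linarith) T 0 (by omega) t V E hcond hs
  refine ⟨I, hI.1, ?_, ?_⟩
  · intro e he hsub
    have h1 : e ∩ V = e := Finset.inter_eq_left.mpr (hcard e he).1
    refine hI.2 e he ?_ ?_
    · rw [h1, ← Finset.card_pos, (hcard e he).2]; omega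
    · rw [h1]; exact hsub
  · refine le_trans ?_ hIc
    rw [ha0, sub_zero]
    have hκ : (1 / 2 : ℝ) ≤ ((1 - δ) / (1 + δ)) ^ T := by
      have h1 : 1 - 2 * δ ≤ (1 - δ) / (1 + δ) := by
        rw [le_div_iff₀ (by linarith)]; nlinarith
      have h2 : 1 + (T : ℝ) * (-(2 * δ)) ≤ (1 + -(2 * δ)) ^ T :=
        one_add_mul_le_pow (by linarith) T
      have h3 : (1 + -(2 * δ)) ^ T ≤ ((1 - δ) / (1 + δ)) ^ T :=
        pow_le_pow_left₀ (by linarith) (by linarith) T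
      nlinarith
    have hlog : (1 / 4 : ℝ) ^ ((1 : ℝ) / k) * Real.log t ^ ((1 : ℝ) / k) ≤ aa k T := by
      rw [← Real.mul_rpow (by norm_num) (by linarith)]
      unfold aa
      refine Real.rpow_le_rpow (by linarith) ?_ (by positivity)
      linarith
    calc _ = (V.card : ℝ) * ((1 / 2) * ((1 / 4 : ℝ) ^ ((1 : ℝ) / k) *
          Real.log t ^ ((1 : ℝ) / k)) / (4 * t)) := by
          field_simp; ring
      _ ≤ _ := by
          refine mul_le_mul_of_nonneg_left ?_ (Nat.cast_nonneg _)
          refine div_le_div_of_nonneg_right ?_ (by positivity)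
          refine mul_le_mul hκ hlog ?_ (by linarith)
          have : 0 ≤ Real.log t := by linarith
          positivity

end Iterate
section Comb

variable {n : ℕ}

/-- Number of vertices spanned by a family. -/
def un (U : Finset (Finset (Fin n))) : ℕ := (U.sup id).card

/-- The sparseness potential. -/
def gg (r k m : ℕ) (U : Finset (Finset (Fin n))) : ℤ :=
  ((un U : ℤ) - r) * k - ((U.card : ℤ) - 1) * m

theorem un_sub (A B : Finset (Finset (Fin n))) : un (A ∪ B) + un (A ∩ B) ≤ un A + un B := by
  unfold un
  rw [Finset.sup_union]
  have h : (A ∩ B).sup id ⊆ A.sup id ∩ B.sup id :=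
    Finset.subset_inter (Finset.sup_mono Finset.inter_subset_left)
      (Finset.sup_mono Finset.inter_subset_right)
  have h2 := Finset.card_le_card h
  have h3 := Finset.card_union_add_card_inter (A.sup id) (B.sup id)
  have h4 : (A.sup id ⊔ B.sup id) = A.sup id ∪ B.sup id := rfl
  rw [h4]
  omega

theorem gg_sub (r k m : ℕ) (A B : Finset (Finset (Fin n))) :
    gg r k m (A ∪ B) + gg r k m (A ∩ B) ≤ gg r k m A + gg r k m B := by
  unfold gg
  have h1 : (un (A ∪ B) : ℤ) + un (A ∩ B) ≤ un A + un B := by exact_mod_cast un_sub A B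
  have h2 : ((A ∪ B).card : ℤ) + (A ∩ B).card = A.card + B.card := by
    exact_mod_cast Finset.card_union_add_card_inter A B
  have h3 := mul_le_mul_of_nonneg_right h1 (Int.natCast_nonneg k)
  have h4 : (((A ∪ B).card : ℤ) + (A ∩ B).card) * m = (A.card + B.card) * m := by rw [h2]
  linarith

/-- Sparse host families. -/
structure Host (r k m : ℕ) (V : Finset (Finset (Fin n))) : Prop where
  card : ∀ x ∈ V, x.card = r
  spa : ∀ U ⊆ V, 2 ≤ U.card → U.card ≤ 4 * (k + 1) → 0 ≤ gg r k m U

theorem Host.nonneg {r k m : ℕ} {V : Finset (Finset (Fin n))} (h : Host r k m V)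
    {U : Finset (Finset (Fin n))} (hU : U ⊆ V) (h1 : 1 ≤ U.card) (h2 : U.card ≤ 4 * (k + 1)) :
    0 ≤ gg r k m U := by
  rcases Nat.lt_or_ge U.card 2 with h3 | h3
  · have h4 : U.card = 1 := by omega
    obtain ⟨x, rfl⟩ := Finset.card_eq_one.mp h4
    have := h.card x (hU (by simp))
    simp [gg, un, this]
  · exact h.spa U hU h3 h2

theorem Host.pos {r k m : ℕ} {V : Finset (Finset (Fin n))} (h : Host r k m V)
    (hco : Nat.Coprime k m)
    {U : Finset (Finset (Fin n))} (hU : U ⊆ V) (h1 : 2 ≤ U.card) (h2 : U.card ≤ k) :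
    0 < gg r k m U := by
  have h0 := h.spa U hU h1 (by omega)
  refine lt_of_le_of_ne h0 (fun h3 => ?_)
  unfold gg at h3
  have h4 : (k : ℤ) ∣ ((U.card : ℤ) - 1) * m := ⟨(un U : ℤ) - r, by linarith⟩
  have h5 : IsCoprime (k : ℤ) (m : ℤ) := Nat.isCoprime_iff_coprime.mpr hco
  have h6 := h5.dvd_of_dvd_mul_right h4
  have h7 := Int.le_of_dvd (by omega) h6
  omega

theorem Host.tight {r k m : ℕ} {V : Finset (Finset (Fin n))} (h : Host r k m V)
    (hco : Nat.Coprime k m) {A U : Finset (Finset (Fin n))} (hU : U ⊆ V)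
    (hUc : U.card ≤ 3 * (k + 1)) (hUg : gg r k m U ≤ 0) (hA : A ⊆ V) (hAc : A.card = k + 1)
    (hAg : gg r k m A ≤ 0) {x : Finset (Fin n)} (hxA : x ∈ A) (hxU : x ∈ U) :
    gg r k m (A ∪ U) ≤ 0 ∧ ∀ y ∈ A, y ∈ U → y ≠ x → A ⊆ U := by
  have hs := gg_sub r k m A U
  have hi1 : 1 ≤ (A ∩ U).card := Finset.card_pos.mpr ⟨x, Finset.mem_inter.mpr ⟨hxA, hxU⟩⟩
  have hile : (A ∩ U).card ≤ k + 1 := hAc ▸ Finset.card_le_card Finset.inter_subset_left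
  have hi := h.nonneg (U := A ∩ U) (Finset.inter_subset_left.trans hA) hi1 (by omega)
  have hu := Finset.card_union_le A U
  have hu1 : 1 ≤ (A ∪ U).card := Finset.card_pos.mpr ⟨x, Finset.mem_union_left _ hxA⟩
  have hun := h.nonneg (U := A ∪ U) (Finset.union_subset hA hU) hu1 (by omega)
  refine ⟨by linarith, fun y hyA hyU hyx => ?_⟩
  have h2 : 2 ≤ (A ∩ U).card := by
    apply Finset.one_lt_card.mpr
    exact ⟨x, Finset.mem_inter.mpr ⟨hxA, hxU⟩, y, Finset.mem_inter.mpr ⟨hyA, hyU⟩, hyx.symm⟩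
  by_contra hns
  have h3 : (A ∩ U).card ≤ k := by
    by_contra hcon
    apply hns
    have : A ∩ U = A := Finset.eq_of_subset_of_card_le Finset.inter_subset_left (by omega)
    exact Finset.inter_eq_left.mp this
  have := h.pos hco (U := A ∩ U) (Finset.inter_subset_left.trans hA) h2 h3
  linarith

theorem Host.unc {r k m : ℕ} {V : Finset (Finset (Fin n))} (h : Host r k m V) (hk : 3 ≤ k)
    (hco : Nat.Coprime k m) {E : Finset (Finset (Finset (Fin n)))}
    (hE : ∀ A ∈ E, A ⊆ V ∧ A.card = k + 1 ∧ gg r k m A ≤ 0) : Unc E := by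
  have lin : ∀ e ∈ E, ∀ f ∈ E, e ≠ f → ∀ x y, x ∈ e → x ∈ f → y ∈ e → y ∈ f → x = y := by
    intro A hA B hB hne x y hxA hxB hyA hyB
    by_contra hxy
    obtain ⟨a1, a2, a3⟩ := hE A hA
    obtain ⟨b1, b2, b3⟩ := hE B hB
    have := (h.tight hco b1 (by omega) b3 a1 a2 a3 hxA hxB).2 y hyA hyB (fun h => hxy h.symm)
    exact hne (Finset.eq_of_subset_of_card_le this (by omega))
  have lin' : ∀ e ∈ E, ∀ f ∈ E, e ≠ f → (e ∩ f).card ≤ 1 := by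
    intro A hA B hB hne
    rw [Finset.card_le_one]
    intro x hx y hy
    rw [Finset.mem_inter] at hx hy
    exact lin A hA B hB hne x y hx.1 hx.2 hy.1 hy.2
  refine ⟨lin, ?_, ?_⟩
  · intro A hA B hB C hC hAB hBC hCA x y z hxy hyz hzx xA xB yB yC zC zA
    obtain ⟨a1, a2, a3⟩ := hE A hA
    obtain ⟨b1, b2, b3⟩ := hE B hB
    obtain ⟨c1, c2, c3⟩ := hE C hC
    have t1 := (h.tight hco b1 (by omega) b3 a1 a2 a3 xA xB).1
    have u1 := Finset.card_union_le A B
    have hs := (h.tight hco (U := A ∪ B) (Finset.union_subset a1 b1) (by omega) t1 c1 c2 c3 yC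
      (Finset.mem_union_right _ yB)).2 z zC (Finset.mem_union_left _ zA) (fun h => hyz h.symm)
    have h1 : C = C ∩ A ∪ C ∩ B := by
      rw [← Finset.inter_union_distrib_left, Finset.inter_eq_left.mpr hs]
    have h2 := Finset.card_union_le (C ∩ A) (C ∩ B)
    have h3 := lin' C hC A hA hCA
    have h4 := lin' C hC B hB hBC.symm
    rw [← h1] at h2
    omega
  · intro A hA B hB C hC D hD hAB hAC hAD hBC hBD hCD x y z w hxy hxz hxw hyz hyw hzw
      xA xB yB yC zC zD wD wA
    obtain ⟨a1, a2, a3⟩ := hE A hA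
    obtain ⟨b1, b2, b3⟩ := hE B hB
    obtain ⟨c1, c2, c3⟩ := hE C hC
    obtain ⟨d1, d2, d3⟩ := hE D hD
    have t1 := (h.tight hco b1 (by omega) b3 a1 a2 a3 xA xB).1
    have u1 := Finset.card_union_le A B
    have t2 := (h.tight hco (U := A ∪ B) (Finset.union_subset a1 b1) (by omega) t1 c1 c2 c3 yC
      (Finset.mem_union_right _ yB)).1
    have u2 := Finset.card_union_le C (A ∪ B)
    have hs := (h.tight hco (U := C ∪ (A ∪ B)) (Finset.union_subset c1 (Finset.union_subset a1 b1))
      (by omega) t2 d1 d2 d3 zD (Finset.mem_union_left _ zC)).2 w wD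
      (Finset.mem_union_right _ (Finset.mem_union_left _ wA)) (fun h => hzw h.symm)
    have h1 : D = D ∩ C ∪ (D ∩ A ∪ D ∩ B) := by
      rw [← Finset.inter_union_distrib_left, ← Finset.inter_union_distrib_left,
        Finset.inter_eq_left.mpr hs]
    have h2 := Finset.card_union_le (D ∩ C) (D ∩ A ∪ D ∩ B)
    have h2' := Finset.card_union_le (D ∩ A) (D ∩ B)
    have h3 := lin' D hD A hA hAD.symm
    have h4 := lin' D hD B hB hBD.symm
    have h5 := lin' D hD C hC hCD.symm
    rw [← h1] at h2
    omega

end Comb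

section Sample

variable {ι : Type} [Fintype ι] [DecidableEq ι]

theorem ind_le_prod (N U : Finset ι) (ω : ι → Bool) :
    (if U ⊆ N.filter (fun i => ω i = true) then (1 : ℝ) else 0) ≤ ∏ i ∈ U, sel i ω := by
  split_ifs with h
  · rw [Finset.prod_eq_one]
    intro i hi
    have := (Finset.mem_filter.mp (h hi)).2
    simp [sel, this]
  · exact Finset.prod_nonneg fun i _ => sel_nonneg i ω

theorem sample (N : Finset ι) (D C : Finset (Finset ι)) {k : ℕ} {p M : ℝ} (hp0 : 0 ≤ p)
    (hp1 : p ≤ 1) (hM : 0 < M) (hD : ∀ U ∈ D, U.Nonempty) (hC : ∀ A ∈ C, A.card = k + 1) :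
    ∃ V ⊆ N, (∀ U ∈ D, ¬ U ⊆ V) ∧
      (∀ v ∈ V, ((((C.filter (· ⊆ V))).filter fun A => v ∈ A).card : ℝ) ≤ M) ∧
      (N.card : ℝ) * p - ∑ U ∈ D, p ^ U.card - (k + 1) / M * (C.card * p ^ (k + 1)) ≤ V.card := by
  classical
  let f : (ι → Bool) → ℝ := fun ω => ∑ v ∈ N, sel v ω - ∑ U ∈ D, ∏ i ∈ U, sel i ω -
    (k + 1) / M * ∑ U ∈ C, ∏ i ∈ U, sel i ω
  obtain ⟨ω, hω⟩ := exists_ge_Ex (p := fun _ : ι => p) (fun _ => hp0) (fun _ => hp1) f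
  have hEx : Ex (fun _ : ι => p) f =
      (N.card : ℝ) * p - ∑ U ∈ D, p ^ U.card - (k + 1) / M * (C.card * p ^ (k + 1)) := by
    simp only [f]
    rw [Ex_sub, Ex_sub, Ex_const_mul, Ex_sum, Ex_sum, Ex_sum]
    simp only [Ex_sel, Ex_prod_sel, Finset.prod_const, Finset.sum_const, nsmul_eq_mul]
    congr 2
    rw [Finset.sum_congr rfl (fun A hA => by rw [hC A hA]), Finset.sum_const, nsmul_eq_mul]
  rw [← hEx]
  set S := N.filter (fun i => ω i = true) with hS
  set D' := D.filter (· ⊆ S) with hD'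
  set C' := C.filter (· ⊆ S) with hC'
  let X : Finset ι := D'.attach.image
    (fun U => (hD U.1 (Finset.mem_filter.mp U.2).1).choose)
  have hXc : X.card ≤ D'.card := Finset.card_image_le.trans (by rw [Finset.card_attach])
  have hX : ∀ U ∈ D', ∃ x ∈ U, x ∈ X := fun U hU =>
    ⟨_, (hD U (Finset.mem_filter.mp hU).1).choose_spec,
      Finset.mem_image.mpr ⟨⟨U, hU⟩, Finset.mem_attach _ _, rfl⟩⟩
  set Y := S.filter (fun v => M < ((C'.filter fun A => v ∈ A).card : ℝ)) with hY
  have hYc : (Y.card : ℝ) ≤ (k + 1) / M * C'.card := by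
    have h1 : (Y.card : ℝ) * M ≤ ∑ v ∈ Y, ((C'.filter fun A => v ∈ A).card : ℝ) := by
      rw [← nsmul_eq_mul]
      exact Finset.card_nsmul_le_sum _ _ _ fun v hv => (Finset.mem_filter.mp hv).2.le
    have h2 : ∑ v ∈ Y, ((C'.filter fun A => v ∈ A).card : ℝ) =
        ∑ A ∈ C', ((Y.filter fun v => v ∈ A).card : ℝ) := by
      have := Finset.sum_card_bipartiteAbove_eq_sum_card_bipartiteBelow
        (s := Y) (t := C') (fun v A => v ∈ A)
      unfold Finset.bipartiteAbove Finset.bipartiteBelow at this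
      exact_mod_cast this
    have h3 : ∑ A ∈ C', ((Y.filter fun v => v ∈ A).card : ℝ) ≤ ∑ A ∈ C', ((k : ℝ) + 1) := by
      refine Finset.sum_le_sum fun A hA => ?_
      have h4 : (Y.filter fun v => v ∈ A) ⊆ A := fun v hv => (Finset.mem_filter.mp hv).2
      have h5 := Finset.card_le_card h4
      rw [hC A (Finset.mem_filter.mp hA).1] at h5
      exact_mod_cast h5
    rw [Finset.sum_const, nsmul_eq_mul] at h3
    rw [div_mul_eq_mul_div, le_div_iff₀ hM]
    linarith
  have hsubS : (S \ X) \ Y ⊆ S := Finset.sdiff_subset.trans Finset.sdiff_subset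
  refine ⟨(S \ X) \ Y, hsubS.trans (Finset.filter_subset _ _), ?_, ?_, ?_⟩
  · intro U hU hsub
    obtain ⟨x, hxU, hxX⟩ := hX U (Finset.mem_filter.mpr ⟨hU, hsub.trans hsubS⟩)
    have := hsub hxU
    simp only [Finset.mem_sdiff] at this
    exact this.1.2 hxX
  · intro v hv
    have hv' := hv
    simp only [Finset.mem_sdiff] at hv'
    have h1 : ¬ M < ((C'.filter fun A => v ∈ A).card : ℝ) := fun h =>
      hv'.2 (Finset.mem_filter.mpr ⟨hv'.1.1, h⟩)
    refine le_trans ?_ (not_lt.mp h1)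
    have h2 : ((C.filter (· ⊆ (S \ X) \ Y)).filter fun A => v ∈ A) ⊆
        C'.filter fun A => v ∈ A := by
      intro A hA
      simp only [Finset.mem_filter, hC'] at hA ⊢
      exact ⟨⟨hA.1.1, hA.1.2.trans hsubS⟩, hA.2⟩
    exact_mod_cast Finset.card_le_card h2
  · refine hω.trans ?_
    have e1 : ∑ v ∈ N, sel v ω = S.card := by
      simp only [sel, hS]
      rw [Finset.sum_boole]
    have e2 : (D'.card : ℝ) ≤ ∑ U ∈ D, ∏ i ∈ U, sel i ω := by
      rw [hD', ← Finset.sum_boole]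
      exact Finset.sum_le_sum fun U _ => ind_le_prod N U ω
    have e3 : (C'.card : ℝ) ≤ ∑ U ∈ C, ∏ i ∈ U, sel i ω := by
      rw [hC', ← Finset.sum_boole]
      exact Finset.sum_le_sum fun U _ => ind_le_prod N U ω
    have e4 := mul_le_mul_of_nonneg_left e3 (show 0 ≤ ((k : ℝ) + 1) / M by positivity)
    have c1 : S.card ≤ (S \ X).card + X.card := by
      have := Finset.le_card_sdiff X S
      omega
    have c2 : (S \ X).card ≤ ((S \ X) \ Y).card + Y.card := by
      have := Finset.le_card_sdiff Y (S \ X)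
      omega
    have c3 : (S.card : ℝ) ≤ ((S \ X) \ Y).card + Y.card + D'.card := by
      exact_mod_cast (by omega : S.card ≤ ((S \ X) \ Y).card + Y.card + D'.card)
    simp only [f]
    rw [e1]
    linarith

end Sample

section Count

variable {n : ℕ}

theorem count_un (s : ℕ) : ((Finset.univ : Finset (Finset (Finset (Fin n)))).filter
    fun U => un U = s).card ≤ n ^ s * 2 ^ 2 ^ s := by
  have h : ((Finset.univ : Finset (Finset (Finset (Fin n)))).filter fun U => un U = s) ⊆
      (Finset.powersetCard s (Finset.univ : Finset (Fin n))).biUnion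
        (fun W => W.powerset.powerset) := by
    intro U hU
    rw [Finset.mem_biUnion]
    refine ⟨U.sup id, ?_, ?_⟩
    · rw [Finset.mem_powersetCard]
      exact ⟨Finset.subset_univ _, (Finset.mem_filter.mp hU).2⟩
    · rw [Finset.mem_powerset]
      intro x hx
      rw [Finset.mem_powerset]
      exact Finset.le_sup (f := id) hx
  refine (Finset.card_le_card h).trans (Finset.card_biUnion_le.trans ?_)
  rw [Finset.sum_congr rfl (fun W hW => by
    rw [Finset.card_powerset, Finset.card_powerset, (Finset.mem_powersetCard.mp hW).2]),
    Finset.sum_const, Finset.card_powersetCard, Finset.card_univ, Fintype.card_fin, smul_eq_mul]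
  exact Nat.mul_le_mul_right _ (Nat.choose_le_pow n s)

/-- Forbidden dense families. -/
def dense (n r k m : ℕ) : Finset (Finset (Finset (Fin n))) :=
  Finset.univ.filter fun U => 2 ≤ U.card ∧ U.card ≤ 4 * (k + 1) ∧ gg r k m U < 0

/-- Configurations. -/
def conf (n r k m : ℕ) : Finset (Finset (Finset (Fin n))) :=
  Finset.univ.filter fun U => U.card = k + 1 ∧ un U ≤ r + m

theorem sum_by_un (D : Finset (Finset (Finset (Fin n)))) (K : ℕ) (hn : 1 ≤ n)
    (hK : ∀ U ∈ D, un U ≤ K) (w : Finset (Finset (Fin n)) → ℝ) {β : ℝ} (hβ : 0 ≤ β)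
    (hw : ∀ U ∈ D, (n : ℝ) ^ un U * w U ≤ β) :
    ∑ U ∈ D, w U ≤ (K + 1) * 2 ^ 2 ^ K * β := by
  have h1 : ∑ U ∈ D, w U = ∑ s ∈ Finset.range (K + 1), ∑ U ∈ D.filter (fun U => un U = s), w U := by
    rw [Finset.sum_fiberwise_of_maps_to]
    intro U hU
    have := hK U hU
    rw [Finset.mem_range]; omega
  rw [h1]
  have hn0 : (0 : ℝ) < n := by exact_mod_cast hn
  have h2 : ∀ s ∈ Finset.range (K + 1), ∑ U ∈ D.filter (fun U => un U = s), w U ≤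
      2 ^ 2 ^ K * β := by
    intro s hs
    have h3 : ∑ U ∈ D.filter (fun U => un U = s), w U ≤
        ∑ U ∈ D.filter (fun U => un U = s), β / (n : ℝ) ^ s := by
      refine Finset.sum_le_sum fun U hU => ?_
      rw [Finset.mem_filter] at hU
      rw [le_div_iff₀ (by positivity)]
      have := hw U hU.1
      rw [hU.2] at this
      linarith
    refine h3.trans ?_
    rw [Finset.sum_const, nsmul_eq_mul]
    have h4 : (D.filter (fun U => un U = s)).card ≤ n ^ s * 2 ^ 2 ^ s :=
      (Finset.card_le_card (Finset.filter_subset_filter _ (Finset.subset_univ D))).trans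
        (count_un s)
    have h5 : ((D.filter (fun U => un U = s)).card : ℝ) ≤ (n : ℝ) ^ s * 2 ^ 2 ^ s := by
      exact_mod_cast h4
    have h6 : (2 : ℝ) ^ 2 ^ s ≤ 2 ^ 2 ^ K := by
      refine pow_le_pow_right₀ (by norm_num) (Nat.pow_le_pow_right (by norm_num) ?_)
      rw [Finset.mem_range] at hs; omega
    calc _ ≤ (n : ℝ) ^ s * 2 ^ 2 ^ s * (β / (n : ℝ) ^ s) :=
          mul_le_mul_of_nonneg_right h5 (by positivity)
      _ = 2 ^ 2 ^ s * β := by field_simp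
      _ ≤ _ := mul_le_mul_of_nonneg_right h6 hβ
  refine (Finset.sum_le_sum h2).trans ?_
  rw [Finset.sum_const, Finset.card_range, nsmul_eq_mul]
  push_cast
  linarith

theorem choose_ge {r : ℕ} (hn : 2 * r ≤ n) :
    (n : ℝ) ^ r * (1 / (2 ^ r * r.factorial)) ≤ (n.choose r : ℝ) := by
  have h := Nat.pow_le_choose (α := ℝ) r n
  have h1 : (n : ℝ) / 2 ≤ ((n + 1 - r : ℕ) : ℝ) := by
    rw [div_le_iff₀ (by norm_num)]
    exact_mod_cast (by omega : n ≤ (n + 1 - r) * 2)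
  have h2 := pow_le_pow_left₀ (by positivity) h1 r
  rw [div_pow] at h2
  have h3 : (0 : ℝ) < r.factorial := by exact_mod_cast r.factorial_pos
  rw [mul_one_div, ← div_div, div_le_iff₀ h3]
  rw [div_le_iff₀ h3] at h
  exact h2.trans h

end Count
section Final

theorem dense_exp {r k m s i : ℕ} {x δ : ℝ} (hk : 1 ≤ k) (hx : 1 ≤ x)
    (hδ0 : 0 < δ) (hδ : δ * (8 * (k + 1) * k) = 1) (hi : i ≤ 4 * (k + 1))
    (hg : ((s : ℤ) - r) * k - ((i : ℤ) - 1) * m < 0) :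
    x ^ s * (x ^ (δ - (m : ℝ) / k)) ^ i ≤
      x ^ r * x ^ (δ - (m : ℝ) / k) * x ^ (-(1 / (2 * k) : ℝ)) := by
  have hx0 : 0 < x := by linarith
  have hk0 : (0 : ℝ) < k := by exact_mod_cast hk
  rw [← Real.rpow_natCast x s, ← Real.rpow_natCast x r, ← Real.rpow_natCast _ i,
    ← Real.rpow_mul hx0.le, ← Real.rpow_add hx0, ← Real.rpow_add hx0, ← Real.rpow_add hx0]
  refine Real.rpow_le_rpow_of_exponent_le hx ?_
  have h1 : ((s : ℝ) - r) * k - ((i : ℝ) - 1) * m + 1 ≤ 0 := by exact_mod_cast hg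
  have h2 : (i : ℝ) ≤ 4 * (k + 1) := by exact_mod_cast hi
  set θ := (m : ℝ) / k with hθ
  have h3 : θ * k = m := by rw [hθ]; field_simp
  have h4 : (1 / (2 * k) : ℝ) * k = 1 / 2 := by field_simp
  have h5 : δ * k * ((i : ℝ) - 1) ≤ 1 / 2 := by
    have : δ * k * ((i : ℝ) - 1) ≤ δ * k * (4 * (k + 1)) :=
      mul_le_mul_of_nonneg_left (by linarith) (by positivity)
    linarith
  refine le_of_mul_le_mul_right ?_ hk0
  rw [← h3] at h1
  linarith

theorem conf_exp {r k m : ℕ} {x δ : ℝ} (hk : 1 ≤ k) (hx : 1 ≤ x) :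
    x ^ (r + m) * (x ^ (δ - (m : ℝ) / k)) ^ (k + 1) =
      x ^ r * x ^ (δ - (m : ℝ) / k) * (x ^ δ) ^ k := by
  have hx0 : 0 < x := by linarith
  have hk0 : (k : ℝ) ≠ 0 := by have : 0 < k := hk
                               positivity
  rw [← Real.rpow_natCast x (r + m), ← Real.rpow_natCast x r, ← Real.rpow_natCast _ (k + 1),
    ← Real.rpow_natCast _ k,
    ← Real.rpow_mul hx0.le, ← Real.rpow_mul hx0.le, ← Real.rpow_add hx0, ← Real.rpow_add hx0,
    ← Real.rpow_add hx0]
  congr 1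
  push_cast
  field_simp
  ring

theorem main_aux {r k m : ℕ} (hk : 3 ≤ k) (hm : 1 ≤ m) (hco : Nat.Coprime k m) :
    ∃ c : ℝ, 0 < c ∧ ∃ N : ℕ, ∀ n : ℕ, N ≤ n → ∃ H : Finset (Finset (Fin n)),
      Host r k m H ∧ (∀ S ⊆ H, S.card = k + 1 → r + m < un S) ∧
      c * (n : ℝ) ^ ((r : ℝ) - (m : ℝ) / k) * Real.log n ^ ((1 : ℝ) / k) ≤ H.card := by
  classical
  have hk0 : (0 : ℝ) < k := by have : 0 < k := by omega
                               positivity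
  have hm1 : (1 : ℝ) ≤ m := by exact_mod_cast hm
  obtain ⟨c, hc, t₀, hak⟩ := akpss (k := k) (by omega)
  obtain ⟨δ, hδ⟩ : ∃ δ : ℝ, δ = 1 / (8 * (k + 1) * k) := ⟨_, rfl⟩
  have hδ0 : 0 < δ := by rw [hδ]; positivity
  have hδ1 : δ * (8 * (k + 1) * k) = 1 := by rw [hδ]; field_simp
  obtain ⟨c1, hc1⟩ : ∃ c1 : ℝ, c1 = 1 / (2 ^ r * r.factorial) := ⟨_, rfl⟩
  have hc10 : 0 < c1 := by rw [hc1]; have := r.factorial_pos; positivity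
  obtain ⟨K1, hK1⟩ : ∃ K1 : ℕ, K1 = r + 4 * (k + 1) * m := ⟨_, rfl⟩
  obtain ⟨Q1, hQ1⟩ : ∃ Q1 : ℝ, Q1 = (K1 + 1) * 2 ^ 2 ^ K1 := ⟨_, rfl⟩
  have hQ10 : 0 < Q1 := by rw [hQ1]; positivity
  obtain ⟨Q2, hQ2⟩ : ∃ Q2 : ℝ, Q2 = ((r + m : ℕ) + 1) * 2 ^ 2 ^ (r + m) := ⟨_, rfl⟩
  have hQ20 : 0 < Q2 := by rw [hQ2]; positivity
  obtain ⟨B, hB⟩ : ∃ B : ℝ, B = max 1 (4 * (k + 1) * Q2 / c1) := ⟨_, rfl⟩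
  have hB1 : 1 ≤ B := hB ▸ le_max_left _ _
  have hB2 : (k + 1) * Q2 ≤ c1 / 4 * B ^ k := by
    have h1 : 4 * (k + 1) * Q2 / c1 ≤ B := hB ▸ le_max_right _ _
    have h2 : B ≤ B ^ k := le_self_pow₀ hB1 (by omega)
    have h3 := h1.trans h2
    rw [div_le_iff₀ hc10] at h3
    linarith
  have hev : ∀ᶠ n : ℕ in Filter.atTop, 2 * r ≤ n ∧ 1 ≤ n ∧ t₀ ≤ (n : ℝ) ^ δ ∧
      Q1 * (n : ℝ) ^ (-(1 / (2 * k) : ℝ)) ≤ c1 / 4 := by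
    have e1 := (tendsto_rpow_atTop hδ0).comp (tendsto_natCast_atTop_atTop (R := ℝ))
    have e2 := (tendsto_rpow_neg_atTop (show (0 : ℝ) < 1 / (2 * k) by positivity)).comp
      (tendsto_natCast_atTop_atTop (R := ℝ))
    have e3 := (e2.const_mul Q1)
    rw [mul_zero] at e3
    filter_upwards [Filter.eventually_ge_atTop (2 * r), Filter.eventually_ge_atTop 1,
      e1.eventually_ge_atTop t₀, e3.eventually_le_const (show (0 : ℝ) < c1 / 4 by positivity)]
      with n a1 a2 a3 a4
    exact ⟨a1, a2, a3, a4⟩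
  obtain ⟨N, hN⟩ := Filter.eventually_atTop.mp hev
  refine ⟨c * (c1 / (2 * B)) * δ ^ ((1 : ℝ) / k), by positivity, N, fun n hn => ?_⟩
  obtain ⟨hn2, hn1, hnt, hnQ⟩ := hN n hn
  obtain ⟨x, hx⟩ : ∃ x : ℝ, x = n := ⟨_, rfl⟩
  have hx1 : 1 ≤ x := by rw [hx]; exact_mod_cast hn1
  have hx0 : 0 < x := by linarith
  rw [← hx] at hnt hnQ ⊢
  obtain ⟨p, hp⟩ : ∃ p : ℝ, p = x ^ (δ - (m : ℝ) / k) := ⟨_, rfl⟩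
  have hp0 : 0 < p := by rw [hp]; positivity
  have hp1 : p ≤ 1 := by
    rw [hp]
    refine Real.rpow_le_one_of_one_le_of_nonpos hx1 ?_
    rw [sub_nonpos, le_div_iff₀ hk0]
    have : δ * k ≤ δ * (8 * (k + 1) * k) := by
      refine mul_le_mul_of_nonneg_left ?_ hδ0.le
      nlinarith
    linarith
  obtain ⟨t, ht⟩ : ∃ t : ℝ, t = B * x ^ δ := ⟨_, rfl⟩
  have hxδ : 1 ≤ x ^ δ := Real.one_le_rpow hx1 hδ0.le
  have htx : x ^ δ ≤ t := by rw [ht]; nlinarith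
  have ht0 : 0 < t := by linarith
  obtain ⟨V, hVN, hVD, hVC, hVc⟩ := sample (k := k) (M := t ^ k)
    (Finset.powersetCard r (Finset.univ : Finset (Fin n)))
    (dense n r k m) (conf n r k m) hp0.le hp1 (by positivity)
    (fun U hU => by
      have := (Finset.mem_filter.mp hU).2.1
      exact Finset.card_pos.mp (by omega))
    (fun A hA => (Finset.mem_filter.mp hA).2.1)
  have hhost : Host r k m V := by
    refine ⟨fun A hA => (Finset.mem_powersetCard.mp (hVN hA)).2, fun U hU h2 h4 => ?_⟩
    by_contra hcon
    exact hVD U (Finset.mem_filter.mpr ⟨Finset.mem_univ _, h2, h4, not_le.mp hcon⟩) hU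
  have hE : ∀ A ∈ (conf n r k m).filter (· ⊆ V), A ⊆ V ∧ A.card = k + 1 ∧ gg r k m A ≤ 0 := by
    intro A hA
    obtain ⟨hA1, hA2⟩ := Finset.mem_filter.mp hA
    obtain ⟨-, hA3, hA4⟩ := Finset.mem_filter.mp hA1
    refine ⟨hA2, hA3, ?_⟩
    unfold gg
    rw [hA3]
    have : (un A : ℤ) - r ≤ m := by
      have : (un A : ℤ) ≤ r + m := by exact_mod_cast hA4
      linarith
    have := mul_le_mul_of_nonneg_right this (Int.natCast_nonneg k)
    push_cast
    linarith
  obtain ⟨H, hHV, hHE, hHc⟩ := hak t (hnt.trans htx) V ((conf n r k m).filter (· ⊆ V))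
    (hhost.unc hk hco hE) (fun A hA => ⟨(hE A hA).1, (hE A hA).2.1⟩) hVC
  refine ⟨H, ⟨fun A hA => hhost.card A (hHV hA), fun U hU => hhost.spa U (hU.trans hHV)⟩, ?_, ?_⟩
  · intro S hS hSc
    by_contra hcon
    refine hHE S (Finset.mem_filter.mpr ⟨Finset.mem_filter.mpr ⟨Finset.mem_univ _, hSc,
      not_lt.mp hcon⟩, hS.trans hHV⟩) hS
  -- size
  have hNc : x ^ r * c1 ≤ ((Finset.powersetCard r (Finset.univ : Finset (Fin n))).card : ℝ) := by
    rw [Finset.card_powersetCard, Finset.card_univ, Fintype.card_fin, hx, hc1]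
    exact choose_ge hn2
  have hdense : ∑ U ∈ dense n r k m, p ^ U.card ≤ c1 / 4 * (x ^ r * p) := by
    have h1 := sum_by_un (dense n r k m) K1 hn1 (fun U hU => by
      obtain ⟨-, h2, h4, h5⟩ := Finset.mem_filter.mp hU
      unfold gg at h5
      by_contra hcon
      have a1 : (4 * (k + 1) * m : ℤ) ≤ (un U : ℤ) - r := by
        have : (K1 : ℤ) ≤ un U := by exact_mod_cast (not_le.mp hcon).le
        rw [hK1] at this; push_cast at this; linarith
      have a2 : ((U.card : ℤ) - 1) * m ≤ 4 * (k + 1) * m :=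
        mul_le_mul_of_nonneg_right (by omega) (Int.natCast_nonneg m)
      have a3 : (un U : ℤ) - r ≤ ((un U : ℤ) - r) * k :=
        le_mul_of_one_le_right (le_trans (by positivity) a1) (by omega)
      linarith) (fun U => p ^ U.card) (β := x ^ r * p * x ^ (-(1 / (2 * k) : ℝ)))
      (by positivity) (fun U hU => by
        obtain ⟨-, h2, h4, h5⟩ := Finset.mem_filter.mp hU
        unfold gg at h5
        rw [← hx, hp]
        exact dense_exp (by omega) hx1 hδ0 hδ1 h4 h5)
    rw [← hQ1] at h1
    refine h1.trans ?_
    have := mul_le_mul_of_nonneg_right hnQ (show 0 ≤ x ^ r * p by positivity)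
    linarith
  have hconf : (k + 1) / t ^ k * ((conf n r k m).card * p ^ (k + 1)) ≤ c1 / 4 * (x ^ r * p) := by
    have h1 := sum_by_un (conf n r k m) (r + m) hn1 (fun U hU => (Finset.mem_filter.mp hU).2.2)
      (fun U => (1 : ℝ)) (β := x ^ (r + m)) (by positivity) (fun U hU => by
        rw [mul_one, ← hx]
        exact pow_le_pow_right₀ hx1 (Finset.mem_filter.mp hU).2.2)
    rw [Finset.sum_const, nsmul_eq_mul, mul_one, ← hQ2] at h1
    have h2 : x ^ (r + m) * p ^ (k + 1) = x ^ r * p * (x ^ δ) ^ k := by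
      rw [hp]; exact conf_exp (by omega) hx1
    rw [div_mul_eq_mul_div, div_le_iff₀ (by positivity), ht, mul_pow]
    calc (k + 1) * ((conf n r k m).card * p ^ (k + 1))
        ≤ (k + 1) * (Q2 * x ^ (r + m) * p ^ (k + 1)) := by gcongr
      _ = ((k + 1) * Q2) * (x ^ r * p * (x ^ δ) ^ k) := by rw [← h2]; ring
      _ ≤ (c1 / 4 * B ^ k) * (x ^ r * p * (x ^ δ) ^ k) :=
          mul_le_mul_of_nonneg_right hB2 (by positivity)
      _ = _ := by ring
  have hVge : c1 / 2 * (x ^ r * p) ≤ V.card := by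
    have := mul_le_mul_of_nonneg_right hNc hp0.le
    linarith
  refine le_trans ?_ hHc
  have hlx : 0 ≤ Real.log x := Real.log_nonneg hx1
  have hlog : δ ^ ((1 : ℝ) / k) * Real.log x ^ ((1 : ℝ) / k) ≤ Real.log t ^ ((1 : ℝ) / k) := by
    rw [← Real.mul_rpow hδ0.le hlx]
    refine Real.rpow_le_rpow (by positivity) ?_ (by positivity)
    rw [← Real.log_rpow hx0]
    exact Real.log_le_log (by positivity) htx
  have hexp : x ^ ((r : ℝ) - (m : ℝ) / k) * x ^ δ = x ^ r * p := by
    rw [hp, ← Real.rpow_natCast x r, ← Real.rpow_add hx0, ← Real.rpow_add hx0]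
    congr 1; ring
  have hfin : c1 / (2 * B) * x ^ ((r : ℝ) - (m : ℝ) / k) ≤ V.card / t := by
    rw [le_div_iff₀ ht0, ht]
    refine le_trans (le_of_eq ?_) hVge
    rw [← hexp]
    field_simp
  calc _ = c * ((c1 / (2 * B) * x ^ ((r : ℝ) - (m : ℝ) / k)) *
        (δ ^ ((1 : ℝ) / k) * Real.log x ^ ((1 : ℝ) / k))) := by ring
    _ ≤ _ := by
      refine mul_le_mul_of_nonneg_left ?_ hc.le
      exact mul_le_mul hfin hlog (by positivity) (by positivity)

end Final
end AK


theorem stmt_8 (r e : ℕ) (q : ℤ) (hr : 3 ≤ r) (hqr : 3 ≤ q + r) (he : q + r < e)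
    (hgcd : Int.gcd ((e : ℤ) - 1) ((r : ℤ) + q) = 1) :
    ∃ c : ℝ, 0 < c ∧ ∃ N : ℕ, ∀ n : ℕ, N ≤ n →
      ∃ H : Finset (Finset (Fin n)),
        (∀ A ∈ H, A.card = r) ∧
        c * (n : ℝ) ^ ((r : ℝ) - 1 + ((r : ℝ) + q) / ((e : ℝ) - 1)) *
          Real.log n ^ ((1 : ℝ) / ((e : ℝ) - 1)) ≤ H.card ∧
        ∀ i : ℕ, 1 ≤ i → i ≤ e → ∀ S ⊆ H, S.card = i →
          (i : ℤ) - q ≤ ((S.sup id).card : ℤ) := by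
  obtain ⟨k, rfl⟩ : ∃ k, e = k + 1 := ⟨e - 1, by omega⟩
  obtain ⟨m, hm⟩ : ∃ m : ℕ, (m : ℤ) = k - r - q := ⟨(k - r - q : ℤ).toNat, by
    rw [Int.toNat_of_nonneg]; push_cast at he; omega⟩
  have hk : 3 ≤ k := by push_cast at he; omega
  have hq : q = (k : ℤ) - r - m := by linarith
  have hgcd' : Int.gcd (k : ℤ) ((k : ℤ) - m) = 1 := by
    rw [← hgcd]; congr 1
    · push_cast; ring
    · linarith
  have hco : Nat.Coprime k m := by
    rw [← Nat.isCoprime_iff_coprime]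
    have h1 : IsCoprime (k : ℤ) ((k : ℤ) - m) := Int.isCoprime_iff_gcd_eq_one.mpr hgcd'
    obtain ⟨a, b, hab⟩ := h1
    exact ⟨a + b, -b, by linarith⟩
  have hm1 : 1 ≤ m := by
    rcases Nat.eq_zero_or_pos m with h | h
    · subst h
      simp at hco
      omega
    · exact h
  obtain ⟨c, hc, N, hN⟩ := AK.main_aux (r := r) hk hm1 hco
  refine ⟨c, hc, N, fun n hn => ?_⟩
  obtain ⟨H, hH, hconf, hcard⟩ := hN n hn
  have hk0 : (k : ℝ) ≠ 0 := by
    have : 0 < k := by omega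
    positivity
  refine ⟨H, hH.card, ?_, ?_⟩
  · have e1 : ((k + 1 : ℕ) : ℝ) - 1 = k := by push_cast; ring
    have e2 : (r : ℝ) - 1 + ((r : ℝ) + q) / k = (r : ℝ) - (m : ℝ) / k := by
      rw [hq]; push_cast; field_simp; ring
    rw [e1, e2]
    exact hcard
  · intro i hi1 hie S hS hSi
    by_contra hcon
    have hu : ((AK.un S : ℕ) : ℤ) < (i : ℤ) - q := not_le.mp hcon
    have hun0 : (AK.un S : ℤ) + 1 ≤ i - (k - r - m) := by rw [← hq]; linarith
    rcases Nat.lt_or_ge i (k + 1) with hlt | hge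
    · have h0 := hH.nonneg hS (by omega) (by omega)
      unfold AK.gg at h0
      rw [hSi] at h0
      have h1 : ((AK.un S : ℤ) - r) * k ≤ ((i : ℤ) - 1 - k + m) * k :=
        mul_le_mul_of_nonneg_right (by linarith) (Int.natCast_nonneg k)
      -- `(i - 1 - k + m) k - (i - 1) m = (i - 1 - k) (k - m)`
      have h2 : ((k : ℤ) - i + 1) * ((k : ℤ) - m) ≤ 0 := by linarith
      have h3 : 0 < ((k : ℤ) - i + 1) * ((k : ℤ) - m) :=
        mul_pos (by omega) (by push_cast at he; linarith)
      linarith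
    · have hik : i = k + 1 := by omega
      have := hconf S hS (by omega)
      omega
end
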